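/- arXiv:2404.10750 — 2 statements merged into one kernel-verified Lean document; each statement's English description precedes it below -/
import Mathlib

section
/- Let k be a positive integer and set s = ⌈k/12⌉. Every 𝒦_{2,s}-free digraph D with n vertices and more than (k−1)·n arcs contains every antidirected tree with k arcs, i.e., for every antidirected tree T with exactly k arcs there is an embedding of T in D. -/
open Finset

section Defs

variable {V W : Type*}

/-- Number of arcs of a digraph given by a Boolean adjacency relation. -/
def arcCount [Fintype V] (A : V → V → Bool) : ℕ :=
  ((univ : Finset (V × V)).filter (fun p => A p.1 p.2)).card

/-- Out-neighbourhood. -/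
def outNbr [Fintype V] (A : V → V → Bool) (a : V) : Finset V :=
  univ.filter (fun v => A a v)

/-- In-neighbourhood. -/
def inNbr [Fintype V] (A : V → V → Bool) (a : V) : Finset V :=
  univ.filter (fun v => A v a)

/-- Neighbourhood with a sign: `true` = out, `false` = in. -/
def nbr [Fintype V] (A : V → V → Bool) (sign : Bool) (a : V) : Finset V :=
  if sign then outNbr A a else inNbr A a

/-- Total degree (out-degree plus in-degree). -/
def totalDeg [Fintype V] (A : V → V → Bool) (a : V) : ℕ :=
  (outNbr A a).card + (inNbr A a).card

/-- Maximum total degree `Δ`. -/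
def maxDeg [Fintype V] (A : V → V → Bool) : ℕ :=
  univ.sup (totalDeg A)

/-- Second largest element `Δ₂` of the multiset of total degrees. -/
def secondMaxDeg [Fintype V] (A : V → V → Bool) : ℕ :=
  (((univ : Finset V).val.map (totalDeg A)).erase (maxDeg A)).sup

/-- Loopless digraph. -/
def Loopless (A : V → V → Bool) : Prop := ∀ v, ¬ A v v

/-- Antidirected digraph: no directed path with two arcs. -/
def Antidirected (A : V → V → Bool) : Prop := ∀ x y z, A x y → A y z → False

/-- The underlying (undirected) simple graph of a digraph. -/
def underG (A : V → V → Bool) : SimpleGraph V :=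
  SimpleGraph.fromRel (fun x y => A x y)

/-- `𝒦_{2,s}`-freeness: no two distinct vertices `a`, `b` together with signs and `s`
distinct vertices (all different from `a` and `b`) lying in both signed neighbourhoods. -/
def K2sFree [Fintype V] [DecidableEq V] (A : V → V → Bool) (s : ℕ) : Prop :=
  ¬ ∃ (a b : V) (sa sb : Bool) (S : Finset V), a ≠ b ∧ S.card = s ∧
      a ∉ S ∧ b ∉ S ∧ S ⊆ nbr A sa a ∩ nbr A sb b

/-- `T` embeds in `A`: there is an injective arc-preserving map. -/
def Embeds (T : W → W → Bool) (A : V → V → Bool) : Prop :=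
  ∃ f : W → V, Function.Injective f ∧ ∀ x y, T x y → A (f x) (f y)

/-- Vertices of positive out-degree. -/
def outVerts [Fintype V] (A : V → V → Bool) : Finset V :=
  univ.filter (fun v => (outNbr A v).card ≠ 0)

/-- Vertices of positive in-degree. -/
def inVerts [Fintype V] (A : V → V → Bool) : Finset V :=
  univ.filter (fun v => (inNbr A v).card ≠ 0)

/-- A caterpillar: a tree with a path such that every vertex is on the path
or adjacent to it. -/
def IsCaterpillarG {X : Type*} (G : SimpleGraph X) : Prop :=
  G.IsTree ∧ ∃ (x y : X) (P : G.Walk x y), P.IsPath ∧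
    ∀ v, v ∈ P.support ∨ ∃ w ∈ P.support, G.Adj v w

/-- Minimum pseudo-semidegree at least `m`: at least one arc, and every
out-degree and in-degree is `0` or at least `m`. -/
def MinPseudoSemidegGe [Fintype V] (A : V → V → Bool) (m : ℕ) : Prop :=
  0 < arcCount A ∧ (∀ v, (outNbr A v).card = 0 ∨ m ≤ (outNbr A v).card) ∧
    (∀ v, (inNbr A v).card = 0 ∨ m ≤ (inNbr A v).card)

/-- `D'` is a subdigraph of `D` with vertex set `S`. -/
def SubdigraphOn (D : V → V → Bool) (S : Finset V) (D' : V → V → Bool) : Prop :=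
  ∀ x y, D' x y → D x y ∧ x ∈ S ∧ y ∈ S

/-- The vertex set of the double broom `B_{uv}(T)`: the path joining `u` and `v`
together with all neighbours of `u` and all neighbours of `v`. -/
def broomSet [Fintype W] [DecidableEq W] (T : W → W → Bool) {u v : W}
    (p : (underG T).Walk u v) : Finset W :=
  p.support.toFinset ∪ (outNbr T u ∪ inNbr T u) ∪ (outNbr T v ∪ inNbr T v)

/-- `z` lies strictly after `x` and strictly before `y` in clockwise (cyclic) order
on `Fin n`. -/
def cycBetween {n : ℕ} (x y z : Fin n) : Prop :=
  if x < y then x < z ∧ z < y else x < z ∨ z < y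

/-- An arc `pq` of the convex digraph `A` on `Fin n` is good for the antidirected
caterpillar `T` with final vertex `u`, its spine neighbour `v`, and spine with
`plen` edges (so `plen + 1` spine vertices). -/
def GoodArc {n : ℕ} (A : Fin n → Fin n → Bool) (T : W → W → Bool)
    (u v : W) (plen : ℕ) (pq : Fin n × Fin n) : Prop :=
  ∃ f : W → Fin n, Function.Injective f ∧ (∀ x y, T x y → A (f x) (f y)) ∧
    ((T v u = true ∧ (f v, f u) = pq) ∨ (T u v = true ∧ (f u, f v) = pq)) ∧
    (∀ z : Fin n,
      (plen % 2 = 0 → cycBetween (f u) (f v) z → z ∉ Set.range f) ∧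
      (plen % 2 = 1 → z ≠ f u → z ≠ f v → ¬ cycBetween (f u) (f v) z →
        z ∉ Set.range f))

/-- Number of edges of a bipartite graph with parts `α`, `β`. -/
def bipArcCount {α β : Type*} [Fintype α] [Fintype β] (E : α → β → Bool) : ℕ :=
  ((univ : Finset (α × β)).filter (fun p => E p.1 p.2)).card

/-- Degree of a vertex of the `α` part. -/
def bipDegA {α β : Type*} [Fintype β] (E : α → β → Bool) (a : α) : ℕ :=
  (univ.filter (fun b => E a b)).card

/-- Degree of a vertex of the `β` part. -/
def bipDegB {α β : Type*} [Fintype α] (E : α → β → Bool) (b : β) : ℕ :=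
  (univ.filter (fun a => E a b)).card

end Defs

set_option linter.unusedSectionVars false

section Host

variable {V : Type*} [Fintype V] [DecidableEq V]

/-- Neighbourhood of `p` in the bipartite pair set `E`: `p` is read as a first coordinate when
`s = true` and as a second coordinate otherwise. -/
def nb (E : Finset (V × V)) (s : Bool) (p : V) : Finset V :=
  univ.filter (fun q => (if s then (p, q) else (q, p)) ∈ E)

lemma mem_nb_not {E : Finset (V × V)} {s : Bool} {p q : V} :
    q ∈ nb E s p ↔ p ∈ nb E (!s) q := by
  cases s <;> simp [nb]

lemma nb_mono {E E' : Finset (V × V)} (h : E' ⊆ E) (s : Bool) (p : V) :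
    nb E' s p ⊆ nb E s p := by
  intro q hq
  simp only [nb, mem_filter, mem_univ, true_and] at hq ⊢
  exact h hq

/-- Pair sets without loops in which two distinct vertices have at most `c` common neighbours. -/
structure Host (E : Finset (V × V)) (c : ℕ) : Prop where
  irrefl : ∀ s p, p ∉ nb E s p
  codeg : ∀ s s' p p', p ≠ p' → (nb E s p ∩ nb E s' p').card ≤ c

lemma Host.mono {E E' : Finset (V × V)} {c : ℕ} (hE : Host E c) (h : E' ⊆ E) : Host E' c where
  irrefl s p hp := hE.irrefl s p (nb_mono h s p hp)
  codeg s s' p p' hp :=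
    (card_le_card (inter_subset_inter (nb_mono h s p) (nb_mono h s' p'))).trans
      (hE.codeg s s' p p' hp)

/-- All nonempty neighbourhoods on side `s` have at least `m` elements. -/
def MinDeg (E : Finset (V × V)) (s : Bool) (m : ℕ) : Prop :=
  ∀ p, (nb E s p).Nonempty → m ≤ (nb E s p).card

lemma card_nb_true (E : Finset (V × V)) (p : V) :
    (nb E true p).card = (E.filter (fun e => e.1 = p)).card := by
  refine card_bij (fun q _ => (p, q)) ?_ ?_ ?_
  · simp [nb]
  · simp
  · rintro ⟨a, b⟩ h
    simp only [mem_filter] at h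
    obtain ⟨h, rfl⟩ := h
    exact ⟨b, by simpa [nb] using h, rfl⟩

lemma card_nb_false (E : Finset (V × V)) (p : V) :
    (nb E false p).card = (E.filter (fun e => e.2 = p)).card := by
  refine card_bij (fun q _ => (q, p)) ?_ ?_ ?_
  · simp [nb]
  · simp
  · rintro ⟨a, b⟩ h
    simp only [mem_filter] at h
    obtain ⟨h, rfl⟩ := h
    exact ⟨a, by simpa [nb] using h, rfl⟩

/-- Deleting vertices of small degree from a pair set with many pairs. -/
lemma prune (α β : ℕ) (E : Finset (V × V))
    (h : β * (E.image Prod.fst).card + α * (E.image Prod.snd).card < E.card) :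
    ∃ E' ⊆ E, β * (E'.image Prod.fst).card + α * (E'.image Prod.snd).card < E'.card ∧
      MinDeg E' true (β + 1) ∧ MinDeg E' false (α + 1) := by
  induction' hn : E.card using Nat.strong_induction_on with n ih generalizing E
  by_cases h1 : MinDeg E true (β + 1)
  · by_cases h2 : MinDeg E false (α + 1)
    · exact ⟨E, Subset.rfl, by omega, h1, h2⟩
    · simp only [MinDeg, not_forall, not_le, Nat.lt_succ_iff] at h2
      obtain ⟨p, ⟨q, hq⟩, hp⟩ := h2
      rw [card_nb_false] at hp
      have hqE : (q, p) ∈ E := by simpa [nb] using hq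
      have hsplit := card_filter_add_card_filter_not (s := E) (fun e => e.2 = p)
      have hi1 : ((E.filter (fun e => ¬ e.2 = p)).image Prod.fst).card ≤ (E.image Prod.fst).card :=
        card_le_card (image_subset_image (filter_subset _ _))
      have hi2 : ((E.filter (fun e => ¬ e.2 = p)).image Prod.snd).card + 1
          ≤ (E.image Prod.snd).card := by
        apply Nat.succ_le_of_lt
        apply card_lt_card
        refine ⟨image_subset_image (filter_subset _ _), fun hh => ?_⟩
        have := hh (mem_image_of_mem Prod.snd hqE)
        simp at this
      have hpos : 0 < (E.filter (fun e => e.2 = p)).card :=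
        card_pos.2 ⟨(q, p), by simp [hqE]⟩
      have m1 := Nat.mul_le_mul_left β hi1
      have m2 := Nat.mul_le_mul_left α hi2
      rw [Nat.mul_add] at m2
      obtain ⟨E', hE', hh⟩ := ih _ (by omega) (E.filter (fun e => ¬ e.2 = p)) (by omega) rfl
      exact ⟨E', hE'.trans (filter_subset _ _), hh⟩
  · simp only [MinDeg, not_forall, not_le, Nat.lt_succ_iff] at h1
    obtain ⟨p, ⟨q, hq⟩, hp⟩ := h1
    rw [card_nb_true] at hp
    have hqE : (p, q) ∈ E := by simpa [nb] using hq
    have hsplit := card_filter_add_card_filter_not (s := E) (fun e => e.1 = p)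
    have hi2 : ((E.filter (fun e => ¬ e.1 = p)).image Prod.snd).card ≤ (E.image Prod.snd).card :=
      card_le_card (image_subset_image (filter_subset _ _))
    have hi1 : ((E.filter (fun e => ¬ e.1 = p)).image Prod.fst).card + 1
        ≤ (E.image Prod.fst).card := by
      apply Nat.succ_le_of_lt
      apply card_lt_card
      refine ⟨image_subset_image (filter_subset _ _), fun hh => ?_⟩
      have := hh (mem_image_of_mem Prod.fst hqE)
      simp at this
    have hpos : 0 < (E.filter (fun e => e.1 = p)).card :=
      card_pos.2 ⟨(p, q), by simp [hqE]⟩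
    have m1 := Nat.mul_le_mul_left β hi1
    have m2 := Nat.mul_le_mul_left α hi2
    rw [Nat.mul_add] at m1
    obtain ⟨E', hE', hh⟩ := ih _ (by omega) (E.filter (fun e => ¬ e.1 = p)) (by omega) rfl
    exact ⟨E', hE'.trans (filter_subset _ _), hh⟩

/-- A vertex of at least average degree. -/
lemma exists_large_nb (E : Finset (V × V)) (m : ℕ) (h : m * (E.image Prod.fst).card < E.card) :
    ∃ w, m + 1 ≤ (nb E true w).card := by
  by_contra! hc
  have : E.card ≤ m * (E.image Prod.fst).card := by
    refine card_le_mul_card_image (f := (Prod.fst : V × V → V)) E m (fun w _ => ?_)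
    rw [← card_nb_true]
    have := hc w
    omega
  omega

lemma prune_trade {E : Finset (V × V)} {α β : ℕ} (t : ℕ) (ht : t ≤ β)
    (hp : (E.image Prod.snd).card ≤ (E.image Prod.fst).card)
    (h : β * (E.image Prod.fst).card + α * (E.image Prod.snd).card < E.card) :
    (β - t) * (E.image Prod.fst).card + (α + t) * (E.image Prod.snd).card < E.card := by
  obtain ⟨r, rfl⟩ := Nat.exists_eq_add_of_le ht
  have := Nat.mul_le_mul_left t hp
  simp only [Nat.add_sub_cancel_left]
  nlinarith

lemma exists_large_nb_of_le {E : Finset (V × V)} {α β : ℕ}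
    (hp : (E.image Prod.fst).card ≤ (E.image Prod.snd).card)
    (h : β * (E.image Prod.fst).card + α * (E.image Prod.snd).card < E.card) :
    ∃ w, α + β + 1 ≤ (nb E true w).card := by
  apply exists_large_nb
  have := Nat.mul_le_mul_left α hp
  nlinarith

end Host

section RTree

/-- Rooted trees given by a parent function and a depth function. -/
structure RTree (W : Type*) where
  root : W
  par : W → W
  dep : W → ℕ
  dep_root : dep root = 0
  dep_par : ∀ y, y ≠ root → dep y = dep (par y) + 1

namespace RTree

variable {W : Type*} [Fintype W] [DecidableEq W] (t : RTree W)

/-- The side of a vertex in the bipartition, `true` for the root. -/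
def side (y : W) : Bool := t.dep y % 2 == 0

lemma side_root : t.side t.root = true := by simp [side, t.dep_root]

lemma side_par {y : W} (hy : y ≠ t.root) : t.side y = !t.side (t.par y) := by
  simp only [side, t.dep_par y hy]
  rcases Nat.mod_two_eq_zero_or_one (t.dep (t.par y)) with h | h <;>
    simp [Nat.add_mod, h]

/-- The children of a vertex. -/
def kids (x : W) : Finset W := univ.filter (fun y => y ≠ t.root ∧ t.par y = x)

variable {t}

lemma mem_kids {x y : W} : y ∈ t.kids x ↔ y ≠ t.root ∧ t.par y = x := by simp [kids]

lemma par_ne {y : W} (hy : y ≠ t.root) : t.par y ≠ y := fun h => by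
  have := t.dep_par y hy
  rw [h] at this
  omega

lemma kids_disjoint {x x' : W} (h : x ≠ x') : Disjoint (t.kids x) (t.kids x') := by
  rw [disjoint_left]
  intro y hy hy'
  exact h ((mem_kids.1 hy).2.symm.trans (mem_kids.1 hy').2)

lemma sum_kids (S : Finset W) :
    (S.biUnion t.kids).card = ∑ x ∈ S, (t.kids x).card :=
  card_biUnion (fun _ _ _ _ h => kids_disjoint h)

variable (t)

/-- Sets of vertices closed under taking parents. -/
def Closed (P : Finset W) : Prop := t.root ∈ P ∧ ∀ y ∈ P, y ≠ t.root → t.par y ∈ P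

variable {t}

lemma Closed.insert {P : Finset W} (hP : t.Closed P) {y : W} (hy : t.par y ∈ P) :
    t.Closed (insert y P) := by
  refine ⟨mem_insert_of_mem hP.1, fun z hz hz0 => ?_⟩
  rcases mem_insert.1 hz with rfl | hz
  · exact mem_insert_of_mem hy
  · exact mem_insert_of_mem (hP.2 z hz hz0)

/-- In a nonempty upward unfinished situation there is an unplaced vertex with placed parent;
moreover it can be found in any parent-closed complement. -/
lemma Closed.exists_next {P : Finset W} (hP : t.Closed P) {y : W} (hy : y ∉ P) :
    ∃ z, z ∉ P ∧ t.par z ∈ P ∧ (z = y ∨ ∃ z', z' ≠ t.root ∧ t.par z' = z) := by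
  induction' hn : t.dep y using Nat.strong_induction_on with n ih generalizing y
  have hy0 : y ≠ t.root := fun h => hy (h ▸ hP.1)
  by_cases h : t.par y ∈ P
  · exact ⟨y, hy, h, Or.inl rfl⟩
  · obtain ⟨z, h1, h2, h3⟩ := ih (t.dep (t.par y)) (by have := t.dep_par y hy0; omega) h rfl
    refine ⟨z, h1, h2, ?_⟩
    rcases h3 with rfl | h3
    · exact Or.inr ⟨y, hy0, rfl⟩
    · exact Or.inr h3

end RTree

end RTree

section PE

variable {V W : Type*} [Fintype V] [DecidableEq V] [Fintype W] [DecidableEq W]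

/-- Partial embeddings of a rooted tree in a pair set. -/
structure PE (t : RTree W) (E : Finset (V × V)) (P : Finset W) (f : W → V) : Prop where
  closed : t.Closed P
  inj : Set.InjOn f P
  adj : ∀ y ∈ P, y ≠ t.root → f y ∈ nb E (t.side (t.par y)) (f (t.par y))

variable {t : RTree W} {E : Finset (V × V)} {P : Finset W} {f : W → V}

lemma image_update {y : W} (hy : y ∉ P) (v : V) :
    (insert y P).image (Function.update f y v) = insert v (P.image f) := by
  rw [image_insert, Function.update_self]
  congr 1
  exact image_congr (fun z hz => Function.update_of_ne (by rintro rfl; exact hy hz) _ _)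

lemma PE.card_image (h : PE t E P f) : (P.image f).card = P.card := card_image_of_injOn h.inj

lemma PE.extend (h : PE t E P f) {y : W} (hy : y ∉ P) (hp : t.par y ∈ P) {v : V}
    (hv : v ∈ nb E (t.side (t.par y)) (f (t.par y))) (hvP : v ∉ P.image f) :
    PE t E (insert y P) (Function.update f y v) := by
  have hne : ∀ z ∈ P, z ≠ y := by rintro z hz rfl; exact hy hz
  refine ⟨h.closed.insert hp, ?_, ?_⟩
  · intro a ha b hb hab
    simp only [coe_insert, Set.mem_insert_iff, mem_coe] at ha hb
    rcases ha with rfl | ha <;> rcases hb with rfl | hb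
    · rfl
    · rw [Function.update_self, Function.update_of_ne (hne b hb)] at hab
      exact absurd (mem_image.2 ⟨b, hb, hab.symm⟩) hvP
    · rw [Function.update_self, Function.update_of_ne (hne a ha)] at hab
      exact absurd (mem_image.2 ⟨a, ha, hab⟩) hvP
    · rw [Function.update_of_ne (hne a ha), Function.update_of_ne (hne b hb)] at hab
      exact h.inj ha hb hab
  · intro z hz hz0
    rcases mem_insert.1 hz with rfl | hz
    · rwa [Function.update_self, Function.update_of_ne (hne _ hp)]
    · rw [Function.update_of_ne (hne z hz), Function.update_of_ne (hne _ (h.closed.2 z hz hz0))]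
      exact h.adj z hz hz0

lemma PE.base (t : RTree W) (E : Finset (V × V)) (w : V) : PE t E {t.root} (fun _ => w) := by
  refine ⟨⟨by simp, fun y hy h => absurd (mem_singleton.1 hy) h⟩, by simp, ?_⟩
  intro y hy h
  exact absurd (mem_singleton.1 hy) h

/-- The abstract embedding goal. -/
def EmbedsRT (t : RTree W) (E : Finset (V × V)) : Prop :=
  ∃ f : W → V, Function.Injective f ∧
    ∀ y, y ≠ t.root → f y ∈ nb E (t.side (t.par y)) (f (t.par y))

lemma PE.embeds (h : PE t E univ f) : EmbedsRT t E :=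
  ⟨f, fun a b hab => h.inj (by simp) (by simp) hab, fun y => h.adj y (mem_univ y)⟩

lemma embeds_of_extend (Inv : Finset W → (W → V) → Prop) (hPE : ∀ P f, Inv P f → PE t E P f)
    (hstep : ∀ P f, Inv P f → P ≠ univ → ∃ P' f', P.card < P'.card ∧ Inv P' f')
    (h0 : Inv P f) : EmbedsRT t E := by
  induction' hn : Fintype.card W - P.card using Nat.strong_induction_on with n ih generalizing P f
  by_cases hP : P = univ
  · subst hP
    exact (hPE _ _ h0).embeds
  · obtain ⟨P', f', hlt, hI⟩ := hstep P f h0 hP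
    have := card_le_univ P'
    exact ih _ (by omega) hI rfl

/-- The neighbourhood of any vertex in the image of a partial embedding, for the tree
neighbours. -/
lemma PE.adj' (h : PE t E P f) {y : W} (hy : y ∈ P) (h0 : y ≠ t.root) :
    f (t.par y) ∈ nb E (t.side y) (f y) := by
  rw [t.side_par h0, ← mem_nb_not]
  exact h.adj y hy h0

end PE

section Greedy

variable {V W : Type*} [Fintype V] [DecidableEq V] [Fintype W] [DecidableEq W]
  {t : RTree W} {E : Finset (V × V)} {P : Finset W} {f : W → V}

lemma RTree.Closed.exists_root_kid (hP : t.Closed P) {x : W} (hx : x ∈ P) (hx0 : x ≠ t.root) :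
    ∃ z ∈ P, z ≠ t.root ∧ t.par z = t.root := by
  induction' hn : t.dep x using Nat.strong_induction_on with n ih generalizing x
  by_cases h : t.par x = t.root
  · exact ⟨x, hx, hx0, h⟩
  · exact ih (t.dep (t.par x)) (by have := t.dep_par x hx0; omega) (hP.2 x hx hx0) h rfl

lemma PE.nonempty (h : PE t E P f) (h0 : (nb E true (f t.root)).Nonempty) {x : W} (hx : x ∈ P) :
    (nb E (t.side x) (f x)).Nonempty := by
  by_cases hx0 : x = t.root
  · subst hx0
    rwa [t.side_root]
  · exact ⟨_, h.adj' hx hx0⟩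

lemma not_mem_inter_of_codeg_zero (hE : Host E 0) {s s' : Bool} {p p' q : V} (h : q ∈ nb E s p)
    (h' : q ∈ nb E s' p') : p = p' := by
  by_contra hne
  have := hE.codeg s s' p p' hne
  have : 0 < (nb E s p ∩ nb E s' p').card := card_pos.2 ⟨q, mem_inter.2 ⟨h, h'⟩⟩
  omega

lemma PE.nb_inter_of_codeg_zero (hE : Host E 0) (h : PE t E P f) {x : W} (hx : x ∈ P) {q : W}
    (hq : q ∈ P) (hqx : f q ∈ nb E (t.side x) (f x)) :
    q ∈ t.kids x ∨ (x ≠ t.root ∧ q = t.par x) := by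
  by_cases hq0 : q = t.root
  · subst hq0
    right
    have hx0 : x ≠ t.root := by
      rintro rfl
      exact hE.irrefl _ _ hqx
    refine ⟨hx0, ?_⟩
    obtain ⟨z, hz, hz0, hzr⟩ := h.closed.exists_root_kid hx hx0
    have h1 := h.adj' hz hz0
    rw [hzr] at h1
    have := h.inj hx hz (not_mem_inter_of_codeg_zero hE hqx h1)
    rw [this, hzr]
  · left
    have h1 := h.adj q hq hq0
    have := h.inj hx (h.closed.2 q hq hq0) (not_mem_inter_of_codeg_zero hE hqx h1)
    exact RTree.mem_kids.2 ⟨hq0, this.symm⟩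

/-- Greedy embedding when distinct vertices have no common neighbours. -/
lemma embeds_of_codeg_zero (hE : Host E 0) {a b : ℕ} (hb : MinDeg E true b) (ha : MinDeg E false a)
    {w : V} (hw : (nb E true w).Nonempty) (hroot : (t.kids t.root).card ≤ b)
    (hy : ∀ y, y ≠ t.root → (t.kids y).card + 1 ≤ b ∧ (t.kids y).card + 1 ≤ a) :
    EmbedsRT t E := by
  refine embeds_of_extend (fun P f => PE t E P f ∧ (nb E true (f t.root)).Nonempty)
    (fun P f h => h.1) ?_ (P := {t.root}) (f := fun _ => w) ⟨PE.base t E w, hw⟩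
  rintro P f ⟨h, h0⟩ hP
  obtain ⟨y', hy'⟩ : ∃ y, y ∉ P := by
    by_contra! hc
    exact hP (eq_univ_of_forall hc)
  obtain ⟨y, hyP, hpar, -⟩ := h.closed.exists_next hy'
  have hy0 : y ≠ t.root := fun hh => hyP (hh ▸ h.closed.1)
  have key : ∃ v ∈ nb E (t.side (t.par y)) (f (t.par y)), v ∉ P.image f := by
    by_contra! hc
    have hne := h.nonempty h0 hpar
    set x := t.par y with hx
    have hsub : nb E (t.side x) (f x) ⊆ ((t.kids x).erase y ∪
        (if x = t.root then ∅ else {t.par x})).image f := by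
      intro v hv
      obtain ⟨q, hq, rfl⟩ := mem_image.1 (hc v hv)
      apply mem_image_of_mem
      rcases h.nb_inter_of_codeg_zero hE hpar hq hv with h1 | ⟨h1, h2⟩
      · exact mem_union_left _ (mem_erase.2 ⟨by rintro rfl; exact hyP hq, h1⟩)
      · rw [if_neg h1, h2]
        exact mem_union_right _ (mem_singleton_self _)
    have h1 := (card_le_card hsub).trans (card_image_le.trans (card_union_le _ _))
    have hyk : y ∈ t.kids x := RTree.mem_kids.2 ⟨hy0, rfl⟩
    have h2 := card_erase_of_mem hyk
    have h3 : 0 < (t.kids x).card := card_pos.2 ⟨y, hyk⟩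
    by_cases hx0 : x = t.root
    · rw [if_pos hx0, card_empty] at h1
      rw [hx0, t.side_root] at h1 hne
      have := hb _ hne
      rw [hx0] at h2 h3
      omega
    · rw [if_neg hx0, card_singleton] at h1
      obtain ⟨h4, h5⟩ := hy x hx0
      cases hs : t.side x
      · rw [hs] at h1 hne
        have := ha _ hne
        omega
      · rw [hs] at h1 hne
        have := hb _ hne
        omega
  obtain ⟨v, hv, hvP⟩ := key
  refine ⟨insert y P, Function.update f y v, ?_, h.extend hyP hpar hv hvP, ?_⟩
  · rw [card_insert_of_notMem hyP]; omega
  · rwa [Function.update_of_ne hy0.symm]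

end Greedy

section Counting

variable {W : Type*} [Fintype W] [DecidableEq W] {t : RTree W}

lemma RTree.sum_kids_univ : ∑ x, (t.kids x).card + 1 = Fintype.card W := by
  have h : (univ : Finset W).biUnion t.kids = univ.erase t.root := by
    ext y
    simp [RTree.mem_kids]
  rw [← RTree.sum_kids, h, card_erase_of_mem (mem_univ _), card_univ]
  have : 0 < Fintype.card W := Fintype.card_pos_iff.2 ⟨t.root⟩
  omega

lemma RTree.sum_kids_le (S : Finset W) : ∑ x ∈ S, (t.kids x).card + 1 ≤ Fintype.card W := by
  rw [← RTree.sum_kids_univ (t := t)]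
  exact Nat.add_le_add_right (sum_le_sum_of_subset (subset_univ S)) 1

variable (t)

/-- The leaves among the children of the root. -/
def RTree.rootLeaves : Finset W := (t.kids t.root).filter (fun y => t.kids y = ∅)

variable {t}

lemma RTree.mem_rootLeaves {y : W} :
    y ∈ t.rootLeaves ↔ (y ≠ t.root ∧ t.par y = t.root) ∧ t.kids y = ∅ := by
  simp [RTree.rootLeaves, RTree.mem_kids]

lemma RTree.card_sdiff_rootLeaves :
    (t.kids t.root \ t.rootLeaves).card + (t.kids t.root).card + 1 ≤ Fintype.card W := by
  have h1 : t.root ∉ t.kids t.root \ t.rootLeaves := by simp [RTree.mem_kids]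
  have h2 := RTree.sum_kids_le (t := t) (insert t.root (t.kids t.root \ t.rootLeaves))
  rw [sum_insert h1] at h2
  have h3 : (t.kids t.root \ t.rootLeaves).card
      ≤ ∑ x ∈ t.kids t.root \ t.rootLeaves, (t.kids x).card := by
    rw [card_eq_sum_ones]
    refine sum_le_sum (fun x hx => ?_)
    rw [mem_sdiff, RTree.mem_rootLeaves] at hx
    apply Nat.one_le_iff_ne_zero.2
    intro h0
    exact hx.2 ⟨RTree.mem_kids.1 hx.1, card_eq_zero.1 h0⟩
  omega

lemma RTree.not_mem_rootLeaves_par {y : W} (hy : y ≠ t.root) : t.par y ∉ t.rootLeaves := by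
  intro h
  have h1 := (RTree.mem_rootLeaves.1 h).2
  have : y ∈ t.kids (t.par y) := RTree.mem_kids.2 ⟨hy, rfl⟩
  rw [h1] at this
  simp at this

lemma RTree.Closed.exists_next_not_rootLeaves {P : Finset W} (hP : t.Closed P) {y : W} (hy : y ∉ P)
    (hyL : y ∉ t.rootLeaves) : ∃ z, z ∉ P ∧ t.par z ∈ P ∧ z ∉ t.rootLeaves ∧ z ≠ t.root := by
  obtain ⟨z, h1, h2, h3⟩ := hP.exists_next hy
  refine ⟨z, h1, h2, ?_, fun hh => h1 (hh ▸ hP.1)⟩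
  rcases h3 with rfl | ⟨z', h4, rfl⟩
  · exact hyL
  · exact RTree.not_mem_rootLeaves_par h4

end Counting

section LargeRoot

variable {V W : Type*} [Fintype V] [DecidableEq V] [Fintype W] [DecidableEq W]
  {t : RTree W} {E E' : Finset (V × V)} {P : Finset W} {f : W → V}

lemma exists_mem_not_mem_of_subset_image {N : Finset V} {S : Finset W} {U : Finset V}
    (hsub : ∀ v ∈ N, v ∈ U → v ∈ S.image f) (h : S.card < N.card) : ∃ v ∈ N, v ∉ U := by
  by_contra! hc
  have h1 : N ⊆ S.image f := fun v hv => hsub v hv (hc v hv)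
  have := (card_le_card h1).trans card_image_le
  omega

/-- The embedding when the root is large and the odd side can be given larger degrees. -/
lemma embeds_of_large_root_of_trade {k c : ℕ} (hW : Fintype.card W = k + 1) (hE : Host E c)
    (hE' : E' ⊆ E) (hbig : k + 2 * c + 1 ≤ 2 * (t.kids t.root).card)
    (hb : MinDeg E true (t.kids t.root).card)
    (hb' : MinDeg E' true ((t.kids t.root).card - c))
    (ha' : MinDeg E' false (k + 1 - (t.kids t.root).card + c))
    {w : V} (hw : (nb E' true w).Nonempty) : EmbedsRT t E := by
  set κ := (t.kids t.root).card with hκ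
  have hL := RTree.card_sdiff_rootLeaves (t := t)
  refine embeds_of_extend (fun P f => PE t E P f ∧
    (∀ y ∈ P, y ∉ t.rootLeaves → (nb E' (t.side y) (f y)).Nonempty) ∧
    (∀ y ∈ P, y ≠ t.root → f y ∈ nb E true (f t.root) → t.par y = t.root) ∧
    ((∃ y ∈ P, y ∈ t.rootLeaves) → ∀ y, y ∉ t.rootLeaves → y ∈ P))
    (fun P f h => h.1) ?_ (P := {t.root}) (f := fun _ => w) ⟨PE.base t E w, ?_, ?_, ?_⟩
  rotate_left
  · intro y hy _
    rw [mem_singleton.1 hy, t.side_root]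
    exact hw
  · intro y hy h0
    exact absurd (mem_singleton.1 hy) h0
  · rintro ⟨y, hy, h0⟩
    exact absurd (mem_singleton.1 hy) (RTree.mem_rootLeaves.1 h0).1.1
  rintro P f ⟨h, hval, hN, hord⟩ hP
  have hroot := h.closed.1
  have hrL : t.root ∉ t.rootLeaves := fun hh => (RTree.mem_rootLeaves.1 hh).1.1 rfl
  have hwne := hval _ hroot hrL
  rw [t.side_root] at hwne
  have hwne' : (nb E true (f t.root)).Nonempty := hwne.mono (nb_mono hE' _ _)
  have hupd : ∀ {y : W} {v : V}, y ∉ P → ∀ z ∈ P, Function.update f y v z = f z := by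
    intro y v hy z hz
    exact Function.update_of_ne (by rintro rfl; exact hy hz) _ _
  by_cases hA : ∃ y, y ∉ P ∧ y ∉ t.rootLeaves
  · obtain ⟨y', hy', hy'L⟩ := hA
    obtain ⟨y, hyP, hpar, hyL, hy0⟩ := h.closed.exists_next_not_rootLeaves hy' hy'L
    have hnoL : ∀ z ∈ P, z ∉ t.rootLeaves := fun z hz hzL => hyP (hord ⟨z, hz, hzL⟩ y hyL)
    have key : ∃ v ∈ nb E' (t.side (t.par y)) (f (t.par y)), v ∉ P.image f ∧
        (v ∈ nb E true (f t.root) → t.par y = t.root) := by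
      by_cases hx : t.par y = t.root
      · have hlt : ((t.kids t.root \ t.rootLeaves).erase y).card
            < (nb E' true (f t.root)).card := by
          have := hb' _ hwne
          have h1 : y ∈ t.kids t.root \ t.rootLeaves :=
            mem_sdiff.2 ⟨RTree.mem_kids.2 ⟨hy0, hx⟩, hyL⟩
          have := card_erase_of_mem h1
          have : 0 < (t.kids t.root \ t.rootLeaves).card := card_pos.2 ⟨_, h1⟩
          omega
        obtain ⟨v, hv, hvU⟩ := exists_mem_not_mem_of_subset_image (f := f) (U := P.image f)
          (fun v hv hvU => by
            obtain ⟨q, hq, rfl⟩ := mem_image.1 hvU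
            have hv' := nb_mono hE' _ _ hv
            have hq0 : q ≠ t.root := by
              rintro rfl
              exact hE.irrefl _ _ hv'
            refine mem_image_of_mem _ (mem_erase.2 ⟨by rintro rfl; exact hyP hq, mem_sdiff.2
              ⟨RTree.mem_kids.2 ⟨hq0, hN q hq hq0 hv'⟩, hnoL q hq⟩⟩)) hlt
        rw [hx, t.side_root]
        exact ⟨v, hv, hvU, fun _ => rfl⟩
      · have hxne := hval _ hpar (RTree.not_mem_rootLeaves_par hy0)
        have hne : f (t.par y) ≠ f t.root := fun hh => hx (h.inj hpar hroot hh)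
        have hcod := hE.codeg (t.side (t.par y)) true _ _ hne
        have hcod' : (nb E' (t.side (t.par y)) (f (t.par y)) ∩ nb E true (f t.root)).card ≤ c :=
          (card_le_card (inter_subset_inter (nb_mono hE' _ _) Subset.rfl)).trans hcod
        have hsd := card_sdiff_add_card_inter (nb E' (t.side (t.par y)) (f (t.par y)))
          (nb E true (f t.root))
        have hdeg : k + 1 - κ + c ≤ (nb E' (t.side (t.par y)) (f (t.par y))).card := by
          cases hs : t.side (t.par y)
          · rw [hs] at hxne
            exact ha' _ hxne
          · rw [hs] at hxne
            have := hb' _ hxne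
            omega
        have hyc : y ∈ (t.kids t.root)ᶜ := by
          simp [RTree.mem_kids, hx]
        have hlt : ((t.kids t.root)ᶜ.erase y).card
            < (nb E' (t.side (t.par y)) (f (t.par y)) \ nb E true (f t.root)).card := by
          rw [card_erase_of_mem hyc, card_compl, hW]
          have : κ ≤ k := by omega
          omega
        obtain ⟨v, hv, hvU⟩ := exists_mem_not_mem_of_subset_image (f := f) (U := P.image f)
          (fun v hv hvU => by
            obtain ⟨q, hq, rfl⟩ := mem_image.1 hvU
            refine mem_image_of_mem _ (mem_erase.2 ⟨by rintro rfl; exact hyP hq, ?_⟩)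
            rw [mem_compl, RTree.mem_kids]
            rintro ⟨hq0, hqr⟩
            have := h.adj q hq hq0
            rw [hqr, t.side_root] at this
            exact (mem_sdiff.1 hv).2 this) hlt
        exact ⟨v, (mem_sdiff.1 hv).1, hvU, fun hh => absurd hh (mem_sdiff.1 hv).2⟩
    obtain ⟨v, hv, hvU, hvN⟩ := key
    refine ⟨insert y P, Function.update f y v, by rw [card_insert_of_notMem hyP]; omega,
      h.extend hyP hpar (nb_mono hE' _ _ hv) hvU, ?_, ?_, ?_⟩
    · intro z hz hzL
      rcases mem_insert.1 hz with rfl | hz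
      · rw [Function.update_self, t.side_par hy0]
        exact ⟨_, mem_nb_not.1 hv⟩
      · rw [hupd hyP z hz]
        exact hval z hz hzL
    · intro z hz hz0 hzv
      rw [hupd hyP _ hroot] at hzv
      rcases mem_insert.1 hz with rfl | hz
      · rw [Function.update_self] at hzv
        exact hvN hzv
      · rw [hupd hyP z hz] at hzv
        exact hN z hz hz0 hzv
    · rintro ⟨z, hz, hzL⟩
      rcases mem_insert.1 hz with rfl | hz
      · exact absurd hzL hyL
      · exact absurd hzL (hnoL z hz)
  · push Not at hA
    obtain ⟨y, hyP⟩ : ∃ y, y ∉ P := by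
      by_contra! hc
      exact hP (eq_univ_of_forall hc)
    have hyL := hA y hyP
    obtain ⟨⟨hy0, hyr⟩, hyk⟩ := RTree.mem_rootLeaves.1 hyL
    have hlt : ((t.kids t.root).erase y).card < (nb E true (f t.root)).card := by
      have := hb _ hwne'
      have h1 : y ∈ t.kids t.root := RTree.mem_kids.2 ⟨hy0, hyr⟩
      have := card_erase_of_mem h1
      omega
    obtain ⟨v, hv, hvU⟩ := exists_mem_not_mem_of_subset_image (f := f) (U := P.image f)
      (fun v hv hvU => by
        obtain ⟨q, hq, rfl⟩ := mem_image.1 hvU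
        have hq0 : q ≠ t.root := by
          rintro rfl
          exact hE.irrefl _ _ hv
        exact mem_image_of_mem _ (mem_erase.2 ⟨by rintro rfl; exact hyP hq,
          RTree.mem_kids.2 ⟨hq0, hN q hq hq0 hv⟩⟩)) hlt
    refine ⟨insert y P, Function.update f y v, by rw [card_insert_of_notMem hyP]; omega,
      h.extend hyP (hyr ▸ hroot) (by rwa [hyr, t.side_root]) hvU, ?_, ?_, ?_⟩
    · intro z hz hzL
      rcases mem_insert.1 hz with rfl | hz
      · exact absurd hyL hzL
      · rw [hupd hyP z hz]
        exact hval z hz hzL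
    · intro z hz hz0 hzv
      rw [hupd hyP _ hroot] at hzv
      rcases mem_insert.1 hz with rfl | hz
      · exact hyr
      · rw [hupd hyP z hz] at hzv
        exact hN z hz hz0 hzv
    · intro _ z hzL
      by_contra hz
      exact hzL (hA z (fun hh => hz (mem_insert_of_mem hh)))

end LargeRoot

section LargeRootMatched

variable {V W : Type*} [Fintype V] [DecidableEq V] [Fintype W] [DecidableEq W]
  {t : RTree W} {E E' : Finset (V × V)} {P : Finset W} {f : W → V}

lemma Host.double_count {c : ℕ} (hE : Host E c) {C U : Finset V} {p : V} {s : Bool}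
    (hC : C ⊆ nb E s p) (hU : p ∉ U) {s' : Bool} {m : ℕ}
    (h : ∀ v ∈ C, m ≤ (nb E s' v ∩ U).card) : C.card * m ≤ U.card * c := by
  refine card_mul_le_card_mul (fun v q => q ∈ nb E s' v) (fun v hv => ?_) (fun q hq => ?_)
  · refine (h v hv).trans (card_le_card (fun q hq => ?_))
    rw [mem_inter] at hq
    simp [bipartiteAbove, hq]
  · have hne : p ≠ q := by rintro rfl; exact hU hq
    refine (card_le_card (fun v hv => ?_)).trans (hE.codeg s (!s') p q hne)
    simp only [bipartiteBelow, mem_filter] at hv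
    exact mem_inter.2 ⟨hC hv.1, mem_nb_not.1 hv.2⟩

/-- The children that have not been placed yet. -/
def RTree.pend (t : RTree W) (P : Finset W) (x : W) : Finset W := t.kids x \ P

lemma RTree.mem_pend {x y : W} : y ∈ t.pend P x ↔ (y ≠ t.root ∧ t.par y = x) ∧ y ∉ P := by
  simp [RTree.pend, RTree.mem_kids]

lemma RTree.pend_insert (x y : W) : t.pend (insert y P) x = (t.pend P x).erase y := by
  ext z
  simp only [RTree.mem_pend, mem_erase, mem_insert]
  tauto

lemma RTree.pend_subset (x : W) : t.pend P x ⊆ t.kids x := sdiff_subset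

lemma RTree.Closed.pend_eq_kids (hP : t.Closed P) {y : W} (hy : y ∉ P) : t.pend P y = t.kids y := by
  refine Subset.antisymm (RTree.pend_subset y) (fun z hz => ?_)
  rw [RTree.mem_kids] at hz
  refine RTree.mem_pend.2 ⟨hz, fun hzP => hy ?_⟩
  rw [← hz.2]
  exact hP.2 z hzP hz.1

lemma update_of_mem {y : W} {v : V} (hy : y ∉ P) {z : W} (hz : z ∈ P) :
    Function.update f y v z = f z :=
  Function.update_of_ne (by rintro rfl; exact hy hz) _ _

set_option maxHeartbeats 1000000 in
/-- The embedding when the root is large and some vertex has degree at least the size of the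
tree. -/
lemma embeds_of_large_root_of_matched {k c : ℕ} (hW : Fintype.card W = k + 1) (hE : Host E c)
    (hk : 12 * c + 1 ≤ k) (hbig : k + 2 * c + 1 ≤ 2 * (t.kids t.root).card)
    (hb : MinDeg E true (t.kids t.root).card)
    (ha : MinDeg E false (k + 1 - (t.kids t.root).card))
    {w : V} (hw : k ≤ (nb E true w).card) : EmbedsRT t E := by
  set κ := (t.kids t.root).card with hκ
  have hκk : κ ≤ k := by
    have := RTree.sum_kids_le (t := t) {t.root}
    rw [sum_singleton] at this
    omega
  refine embeds_of_extend (fun P f => PE t E P f ∧ k ≤ (nb E true (f t.root)).card ∧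
    (∀ x ∈ P, t.side x = false → ∀ x' ∈ P, t.side x' = false → (t.pend P x).Nonempty →
      (t.pend P x').Nonempty → x = x') ∧
    (∀ x ∈ P, t.side x = false → (t.pend P x).card ≤ (nb E false (f x) \ P.image f).card) ∧
    ((∃ y ∈ P, y ∈ t.rootLeaves) → ∀ y, y ∉ t.rootLeaves → y ∈ P))
    (fun P f h => h.1) ?_ (P := {t.root}) (f := fun _ => w) ⟨PE.base t E w, hw, ?_, ?_, ?_⟩
  rotate_left
  · intro x hx hs
    rw [mem_singleton.1 hx, t.side_root] at hs
    simp at hs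
  · intro x hx hs
    rw [mem_singleton.1 hx, t.side_root] at hs
    simp at hs
  · rintro ⟨y, hy, h0⟩
    exact absurd (mem_singleton.1 hy) (RTree.mem_rootLeaves.1 h0).1.1
  rintro P f ⟨h, hw, hone, hpend, hord⟩ hP
  have hroot := h.closed.1
  by_cases hi : ∃ x ∈ P, t.side x = false ∧ (t.pend P x).Nonempty
  · obtain ⟨x, hxP, hxs, y, hy⟩ := hi
    have hle := hpend x hxP hxs
    obtain ⟨⟨hy0, hyx⟩, hyP⟩ := RTree.mem_pend.1 hy
    have hx0 : x ≠ t.root := by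
      rintro rfl
      rw [t.side_root] at hxs
      simp at hxs
    have hyL : y ∉ t.rootLeaves := fun hh => hx0 (hyx ▸ (RTree.mem_rootLeaves.1 hh).1.2)
    have hnoL : ∀ z ∈ P, z ∉ t.rootLeaves := fun z hz hzL => hyP (hord ⟨z, hz, hzL⟩ y hyL)
    have hys : t.side y = true := by rw [t.side_par hy0, hyx, hxs]; rfl
    obtain ⟨v, hv⟩ : (nb E false (f x) \ P.image f).Nonempty := by
      rw [← card_pos]
      exact lt_of_lt_of_le (card_pos.2 ⟨y, hy⟩) hle
    rw [mem_sdiff] at hv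
    refine ⟨insert y P, Function.update f y v, by rw [card_insert_of_notMem hyP]; omega,
      h.extend hyP (hyx ▸ hxP) (by rw [hyx, hxs]; exact hv.1) hv.2, ?_, ?_, ?_, ?_⟩
    · rwa [update_of_mem hyP hroot]
    · intro z hz hzs z' hz' hzs' hp hp'
      rw [RTree.pend_insert] at hp hp'
      have h1 : z ∈ P := by
        rcases mem_insert.1 hz with rfl | hz
        · rw [hys] at hzs; simp at hzs
        · exact hz
      have h2 : z' ∈ P := by
        rcases mem_insert.1 hz' with rfl | hz'
        · rw [hys] at hzs'; simp at hzs'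
        · exact hz'
      exact hone z h1 hzs z' h2 hzs' (hp.mono (erase_subset _ _)) (hp'.mono (erase_subset _ _))
    · intro z hz hzs
      have hzP : z ∈ P := by
        rcases mem_insert.1 hz with rfl | hz
        · rw [hys] at hzs; simp at hzs
        · exact hz
      rw [RTree.pend_insert, image_update hyP, update_of_mem hyP hzP]
      rcases (t.pend P z).eq_empty_or_nonempty with he | hne
      · rw [he]; simp
      · obtain rfl := hone z hzP hzs x hxP hxs hne ⟨y, hy⟩
        rw [card_erase_of_mem hy, sdiff_insert, card_erase_of_mem (mem_sdiff.2 hv)]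
        omega
    · rintro ⟨z, hz, hzL⟩
      rcases mem_insert.1 hz with rfl | hz
      · exact absurd hzL hyL
      · exact absurd hzL (hnoL z hz)
  push Not at hi
  by_cases hA : ∃ y, y ∉ P ∧ y ∉ t.rootLeaves
  · obtain ⟨y', hy', hy'L⟩ := hA
    obtain ⟨y, hyP, hpar, hyL, hy0⟩ := h.closed.exists_next_not_rootLeaves hy' hy'L
    have hnoL : ∀ z ∈ P, z ∉ t.rootLeaves := fun z hz hzL => hyP (hord ⟨z, hz, hzL⟩ y hyL)
    set x := t.par y with hx
    have hxs : t.side x = true := by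
      by_contra hs
      have hs' : t.side x = false := by simpa using hs
      have := hi x hpar hs'
      have hy : y ∈ t.pend P x := RTree.mem_pend.2 ⟨⟨hy0, rfl⟩, hyP⟩
      rw [this] at hy
      simp at hy
    have hys : t.side y = false := by rw [t.side_par hy0, ← hx, hxs]; rfl
    -- the placed children of the root, and the other placed vertices
    set A := P.filter (fun q => q ∈ t.kids t.root) with hAdef
    set B := (P.erase t.root).filter (fun q => q ∉ t.kids t.root) with hBdef
    have hPc : P.card = 1 + B.card + A.card := by
      have h1 : (P.erase t.root).filter (fun q => q ∈ t.kids t.root) = A := by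
        ext q
        simp only [hAdef, mem_filter, mem_erase]
        constructor
        · rintro ⟨⟨_, h1⟩, h2⟩; exact ⟨h1, h2⟩
        · rintro ⟨h1, h2⟩; exact ⟨⟨(RTree.mem_kids.1 h2).1, h1⟩, h2⟩
      have h2 := card_filter_add_card_filter_not (s := P.erase t.root)
        (fun q => q ∈ t.kids t.root)
      rw [h1, card_erase_of_mem hroot] at h2
      change A.card + B.card = _ at h2
      have : 0 < P.card := card_pos.2 ⟨_, hroot⟩
      omega
    have hAB : A.card ≤ B.card := by
      have h1 : A.card ≤ (A.biUnion t.kids).card := by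
        rw [RTree.sum_kids, card_eq_sum_ones]
        refine sum_le_sum (fun z hz => ?_)
        simp only [hAdef, mem_filter] at hz
        apply Nat.one_le_iff_ne_zero.2
        intro h0
        exact hnoL z hz.1 (RTree.mem_rootLeaves.2 ⟨RTree.mem_kids.1 hz.2, card_eq_zero.1 h0⟩)
      refine h1.trans (card_le_card (fun q hq => ?_))
      obtain ⟨z, hz, hqz⟩ := mem_biUnion.1 hq
      simp only [hAdef, mem_filter] at hz
      obtain ⟨hz0, hzr⟩ := RTree.mem_kids.1 hz.2
      have hzs : t.side z = false := by rw [t.side_par hz0, hzr, t.side_root]; rfl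
      have hqP : q ∈ P := by
        by_contra hqP
        have h1 := hi z hz.1 hzs
        have : q ∈ t.pend P z := mem_sdiff.2 ⟨hqz, hqP⟩
        rw [h1] at this
        simp at this
      obtain ⟨hq0, hqz'⟩ := RTree.mem_kids.1 hqz
      simp only [hBdef, mem_filter, mem_erase]
      refine ⟨⟨hq0, hqP⟩, fun hh => hz0 ?_⟩
      rw [← hqz', (RTree.mem_kids.1 hh).2]
    have hdisj : Disjoint (t.kids y) B := by
      rw [disjoint_left]
      intro q hq hqB
      simp only [hBdef, mem_filter, mem_erase] at hqB
      rw [← h.closed.pend_eq_kids hyP] at hq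
      exact (RTree.mem_pend.1 hq).2 hqB.1.2
    have hsub : t.kids y ∪ B ⊆ (univ.erase t.root) \ t.kids t.root := by
      intro q hq
      rw [mem_sdiff, mem_erase]
      rcases mem_union.1 hq with hq | hq
      · have hq' := RTree.mem_kids.1 hq
        refine ⟨⟨hq'.1, mem_univ _⟩, fun hh => hy0 ?_⟩
        rw [← hq'.2, (RTree.mem_kids.1 hh).2]
      · simp only [hBdef, mem_filter, mem_erase] at hq
        exact ⟨⟨hq.1.1, mem_univ _⟩, hq.2⟩
    have hrestc : ((univ.erase t.root) \ t.kids t.root).card = k - κ := by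
      rw [card_sdiff_of_subset, card_erase_of_mem (mem_univ _), card_univ, hW]
      · omega
      · intro q hq
        exact mem_erase.2 ⟨(RTree.mem_kids.1 hq).1, mem_univ _⟩
    have hκy : (t.kids y).card + B.card ≤ k - κ := by
      rw [← hrestc, ← card_union_of_disjoint hdisj]
      exact card_le_card hsub
    have hAw : A.image f ⊆ nb E true (f t.root) := by
      intro v hv
      obtain ⟨q, hq, rfl⟩ := mem_image.1 hv
      simp only [hAdef, mem_filter] at hq
      obtain ⟨hq0, hqr⟩ := RTree.mem_kids.1 hq.2
      have := h.adj q hq.1 hq0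
      rwa [hqr, t.side_root] at this
    have hUc := h.card_image
    have hcard_erase : ∀ z ∈ P, ((P.image f).erase (f z)).card = B.card + A.card := by
      intro z hz
      rw [card_erase_of_mem (mem_image_of_mem f hz)]
      omega
    have key : ∃ v ∈ nb E true (f x), v ∉ P.image f ∧
        (t.kids y).card ≤ (nb E false v \ P.image f).card := by
      by_contra! hc
      set C := nb E true (f x) \ P.image f with hC
      have hCsub : C ⊆ nb E true (f x) := sdiff_subset
      have hbad : ∀ v ∈ C, k + 2 ≤ κ + (t.kids y).card + (nb E false v ∩ P.image f).card := by
        intro v hv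
        rw [hC, mem_sdiff] at hv
        have h1 := hc v hv.1 hv.2
        have h2 := card_sdiff_add_card_inter (nb E false v) (P.image f)
        have h3 := ha v ⟨f x, mem_nb_not.1 hv.1⟩
        omega
      have hbad' : ∀ v ∈ C, k + 1 ≤ κ + (t.kids y).card
          + (nb E false v ∩ (P.image f).erase (f x)).card := by
        intro v hv
        have h1 := hbad v hv
        have h2 := pred_card_le_card_erase (s := nb E false v ∩ P.image f) (a := f x)
        rw [← inter_erase] at h2
        omega
      have hnotmem : f x ∉ (P.image f).erase (f x) := notMem_erase _ _
      have hCc := card_sdiff_add_card_inter (nb E true (f x)) (P.image f)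
      rw [← hC] at hCc
      by_cases hx0 : x = t.root
      · have h1 := hE.double_count (m := B.card + 1) hCsub hnotmem (s' := false) (fun v hv => by
          have := hbad' v hv
          omega)
        rw [hcard_erase x hpar] at h1
        have h2 : (nb E true (f x) ∩ P.image f).card ≤ B.card + A.card := by
          rw [← hcard_erase x hpar]
          refine card_le_card (fun v hv => ?_)
          rw [mem_inter] at hv
          exact mem_erase.2 ⟨by rintro rfl; exact hE.irrefl _ _ hv.1, hv.2⟩
        have h3 : k ≤ (nb E true (f x)).card := by rw [hx0]; exact hw
        have h4 : 2 * c + 1 ≤ C.card := by omega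
        have h5 : (2 * c + 1) * (B.card + 1) ≤ C.card * (B.card + 1) := Nat.mul_le_mul_right _ h4
        have h6 : (B.card + A.card) * c ≤ (2 * B.card) * c := Nat.mul_le_mul_right _ (by omega)
        nlinarith
      · have hxne : f x ≠ f t.root := fun hh => hx0 (h.inj hpar hroot hh)
        have hxs' : x ∉ t.kids t.root := by
          intro hh
          obtain ⟨h1, h2⟩ := RTree.mem_kids.1 hh
          rw [t.side_par h1, h2, t.side_root] at hxs
          simp at hxs
        have hκy' : (t.kids y).card + B.card + 1 ≤ k - κ := by
          have hyn : y ∉ t.kids y ∪ B := by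
            rw [mem_union]
            rintro (hh | hh)
            · exact RTree.par_ne hy0 (RTree.mem_kids.1 hh).2
            · simp only [hBdef, mem_filter, mem_erase] at hh
              exact hyP hh.1.2
          rw [← hrestc, ← card_union_of_disjoint hdisj, ← card_insert_of_notMem hyn]
          refine card_le_card (insert_subset ?_ hsub)
          rw [mem_sdiff, mem_erase]
          exact ⟨⟨hy0, mem_univ _⟩, fun hh => hx0 (RTree.mem_kids.1 hh).2⟩
        have hPsplit : P.image f = A.image f ∪ (insert t.root B).image f := by
          rw [← image_union]
          congr 1
          ext q
          simp only [hAdef, hBdef, mem_union, mem_filter, mem_insert, mem_erase]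
          constructor
          · intro hq
            by_cases h1 : q ∈ t.kids t.root
            · exact Or.inl ⟨hq, h1⟩
            · by_cases h2 : q = t.root
              · exact Or.inr (Or.inl h2)
              · exact Or.inr (Or.inr ⟨⟨h2, hq⟩, h1⟩)
          · rintro (h1 | rfl | h1)
            · exact h1.1
            · exact hroot
            · exact h1.1.2
        have hAc : ∀ s v, v ≠ f t.root → (nb E s v ∩ A.image f).card ≤ c := fun s v hv =>
          (card_le_card (inter_subset_inter Subset.rfl hAw)).trans (hE.codeg _ _ _ _ hv)
        have hBc : ((insert t.root B).image f).card ≤ B.card + 1 :=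
          card_image_le.trans (card_insert_le _ _)
        have hxB : f x ∈ (insert t.root B).image f := by
          refine mem_image_of_mem _ (mem_insert_of_mem ?_)
          simp only [hBdef, mem_filter, mem_erase]
          exact ⟨⟨hx0, hpar⟩, hxs'⟩
        have hCbig : κ ≤ C.card + c + B.card := by
          have h1 : (nb E true (f x) ∩ P.image f).card ≤ c + B.card := by
            rw [hPsplit, inter_union_distrib_left]
            refine (card_union_le _ _).trans (add_le_add (hAc _ _ hxne) ?_)
            have : nb E true (f x) ∩ (insert t.root B).image f
                ⊆ ((insert t.root B).image f).erase (f x) := by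
              intro v hv
              rw [mem_inter] at hv
              exact mem_erase.2 ⟨by rintro rfl; exact hE.irrefl _ _ hv.1, hv.2⟩
            have := card_le_card this
            rw [card_erase_of_mem hxB] at this
            omega
          have h2 := hb (f x) (by
            have := h.adj' hpar hx0
            rw [hxs] at this
            exact ⟨_, this⟩)
          omega
        have hCne : 2 ≤ C.card := by omega
        by_cases hco : 3 * c ≤ B.card + 4
        · obtain ⟨v₁, hv₁, v₂, hv₂, hvne⟩ := one_lt_card.1 hCne
          have hlow : ∀ v ∈ C, B.card + 3 ≤ c
              + (nb E false v ∩ (insert t.root B).image f).card := by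
            intro v hv
            have h1 := hbad v hv
            rw [hPsplit, inter_union_distrib_left] at h1
            have h2 := card_union_le (nb E false v ∩ A.image f)
              (nb E false v ∩ (insert t.root B).image f)
            have h3 := hAc false v (by
              rintro rfl
              exact (mem_sdiff.1 hv).2 (mem_image_of_mem f hroot))
            omega
          have h1 := hlow v₁ hv₁
          have h2 := hlow v₂ hv₂
          have h3 := card_union_add_card_inter (nb E false v₁ ∩ (insert t.root B).image f)
            (nb E false v₂ ∩ (insert t.root B).image f)
          have h4 : (nb E false v₁ ∩ (insert t.root B).image f
              ∪ nb E false v₂ ∩ (insert t.root B).image f).card ≤ B.card + 1 :=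
            (card_le_card (union_subset inter_subset_right inter_subset_right)).trans hBc
          have h5 : ((nb E false v₁ ∩ (insert t.root B).image f)
              ∩ (nb E false v₂ ∩ (insert t.root B).image f)).card ≤ c :=
            (card_le_card (inter_subset_inter inter_subset_left inter_subset_left)).trans
              (hE.codeg _ _ _ _ hvne)
          omega
        · have h1 := hE.double_count (m := B.card + 2) hCsub hnotmem (s' := false) (fun v hv => by
            have := hbad' v hv
            omega)
          rw [hcard_erase x hpar] at h1
          have h4 : 2 * c ≤ C.card := by omega
          have h5 : (2 * c) * (B.card + 2) ≤ C.card * (B.card + 2) := Nat.mul_le_mul_right _ h4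
          have h6 : (B.card + A.card) * c ≤ (2 * B.card) * c := Nat.mul_le_mul_right _ (by omega)
          have h7 : 0 < c := by omega
          nlinarith
    obtain ⟨v, hv, hvU, hvy⟩ := key
    refine ⟨insert y P, Function.update f y v, by rw [card_insert_of_notMem hyP]; omega,
      h.extend hyP hpar (by rw [← hx, hxs]; exact hv) hvU, ?_, ?_, ?_, ?_⟩
    · rwa [update_of_mem hyP hroot]
    · have hz' : ∀ z ∈ insert y P, t.side z = false → (t.pend (insert y P) z).Nonempty → z = y := by
        intro z hz hzs hp
        rcases mem_insert.1 hz with rfl | hz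
        · rfl
        · rw [RTree.pend_insert, hi z hz hzs] at hp
          simp at hp
      intro z hz hzs z' hz'' hzs' hp hp'
      rw [hz' z hz hzs hp, hz' z' hz'' hzs' hp']
    · intro z hz hzs
      rw [RTree.pend_insert, image_update hyP]
      rcases mem_insert.1 hz with rfl | hz
      · rw [Function.update_self, sdiff_insert, erase_eq_of_notMem (a := v)]
        · refine le_trans (card_le_card ((erase_subset _ _).trans (RTree.pend_subset _))) hvy
        · intro hh
          exact hE.irrefl _ _ (mem_sdiff.1 hh).1
      · rw [hi z hz hzs]
        simp
    · rintro ⟨z, hz, hzL⟩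
      rcases mem_insert.1 hz with rfl | hz
      · exact absurd hzL hyL
      · exact absurd hzL (hnoL z hz)
  · push Not at hA
    obtain ⟨y, hyP⟩ : ∃ y, y ∉ P := by
      by_contra! hc
      exact hP (eq_univ_of_forall hc)
    have hyL := hA y hyP
    obtain ⟨⟨hy0, hyr⟩, hyk⟩ := RTree.mem_rootLeaves.1 hyL
    have hPlt : P.card < k + 1 := by
      rw [← hW, ← card_univ]
      exact card_lt_card (ssubset_univ_iff.2 hP)
    have hpos : 0 < P.card := card_pos.2 ⟨_, hroot⟩
    obtain ⟨v, hv, hvU⟩ := exists_mem_not_mem_of_subset_image (f := f) (U := P.image f)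
      (S := P.erase t.root) (N := nb E true (f t.root)) (fun v hv hvU => by
        obtain ⟨q, hq, rfl⟩ := mem_image.1 hvU
        have hq0 : q ≠ t.root := by
          rintro rfl
          exact hE.irrefl _ _ hv
        exact mem_image_of_mem _ (mem_erase.2 ⟨hq0, hq⟩))
      (by rw [card_erase_of_mem hroot]; omega)
    have hem : ∀ z ∈ insert y P, t.side z = false → t.pend (insert y P) z = ∅ := by
      intro z hz hzs
      rw [RTree.pend_insert]
      rcases mem_insert.1 hz with rfl | hz
      · rw [h.closed.pend_eq_kids hyP, hyk]; rfl
      · rw [hi z hz hzs]; rfl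
    refine ⟨insert y P, Function.update f y v, by rw [card_insert_of_notMem hyP]; omega,
      h.extend hyP (hyr ▸ hroot) (by rwa [hyr, t.side_root]) hvU, ?_, ?_, ?_, ?_⟩
    · rwa [update_of_mem hyP hroot]
    · intro z hz hzs z' hz' hzs' hp hp'
      rw [hem z hz hzs] at hp
      simp at hp
    · intro z hz hzs
      rw [hem z hz hzs]
      simp
    · intro _ z hzL
      by_contra hz
      exact hzL (hA z (fun hh => hz (mem_insert_of_mem hh)))

end LargeRootMatched

section Demand

variable {W : Type*} [Fintype W] [DecidableEq W] {t : RTree W} {P : Finset W}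

namespace RTree

/-- `1` if some children are pending and none of them is a leaf, else `0`. -/
def extra (t : RTree W) (P : Finset W) (x : W) : ℕ :=
  if (t.pend P x).Nonempty ∧ ∀ y ∈ t.pend P x, (t.kids y).Nonempty then 1 else 0

/-- The number of free neighbours that the image of `x` should have. -/
def demand (t : RTree W) (P : Finset W) (x : W) : ℕ := (t.pend P x).card + t.extra P x

/-- The number of pending children if none of them is a leaf, else `0`. -/
def inner (t : RTree W) (P : Finset W) (x : W) : ℕ :=
  if (t.pend P x).Nonempty ∧ ∀ y ∈ t.pend P x, (t.kids y).Nonempty then (t.pend P x).card else 0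

lemma extra_inner (x : W) : (t.extra P x = 0 ∧ t.inner P x = 0) ∨
    (t.extra P x = 1 ∧ t.inner P x = (t.pend P x).card ∧ 1 ≤ (t.pend P x).card) := by
  unfold extra inner
  split_ifs with h
  · exact Or.inr ⟨rfl, rfl, card_pos.2 h.1⟩
  · exact Or.inl ⟨rfl, rfl⟩

lemma demand_insert_of_ne {x y : W} (h : t.par y ≠ x) :
    t.demand (insert y P) x = t.demand P x := by
  have : t.pend (insert y P) x = t.pend P x := by
    rw [pend_insert, erase_eq_of_notMem]
    exact fun hh => h (mem_pend.1 hh).1.2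
  simp [demand, extra, this]

lemma demand_insert_par {y : W} (hy0 : y ≠ t.root) (hy : y ∉ P)
    (h : (t.kids y).Nonempty ∨ ∀ z ∈ t.pend P (t.par y), t.kids z = ∅) :
    t.demand (insert y P) (t.par y) + 1 ≤ t.demand P (t.par y) := by
  have hyp : y ∈ t.pend P (t.par y) := mem_pend.2 ⟨⟨hy0, rfl⟩, hy⟩
  have hc := card_erase_of_mem hyp
  have hpos : 0 < (t.pend P (t.par y)).card := card_pos.2 ⟨y, hyp⟩
  have he : t.extra (insert y P) (t.par y) ≤ t.extra P (t.par y) := by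
    unfold extra
    rw [pend_insert]
    split_ifs with h1 h2 h2
    · rfl
    · exfalso
      apply h2
      refine ⟨⟨y, hyp⟩, fun z hz => ?_⟩
      by_cases hzy : z = y
      · subst hzy
        rcases h with h | h
        · exact h
        · obtain ⟨z', hz'⟩ := h1.1
          have := h1.2 z' hz'
          rw [h z' (mem_of_mem_erase hz')] at this
          simp at this
      · exact h1.2 z (mem_erase.2 ⟨hzy, hz⟩)
    · exact Nat.zero_le _
    · exact le_rfl
  unfold demand
  rw [pend_insert]
  omega

lemma two_le_demand {y : W} (hy0 : y ≠ t.root) (hy : y ∉ P) (h : (t.kids y).Nonempty) :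
    2 ≤ t.demand P (t.par y) := by
  have hyp : y ∈ t.pend P (t.par y) := mem_pend.2 ⟨⟨hy0, rfl⟩, hy⟩
  have hpos : 0 < (t.pend P (t.par y)).card := card_pos.2 ⟨y, hyp⟩
  unfold demand
  by_cases h2 : 2 ≤ (t.pend P (t.par y)).card
  · omega
  · have h1 : (t.pend P (t.par y)).card = 1 := by omega
    obtain ⟨z, hz⟩ := card_eq_one.1 h1
    have hyz : y = z := by rw [hz] at hyp; exact mem_singleton.1 hyp
    subst hyz
    have : t.extra P (t.par y) = 1 := by
      unfold extra
      rw [if_pos]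
      rw [hz]
      exact ⟨singleton_nonempty _, fun q hq => by rw [mem_singleton.1 hq]; exact h⟩
    omega

lemma sum_demand_le (hP : t.Closed P) {S : Finset W} (hS : S ⊆ P) :
    ∑ x ∈ S, t.demand P x ≤ Pᶜ.card := by
  have h1 : ∀ x ∈ S, t.demand P x ≤ (t.pend P x ∪ (t.pend P x).biUnion t.kids).card := by
    intro x hx
    have hd : Disjoint (t.pend P x) ((t.pend P x).biUnion t.kids) := by
      rw [disjoint_left]
      intro y hy hy'
      obtain ⟨z, hz, hyz⟩ := mem_biUnion.1 hy'
      have h2 := (mem_kids.1 hyz).2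
      have h3 := (mem_pend.1 hy).1.2
      rw [h2] at h3
      subst h3
      exact (mem_pend.1 hz).2 (hS hx)
    rw [card_union_of_disjoint hd]
    unfold demand extra
    split_ifs with h
    · obtain ⟨y, hy⟩ := h.1
      obtain ⟨z, hz⟩ := h.2 y hy
      have : 0 < ((t.pend P x).biUnion t.kids).card := card_pos.2 ⟨z, mem_biUnion.2 ⟨y, hy, hz⟩⟩
      omega
    · omega
  refine (sum_le_sum h1).trans ?_
  rw [← card_biUnion]
  · refine card_le_card (fun y hy => ?_)
    rw [mem_compl]
    obtain ⟨x, hx, hy⟩ := mem_biUnion.1 hy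
    rcases mem_union.1 hy with hy | hy
    · exact (mem_pend.1 hy).2
    · obtain ⟨z, hz, hyz⟩ := mem_biUnion.1 hy
      intro hyP
      apply (mem_pend.1 hz).2
      rw [← (mem_kids.1 hyz).2]
      exact hP.2 y hyP (mem_kids.1 hyz).1
  · intro x hx x' hx' hne
    rw [Function.onFun, disjoint_left]
    intro y hy hy'
    rcases mem_union.1 hy with hy | hy <;> rcases mem_union.1 hy' with hy' | hy'
    · exact hne ((mem_pend.1 hy).1.2.symm.trans (mem_pend.1 hy').1.2)
    · obtain ⟨z, hz, hyz⟩ := mem_biUnion.1 hy'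
      apply (mem_pend.1 hz).2
      rw [← (mem_kids.1 hyz).2, (mem_pend.1 hy).1.2]
      exact hS hx
    · obtain ⟨z, hz, hyz⟩ := mem_biUnion.1 hy
      apply (mem_pend.1 hz).2
      rw [← (mem_kids.1 hyz).2, (mem_pend.1 hy').1.2]
      exact hS hx'
    · obtain ⟨z, hz, hyz⟩ := mem_biUnion.1 hy
      obtain ⟨z', hz', hyz'⟩ := mem_biUnion.1 hy'
      have : z = z' := (mem_kids.1 hyz).2.symm.trans (mem_kids.1 hyz').2
      subst this
      exact hne ((mem_pend.1 hz).1.2.symm.trans (mem_pend.1 hz').1.2)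

/-- Comparing the number of unplaced vertices with the number of leaves. -/
lemma sum_kids_add_inner_le (hleaf : ∀ x ∈ P, (t.kids x).Nonempty) {X Z : Finset W}
    (hX : ∀ x ∈ X, (t.kids x).Nonempty) :
    1 + ∑ x ∈ X, (t.kids x).card + ∑ z ∈ Z, t.inner P z ≤ Pᶜ.card + X.card := by
  set L := univ.filter (fun y => t.kids y = ∅) with hL
  set I := univ.filter (fun y => ¬ t.kids y = ∅) with hI
  have hLI : L.card + I.card = Fintype.card W := by
    rw [← card_univ]
    exact card_filter_add_card_filter_not _
  have h1 : ∑ x ∈ I, (t.kids x).card = ∑ x, (t.kids x).card := by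
    apply sum_subset (subset_univ _)
    intro x _ hx
    simp only [hI, mem_filter, mem_univ, true_and, not_not] at hx
    rw [hx, card_empty]
  have hXI : X ⊆ I := fun x hx => by
    simp only [hI, mem_filter, mem_univ, true_and]
    exact (hX x hx).ne_empty
  have h2 : ∑ x ∈ X, (t.kids x).card + (I \ X).card ≤ ∑ x ∈ I, (t.kids x).card := by
    rw [← sum_sdiff hXI, add_comm]
    refine add_le_add ?_ le_rfl
    rw [card_eq_sum_ones]
    refine sum_le_sum (fun x hx => ?_)
    simp only [hI, mem_sdiff, mem_filter, mem_univ, true_and] at hx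
    exact card_pos.2 (nonempty_iff_ne_empty.2 hx.1)
  have h3 := card_sdiff_add_card_eq_card hXI
  have h4 := sum_kids_univ (t := t)
  have h5 : ∑ z ∈ Z, t.inner P z + L.card ≤ Pᶜ.card := by
    have h6 : ∀ z ∈ Z, t.inner P z
        ≤ (if (t.pend P z).Nonempty ∧ ∀ y ∈ t.pend P z, (t.kids y).Nonempty
            then t.pend P z else ∅).card := by
      intro z _
      unfold inner
      split_ifs <;> simp
    refine (add_le_add_left (sum_le_sum h6) _).trans ?_
    rw [← card_biUnion, ← card_union_of_disjoint]
    · refine card_le_card (fun y hy => ?_)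
      rw [mem_compl]
      intro hyP
      rcases mem_union.1 hy with hy | hy
      · obtain ⟨z, _, hyz⟩ := mem_biUnion.1 hy
        split_ifs at hyz
        · exact (mem_pend.1 hyz).2 hyP
        · simp at hyz
      · simp only [hL, mem_filter, mem_univ, true_and] at hy
        have := hleaf y hyP
        rw [hy] at this
        simp at this
    · rw [disjoint_left]
      intro y hy hyL
      simp only [hL, mem_filter, mem_univ, true_and] at hyL
      obtain ⟨z, _, hyz⟩ := mem_biUnion.1 hy
      split_ifs at hyz with h
      · have := h.2 y hyz
        rw [hyL] at this
        simp at this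
      · simp at hyz
    · intro x _ x' _ hne
      rw [Function.onFun]
      refine Disjoint.mono ?_ ?_ (kids_disjoint (t := t) hne)
      · split_ifs
        · exact pend_subset x
        · exact empty_subset _
      · split_ifs
        · exact pend_subset x'
        · exact empty_subset _
  omega

end RTree

end Demand

section Hall

variable {V W : Type*} [DecidableEq V] [Fintype W] [DecidableEq W]
  {t : RTree W} {P : Finset W} {N : W → Finset V} {U : Finset V}

/-- Hall's condition for the demands of the placed vertices. -/
def Hall (t : RTree W) (N : W → Finset V) (P : Finset W) (U : Finset V) : Prop :=
  ∀ S ⊆ P, ∑ x ∈ S, t.demand P x ≤ (S.biUnion N \ U).card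

lemma biUnion_inter_subset (S T : Finset W) :
    (S ∩ T).biUnion N ⊆ S.biUnion N ∩ T.biUnion N :=
  subset_inter (biUnion_subset_biUnion_of_subset_left _ inter_subset_left)
    (biUnion_subset_biUnion_of_subset_left _ inter_subset_right)

lemma Hall.tight_union (h : Hall t N P U) {S T : Finset W} (hS : S ⊆ P) (hT : T ⊆ P)
    (hS' : ∑ x ∈ S, t.demand P x = (S.biUnion N \ U).card)
    (hT' : ∑ x ∈ T, t.demand P x = (T.biUnion N \ U).card) :
    ∑ x ∈ S ∪ T, t.demand P x = ((S ∪ T).biUnion N \ U).card := by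
  refine le_antisymm (h _ (union_subset hS hT)) ?_
  have h1 := sum_union_inter (s₁ := S) (s₂ := T) (f := t.demand P)
  have h2 := h (S ∩ T) (inter_subset_left.trans hS)
  have h3 := card_union_add_card_inter (S.biUnion N \ U) (T.biUnion N \ U)
  rw [← union_sdiff_distrib, ← union_biUnion] at h3
  have h4 : ((S ∩ T).biUnion N \ U).card ≤ ((S.biUnion N \ U) ∩ (T.biUnion N \ U)).card := by
    refine card_le_card (fun v hv => ?_)
    rw [mem_sdiff] at hv
    have := mem_inter.1 (biUnion_inter_subset S T hv.1)
    simp [this.1, this.2, hv.2]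
  omega

/-- Positions for a new vertex `y` that keep Hall's condition for the old vertices. -/
lemma Hall.exists_tight (h : Hall t N P U) {y : W} (hy0 : y ≠ t.root) (hyP : y ∉ P)
    (hx : t.par y ∈ P)
    (hord : (t.kids y).Nonempty ∨ ∀ z ∈ t.pend P (t.par y), t.kids z = ∅) :
    ∃ Q ⊆ P, t.par y ∉ Q ∧ ∑ x ∈ Q, t.demand P x = (Q.biUnion N \ U).card ∧
      t.demand P (t.par y) ≤ ((N (t.par y) \ U) \ Q.biUnion N).card ∧
      ∀ v ∈ (N (t.par y) \ U) \ Q.biUnion N, ∀ S ⊆ P,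
        ∑ x ∈ S, t.demand (insert y P) x ≤ (S.biUnion N \ insert v U).card := by
  set x := t.par y with hxdef
  set F := P.powerset.filter (fun Q => x ∉ Q ∧ ∑ z ∈ Q, t.demand P z = (Q.biUnion N \ U).card)
    with hF
  obtain ⟨Q, hQ, hmax⟩ := exists_max_image F card ⟨∅, by simp [hF]⟩
  simp only [hF, mem_filter, mem_powerset] at hQ
  obtain ⟨hQP, hxQ, hQt⟩ := hQ
  have hmax' : ∀ S ⊆ P, x ∉ S → ∑ z ∈ S, t.demand P z = (S.biUnion N \ U).card → S ⊆ Q := by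
    intro S hS hxS hSt
    have h1 : S ∪ Q ∈ F := by
      simp only [hF, mem_filter, mem_powerset, mem_union, not_or]
      exact ⟨union_subset hS hQP, ⟨hxS, hxQ⟩, h.tight_union hS hQP hSt hQt⟩
    have h2 := eq_of_subset_of_card_le subset_union_right (hmax _ h1)
    rw [h2]
    exact subset_union_left
  refine ⟨Q, hQP, hxQ, hQt, ?_, ?_⟩
  · have h1 := h (insert x Q) (insert_subset hx hQP)
    rw [sum_insert hxQ, biUnion_insert, hQt] at h1
    have h2 : (N x ∪ Q.biUnion N) \ U ⊆ ((N x \ U) \ Q.biUnion N) ∪ (Q.biUnion N \ U) := by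
      intro v hv
      simp only [mem_sdiff, mem_union] at hv ⊢
      tauto
    have h3 := (card_le_card h2).trans (card_union_le _ _)
    omega
  · intro v hv S hS
    simp only [mem_sdiff] at hv
    have hcard : (S.biUnion N \ U).card ≤ (S.biUnion N \ insert v U).card + 1 := by
      rw [sdiff_insert]
      have := pred_card_le_card_erase (s := S.biUnion N \ U) (a := v)
      omega
    have hother : ∀ z ∈ S, z ≠ x → t.demand (insert y P) z = t.demand P z := fun z _ hz =>
      RTree.demand_insert_of_ne (fun hh => hz hh.symm)
    have hle := h S hS
    by_cases hxS : x ∈ S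
    · have h1 : ∑ z ∈ S, t.demand (insert y P) z + 1 ≤ ∑ z ∈ S, t.demand P z := by
        rw [← add_sum_erase _ _ hxS, ← add_sum_erase _ (t.demand P) hxS]
        have h2 := RTree.demand_insert_par hy0 hyP hord
        rw [← hxdef] at h2
        have h3 : ∑ z ∈ S.erase x, t.demand (insert y P) z = ∑ z ∈ S.erase x, t.demand P z :=
          sum_congr rfl (fun z hz => hother z (mem_of_mem_erase hz) (ne_of_mem_erase hz))
        omega
      omega
    · have h1 : ∑ z ∈ S, t.demand (insert y P) z = ∑ z ∈ S, t.demand P z :=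
        sum_congr rfl (fun z hz => hother z hz (by rintro rfl; exact hxS hz))
      by_cases htight : ∑ z ∈ S, t.demand P z = (S.biUnion N \ U).card
      · have hSQ := hmax' S hS hxS htight
        rw [sdiff_insert, erase_eq_of_notMem, h1]
        · exact hle
        · intro hh
          exact hv.2 (biUnion_subset_biUnion_of_subset_left N hSQ (mem_sdiff.1 hh).1)
      · omega

lemma biUnion_update {y : W} {M : Finset V} {S : Finset W} (hy : y ∉ S) :
    S.biUnion (Function.update N y M) = S.biUnion N :=
  biUnion_congr rfl (fun z hz => Function.update_of_ne (by rintro rfl; exact hy hz) _ _)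

lemma biUnion_update_of_mem {y : W} {M : Finset V} {S : Finset W} (hy : y ∈ S) :
    S.biUnion (Function.update N y M) = M ∪ (S.erase y).biUnion N := by
  conv_lhs => rw [← insert_erase hy]
  rw [biUnion_insert, Function.update_self, biUnion_update (notMem_erase y S)]

lemma hall_insert (hP : t.Closed P) {y : W} (hx : t.par y ∈ P) {v : V} {M : Finset V}
    (hold : ∀ S ⊆ P, ∑ x ∈ S, t.demand (insert y P) x ≤ (S.biUnion N \ insert v U).card)
    (h1 : t.demand (insert y P) y ≤ (M \ insert v U).card)
    (h2 : ∀ z ∈ P, t.demand (insert y P) z + t.demand (insert y P) y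
      ≤ ((N z ∪ M) \ insert v U).card)
    (h3 : ∀ z ∈ P, ∀ z' ∈ P, z ≠ z' → (insert y P)ᶜ.card ≤ ((N z ∪ N z' ∪ M) \ insert v U).card) :
    Hall t (Function.update N y M) (insert y P) (insert v U) := by
  intro S hS
  by_cases hyS : y ∈ S
  · have hS' : S.erase y ⊆ P := by
      intro z hz
      rcases mem_insert.1 (hS (mem_of_mem_erase hz)) with rfl | hz'
      · exact absurd rfl (ne_of_mem_erase hz)
      · exact hz'
    rw [biUnion_update_of_mem hyS]
    rcases (S.erase y).eq_empty_or_nonempty with he | ⟨z, hz⟩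
    · rw [← add_sum_erase _ _ hyS, he]
      simpa using h1
    by_cases hone : S.erase y = {z}
    · rw [← add_sum_erase _ _ hyS, hone, sum_singleton, singleton_biUnion, union_comm]
      have := h2 z (hS' hz)
      omega
    · obtain ⟨z', hz', hne⟩ : ∃ z' ∈ S.erase y, z ≠ z' := by
        by_contra! hc
        apply hone
        ext q
        rw [mem_singleton]
        exact ⟨fun hq => (hc q hq).symm, fun hq => hq ▸ hz⟩
      refine (RTree.sum_demand_le (hP.insert hx) hS).trans ((h3 z (hS' hz) z' (hS' hz') hne).trans ?_)
      refine card_le_card (sdiff_subset_sdiff ?_ le_rfl)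
      refine union_subset (union_subset ?_ ?_) subset_union_left
      · exact (subset_biUnion_of_mem N hz).trans subset_union_right
      · exact (subset_biUnion_of_mem N hz').trans subset_union_right
  · rw [biUnion_update hyS]
    apply hold
    intro z hz
    rcases mem_insert.1 (hS hz) with rfl | hz'
    · exact absurd hz hyS
    · exact hz'

lemma hall_insert_of_demand_eq_zero {y : W} {v : V} {M : Finset V}
    (hold : ∀ S ⊆ P, ∑ x ∈ S, t.demand (insert y P) x ≤ (S.biUnion N \ insert v U).card)
    (h0 : t.demand (insert y P) y = 0) :
    Hall t (Function.update N y M) (insert y P) (insert v U) := by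
  intro S hS
  by_cases hyS : y ∈ S
  · rw [biUnion_update_of_mem hyS, ← add_sum_erase _ _ hyS, h0, zero_add]
    refine (hold (S.erase y) ?_).trans (card_le_card (sdiff_subset_sdiff subset_union_right le_rfl))
    intro z hz
    rcases mem_insert.1 (hS (mem_of_mem_erase hz)) with rfl | hz'
    · exact absurd rfl (ne_of_mem_erase hz)
    · exact hz'
  · rw [biUnion_update hyS]
    apply hold
    intro z hz
    rcases mem_insert.1 (hS hz) with rfl | hz'
    · exact absurd hz hyS
    · exact hz'

lemma Hall.congr {N' : W → Finset V} (h : Hall t N P U) (hN : ∀ z ∈ P, N z ⊆ N' z) :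
    Hall t N' P U := by
  intro S hS
  refine (h S hS).trans (card_le_card (sdiff_subset_sdiff ?_ le_rfl))
  exact biUnion_mono (fun z hz => hN z (hS hz))

end Hall

section Placement

variable {V W : Type*} [DecidableEq V] [Fintype W] [DecidableEq W]
  {t : RTree W} {P Z : Finset W} {N : W → Finset V} {U : Finset V} {M : V → Finset V}
  {c k νy : ℕ} {ν : W → ℕ}

lemma card_union_three {A B C : Finset V} (U : Finset V) (h1 : (A ∩ B).card ≤ c)
    (h2 : (A ∩ C).card ≤ c) (h3 : (B ∩ C).card ≤ c) :
    A.card + B.card + C.card ≤ ((A ∪ B ∪ C) \ U).card + U.card + 3 * c := by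
  have e1 := card_union_add_card_inter A B
  have e2 := card_union_add_card_inter (A ∪ B) C
  rw [union_inter_distrib_right] at e2
  have e3 := card_union_le (A ∩ C) (B ∩ C)
  have e4 := le_card_sdiff U (A ∪ B ∪ C)
  omega

lemma card_union_four {A B C D : Finset V} (U : Finset V) (h1 : (A ∩ B).card ≤ c)
    (h2 : (A ∩ C).card ≤ c) (h3 : (B ∩ C).card ≤ c) (h4 : (A ∩ D).card ≤ c)
    (h5 : (B ∩ D).card ≤ c) (h6 : (C ∩ D).card ≤ c) :
    A.card + B.card + C.card + D.card ≤ ((A ∪ B ∪ C ∪ D) \ U).card + U.card + 6 * c := by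
  have e0 := card_union_three (U := ∅) h1 h2 h3
  have e2 := card_union_add_card_inter (A ∪ B ∪ C) D
  rw [union_inter_distrib_right, union_inter_distrib_right] at e2
  have e3 := card_union_le (A ∩ D ∪ B ∩ D) (C ∩ D)
  have e5 := card_union_le (A ∩ D) (B ∩ D)
  have e4 := le_card_sdiff U (A ∪ B ∪ C ∪ D)
  simp only [sdiff_empty, card_empty] at e0
  omega

/-- Neighbourhoods of the placed vertices, and possible neighbourhoods of the next one. -/
structure Spread (N : W → Finset V) (P : Finset W) (U : Finset V) (M : V → Finset V) (c : ℕ) :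
    Prop where
  old_old : ∀ z ∈ P, ∀ z' ∈ P, z ≠ z' → (N z ∩ N z').card ≤ c
  old_new : ∀ z ∈ P, ∀ v, v ∉ U → (N z ∩ M v).card ≤ c
  new_new : ∀ v v', v ≠ v' → (M v ∩ M v').card ≤ c
  irrefl : ∀ v, v ∉ M v

lemma sdiff_le_insert {A U : Finset V} (v : V) : (A \ U).card ≤ (A \ insert v U).card + 1 := by
  rw [sdiff_insert]
  have := pred_card_le_card_erase (s := A \ U) (a := v)
  omega

/-- A position keeps Hall's condition unless it fails together with at most one placed vertex. -/
lemma hall_insert_or (hW : Fintype.card W = k + 1) (hP : t.Closed P) {y : W} (hyP : y ∉ P)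
    (hx : t.par y ∈ P) (hU : U.card = P.card) (hs : Spread N P U M c)
    (hν : ∀ z ∈ P, ν z ≤ (N z).card) {v : V} (hvU : v ∉ U) (hνy : νy ≤ (M v).card)
    (htr : ∀ z ∈ P, ∀ z' ∈ P, z ≠ z' → k + 1 + 3 * c ≤ ν z + ν z' + νy)
    (hold : ∀ S ⊆ P, ∑ x ∈ S, t.demand (insert y P) x ≤ (S.biUnion N \ insert v U).card) :
    Hall t (Function.update N y (M v)) (insert y P) (insert v U) ∨
      (M v \ U).card + 1 ≤ t.demand (insert y P) y ∨
      ∃ z ∈ P, ((N z ∪ M v) \ insert v U).card + 1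
        ≤ t.demand (insert y P) z + t.demand (insert y P) y := by
  by_contra! hc
  obtain ⟨h0, h1, h2⟩ := hc
  apply h0
  refine hall_insert hP hx hold ?_ (fun z hz => Nat.lt_succ_iff.1 (h2 z hz)) ?_
  · rw [sdiff_insert, erase_eq_of_notMem (fun hh => hs.irrefl v (mem_sdiff.1 hh).1)]
    omega
  · intro z hz z' hz' hne
    have e1 := card_union_three (insert v U) (hs.old_old z hz z' hz' hne) (hs.old_new z hz v hvU)
      (hs.old_new z' hz' v hvU)
    have e2 := htr z hz z' hz' hne
    have e3 := hν z hz
    have e4 := hν z' hz'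
    rw [card_insert_of_notMem hvU] at e1
    rw [card_compl, card_insert_of_notMem hyP]
    omega

lemma bad_pair_false {d : W → ℕ} {y : W} (hZ : Z ⊆ P) (hU : U.card = P.card)
    (hs : Spread N P U M c) (hν : ∀ z ∈ P, ν z ≤ (N z).card) (hd : ∀ z ∈ P, d z ≤ (N z \ U).card)
    (h1 : ∀ z ∈ Z, 2 * d y + d z + P.card + 3 * c < 2 * νy + ν z)
    (h2 : ∀ z ∈ Z, ∀ z' ∈ Z, z ≠ z' →
      2 * d y + d z + d z' + P.card + 6 * c < 2 * νy + ν z + ν z')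
    {v v' : V} (hv : v ∉ U) (hv' : v' ∉ U) (hne : v ≠ v')
    (hνv : νy ≤ (M v).card) (hνv' : νy ≤ (M v').card)
    (hb : ∃ z ∈ Z, ((N z ∪ M v) \ insert v U).card + 1 ≤ d z + d y)
    (hb' : (M v' \ U).card + 1 ≤ d y ∨
      ∃ z ∈ Z, ((N z ∪ M v') \ insert v' U).card + 1 ≤ d z + d y) : False := by
  obtain ⟨z, hz, hb⟩ := hb
  have a1 := sdiff_le_insert (A := N z ∪ M v) (U := U) v
  have n1 := hν z (hZ hz)
  have t1 := card_union_three U (hs.old_new z (hZ hz) v hv) (hs.old_new z (hZ hz) v' hv')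
    (hs.new_new v v' hne)
  rcases hb' with hb' | ⟨z', hz', hb'⟩
  · have e1 := card_union_le ((N z ∪ M v) \ U) (M v' \ U)
    rw [← union_sdiff_distrib] at e1
    have := h1 z hz
    omega
  · have a2 := sdiff_le_insert (A := N z' ∪ M v') (U := U) v'
    have e1 := card_union_add_card_inter ((N z ∪ M v) \ U) ((N z' ∪ M v') \ U)
    rw [← union_sdiff_distrib] at e1
    by_cases hzz : z = z'
    · subst hzz
      have e2 : (N z \ U).card ≤ ((N z ∪ M v) \ U ∩ ((N z ∪ M v') \ U)).card := by
        refine card_le_card (fun q hq => ?_)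
        simp only [mem_sdiff, mem_inter, mem_union] at hq ⊢
        tauto
      have e3 := hd z (hZ hz)
      have e4 := h1 z hz
      have e5 : N z ∪ M v ∪ (N z ∪ M v') = N z ∪ M v ∪ M v' := by
        ext q; simp only [mem_union]; tauto
      rw [e5] at e1
      omega
    · have n2 := hν z' (hZ hz')
      have t2 := card_union_four U (hs.old_old z (hZ hz) z' (hZ hz') hzz)
        (hs.old_new z (hZ hz) v hv) (hs.old_new z' (hZ hz') v hv) (hs.old_new z (hZ hz) v' hv')
        (hs.old_new z' (hZ hz') v' hv') (hs.new_new v v' hne)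
      have e5 : N z ∪ M v ∪ (N z' ∪ M v') = N z ∪ N z' ∪ M v ∪ M v' := by
        ext q; simp only [mem_union]; tauto
      rw [e5] at e1
      have e4 := h2 z hz z' hz' hzz
      omega

/-- If all candidate positions are bad on their own, the tight set has at most one element. -/
lemma tight_subsingleton (hW : Fintype.card W = k + 1) (hP : t.Closed P) {y : W} (hyP : y ∉ P)
    (hx : t.par y ∈ P) (hU : U.card = P.card) (hs : Spread N P U M c)
    (hν : ∀ z ∈ P, ν z ≤ (N z).card) {v : V} (hvU : v ∉ U) (hνy : νy ≤ (M v).card)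
    (htr : ∀ z ∈ P, ∀ z' ∈ P, z ≠ z' → k + 1 + 3 * c ≤ ν z + ν z' + νy)
    {Q : Finset W} (hQ : Q ⊆ P) (hxQ : t.par y ∉ Q)
    (hQt : ∑ x ∈ Q, t.demand P x = (Q.biUnion N \ U).card)
    (hb : (M v \ U).card + 1 ≤ t.demand (insert y P) y) : Q.card ≤ 1 := by
  by_contra hc
  obtain ⟨z, hz, z', hz', hne⟩ := one_lt_card.1 (not_le.1 hc)
  have e1 := card_union_three U (hs.old_old z (hQ hz) z' (hQ hz') hne)
    (hs.old_new z (hQ hz) v hvU) (hs.old_new z' (hQ hz') v hvU)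
  have e2 : ((N z ∪ N z' ∪ M v) \ U).card ≤ (Q.biUnion N \ U).card + (M v \ U).card := by
    refine (card_le_card ?_).trans (card_union_le _ _)
    rw [← union_sdiff_distrib]
    refine sdiff_subset_sdiff (union_subset_union (union_subset ?_ ?_) le_rfl) le_rfl
    · exact subset_biUnion_of_mem N hz
    · exact subset_biUnion_of_mem N hz'
  have hyQ : y ∉ Q := fun hh => hyP (hQ hh)
  have e3 := RTree.sum_demand_le (hP.insert hx) (insert_subset_insert y hQ)
  rw [sum_insert hyQ] at e3
  have e4 : ∑ x ∈ Q, t.demand (insert y P) x = ∑ x ∈ Q, t.demand P x :=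
    sum_congr rfl (fun q hq => RTree.demand_insert_of_ne (by rintro rfl; exact hxQ hq))
  rw [card_compl, card_insert_of_notMem hyP] at e3
  have := htr z (hQ hz) z' (hQ hz') hne
  have := hν z (hQ hz)
  have := hν z' (hQ hz')
  omega

lemma Hall.demand_le {y : W} (h : Hall t N P U) (hy0 : y ≠ t.root) (hyP : y ∉ P)
    (hyk : (t.kids y).Nonempty) {z : W} (hz : z ∈ P) :
    t.demand (insert y P) z ≤ (N z \ U).card := by
  have h1 := h {z} (singleton_subset_iff.2 hz)
  rw [sum_singleton, singleton_biUnion] at h1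
  refine le_trans ?_ h1
  by_cases hzx : t.par y = z
  · subst hzx
    have := RTree.demand_insert_par hy0 hyP (Or.inl hyk)
    omega
  · rw [RTree.demand_insert_of_ne hzx]

/-- Placing a vertex that is not a leaf. -/
lemma Hall.exists_place (h : Hall t N P U) (hW : Fintype.card W = k + 1) (hP : t.Closed P) {y : W}
    (hy0 : y ≠ t.root) (hyP : y ∉ P) (hx : t.par y ∈ P) (hyk : (t.kids y).Nonempty)
    (hU : U.card = P.card) (hs : Spread N P U M c)
    (hν : ∀ z ∈ P, ν z ≤ (N z).card) (hνy : ∀ v ∈ N (t.par y), v ∉ U → νy ≤ (M v).card)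
    (h1 : ∀ z ∈ P, 2 * t.demand (insert y P) y + t.demand (insert y P) z + P.card + 3 * c
      < 2 * νy + ν z)
    (h2 : ∀ z ∈ P, ∀ z' ∈ P, z ≠ z' → 2 * t.demand (insert y P) y + t.demand (insert y P) z
      + t.demand (insert y P) z' + P.card + 6 * c < 2 * νy + ν z + ν z')
    (h3 : 3 * t.demand (insert y P) y + P.card + 3 * c < 3 * νy + 3)
    (htr : ∀ z ∈ P, ∀ z' ∈ P, z ≠ z' → k + 1 + 3 * c ≤ ν z + ν z' + νy) :
    ∃ v ∈ N (t.par y), v ∉ U ∧ Hall t (Function.update N y (M v)) (insert y P) (insert v U) := by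
  obtain ⟨Q, hQ, hxQ, hQt, hcard, hold⟩ := h.exists_tight hy0 hyP hx (Or.inl hyk)
  by_contra! hc
  have h2d := RTree.two_le_demand hy0 hyP hyk
  have hd : ∀ z ∈ P, t.demand (insert y P) z ≤ (N z \ U).card :=
    fun z hz => h.demand_le hy0 hyP hyk hz
  set C := (N (t.par y) \ U) \ Q.biUnion N with hC
  have hCm : ∀ v ∈ C, v ∈ N (t.par y) ∧ v ∉ U := by
    intro v hv
    simp only [hC, mem_sdiff] at hv
    exact hv.1
  have hbad : ∀ v ∈ C, (M v \ U).card + 1 ≤ t.demand (insert y P) y ∨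
      ∃ z ∈ P, ((N z ∪ M v) \ insert v U).card + 1
        ≤ t.demand (insert y P) z + t.demand (insert y P) y := by
    intro v hv
    obtain ⟨ha, hb⟩ := hCm v hv
    exact (hall_insert_or hW hP hyP hx hU hs hν hb (hνy v ha hb) htr (hold v hv)).resolve_left
      (hc v ha hb)
  have hbad1 : ∀ v ∈ C, (M v \ U).card + 1 ≤ t.demand (insert y P) y := by
    intro v hv
    rcases hbad v hv with h' | h'
    · exact h'
    · exfalso
      obtain ⟨v', hv', hne⟩ := exists_mem_ne (show 1 < C.card by omega) v
      exact bad_pair_false Subset.rfl hU hs hν hd h1 h2 (hCm v hv).2 (hCm v' hv').2 hne.symm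
        (hνy v (hCm v hv).1 (hCm v hv).2) (hνy v' (hCm v' hv').1 (hCm v' hv').2) h' (hbad v' hv')
  obtain ⟨v₁, hv₁, v₂, hv₂, hne⟩ := one_lt_card.1 (show 1 < C.card by omega)
  have b1 := hbad1 v₁ hv₁
  have b2 := hbad1 v₂ hv₂
  have n1 := hνy v₁ (hCm v₁ hv₁).1 (hCm v₁ hv₁).2
  have n2 := hνy v₂ (hCm v₂ hv₂).1 (hCm v₂ hv₂).2
  have hQ1 := tight_subsingleton hW hP hyP hx hU hs hν (hCm v₁ hv₁).2 n1 htr hQ hxQ hQt b1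
  have hall : ∀ z ∈ P, ((N z ∪ M v₁ ∪ M v₂) \ U).card
      ≤ (N z \ U).card + (M v₁ \ U).card + (M v₂ \ U).card := by
    intro z _
    rw [union_sdiff_distrib, union_sdiff_distrib]
    have := card_union_le (N z \ U ∪ M v₁ \ U) (M v₂ \ U)
    have := card_union_le (N z \ U) (M v₁ \ U)
    omega
  have hlow : ∀ z ∈ P, ν z + 2 * νy ≤ ((N z ∪ M v₁ ∪ M v₂) \ U).card + P.card + 3 * c := by
    intro z hz
    have := card_union_three U (hs.old_new z hz v₁ (hCm v₁ hv₁).2)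
      (hs.old_new z hz v₂ (hCm v₂ hv₂).2) (hs.new_new v₁ v₂ hne)
    have := hν z hz
    omega
  rcases Nat.lt_or_ge 2 C.card with h3C | h2C
  · obtain ⟨a, b, e, ha, hb, he, hab, hae, hbe⟩ := two_lt_card_iff.1 h3C
    have e1 := card_union_three U (hs.new_new a b hab) (hs.new_new a e hae) (hs.new_new b e hbe)
    rw [union_sdiff_distrib, union_sdiff_distrib] at e1
    have e2 := card_union_le (M a \ U ∪ M b \ U) (M e \ U)
    have e3 := card_union_le (M a \ U) (M b \ U)
    have := hbad1 a ha
    have := hbad1 b hb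
    have := hbad1 e he
    have := hνy a (hCm a ha).1 (hCm a ha).2
    have := hνy b (hCm b hb).1 (hCm b hb).2
    have := hνy e (hCm e he).1 (hCm e he).2
    omega
  · rcases Nat.lt_or_ge 0 Q.card with hpos | h0
    · obtain ⟨q, rfl⟩ := card_eq_one.1 (show Q.card = 1 by omega)
      have hqP := singleton_subset_iff.1 hQ
      rw [sum_singleton, singleton_biUnion] at hQt
      have hqx : t.par y ≠ q := fun hh => hxQ (mem_singleton.2 hh)
      have e1 := hall q hqP
      have e2 := hlow q hqP
      have e3 := h1 q hqP
      rw [RTree.demand_insert_of_ne hqx] at e3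
      omega
    · have hQ0 : Q = ∅ := card_eq_zero.1 (by omega)
      have hCe : C = N (t.par y) \ U := by rw [hC, hQ0]; simp
      have e1 := hall _ hx
      have e2 := hlow _ hx
      have e3 := h1 _ hx
      rw [← hCe] at e1
      omega

end Placement

section SpecialPlacement

variable {V W : Type*} [DecidableEq V] [Fintype W] [DecidableEq W]
  {t : RTree W} {P Z : Finset W} {N : W → Finset V} {U : Finset V} {M : V → Finset V}
  {c k νy : ℕ} {ν : W → ℕ}

/-- Placing a vertex whose neighbourhood and that of the placed vertex `r` have a large union. -/
lemma Hall.exists_place_of_pair (h : Hall t N P U) (hW : Fintype.card W = k + 1) (hP : t.Closed P)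
    {y r : W} (hy0 : y ≠ t.root) (hyP : y ∉ P) (hx : t.par y ∈ P) (hyk : (t.kids y).Nonempty)
    (hr : r ∈ P) (hxr : t.par y ≠ r)
    (hU : U.card = P.card) (hs : Spread N P U M c)
    (hν : ∀ z ∈ P, ν z ≤ (N z).card) (hνy : ∀ v ∈ N (t.par y), v ∉ U → νy ≤ (M v).card)
    (hpair : ∀ v ∈ N (t.par y), v ∉ U → (insert y P)ᶜ.card ≤ ((N r ∪ M v) \ insert v U).card)
    {p₀ : V} (hp₀ : p₀ ∈ U)
    (hdc : ∀ p ∈ U, p ≠ p₀ → ((N (t.par y)).filter (fun v => p ∈ M v)).card ≤ c)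
    (h1 : ∀ z ∈ P, z ≠ r → 2 * t.demand (insert y P) y + t.demand (insert y P) z + P.card + 3 * c
      < 2 * νy + ν z)
    (h2 : ∀ z ∈ P, z ≠ r → ∀ z' ∈ P, z' ≠ r → z ≠ z' → 2 * t.demand (insert y P) y
      + t.demand (insert y P) z + t.demand (insert y P) z' + P.card + 6 * c
      < 2 * νy + ν z + ν z')
    (h3 : ∀ q ∈ P, q ≠ r → t.demand (insert y P) q + 2 * t.demand (insert y P) y + P.card + 5 * c
      < ν (t.par y) + 2 * νy + 2)
    (h4 : P.card + 2 * t.demand (insert y P) y ≤ 2 * νy + 1)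
    (h5 : t.demand (insert y P) y + 1 ≤ νy)
    (htr : ∀ z ∈ P, ∀ z' ∈ P, z ≠ z' → k + 1 + 3 * c ≤ ν z + ν z' + νy) :
    ∃ v ∈ N (t.par y), v ∉ U ∧ Hall t (Function.update N y (M v)) (insert y P) (insert v U) := by
  obtain ⟨Q, hQ, hxQ, hQt, hcard, hold⟩ := h.exists_tight hy0 hyP hx (Or.inl hyk)
  by_contra! hc
  have h2d := RTree.two_le_demand hy0 hyP hyk
  have hd : ∀ z ∈ P, t.demand (insert y P) z ≤ (N z \ U).card :=
    fun z hz => h.demand_le hy0 hyP hyk hz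
  have hrd : t.demand (insert y P) r + t.demand (insert y P) y ≤ (insert y P)ᶜ.card := by
    have hyr : y ≠ r := by rintro rfl; exact hyP hr
    have := RTree.sum_demand_le (hP.insert hx) (S := {r, y})
      (insert_subset (mem_insert_of_mem hr) (singleton_subset_iff.2 (mem_insert_self _ _)))
    rwa [sum_pair hyr.symm] at this
  set C := (N (t.par y) \ U) \ Q.biUnion N with hC
  have hCm : ∀ v ∈ C, v ∈ N (t.par y) ∧ v ∉ U := by
    intro v hv
    simp only [hC, mem_sdiff] at hv
    exact hv.1
  have hbad : ∀ v ∈ C, (M v \ U).card + 1 ≤ t.demand (insert y P) y ∨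
      ∃ z ∈ P.erase r, ((N z ∪ M v) \ insert v U).card + 1
        ≤ t.demand (insert y P) z + t.demand (insert y P) y := by
    intro v hv
    obtain ⟨ha, hb⟩ := hCm v hv
    rcases (hall_insert_or hW hP hyP hx hU hs hν hb (hνy v ha hb) htr (hold v hv)).resolve_left
      (hc v ha hb) with h' | ⟨z, hz, h'⟩
    · exact Or.inl h'
    · refine Or.inr ⟨z, mem_erase.2 ⟨?_, hz⟩, h'⟩
      rintro rfl
      have := hpair v ha hb
      omega
  have hbad1 : ∀ v ∈ C, (M v \ U).card + 1 ≤ t.demand (insert y P) y := by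
    intro v hv
    rcases hbad v hv with h' | h'
    · exact h'
    · exfalso
      obtain ⟨v', hv', hne⟩ := exists_mem_ne (show 1 < C.card by omega) v
      refine bad_pair_false (erase_subset r P) hU hs hν hd ?_ ?_ (hCm v hv).2 (hCm v' hv').2 hne.symm
        (hνy v (hCm v hv).1 (hCm v hv).2) (hνy v' (hCm v' hv').1 (hCm v' hv').2) h' (hbad v' hv')
      · intro z hz
        exact h1 z (mem_of_mem_erase hz) (ne_of_mem_erase hz)
      · intro z hz z' hz' hne
        exact h2 z (mem_of_mem_erase hz) (ne_of_mem_erase hz) z' (mem_of_mem_erase hz')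
          (ne_of_mem_erase hz') hne
  obtain ⟨v₁, hv₁, v₂, hv₂, hne⟩ := one_lt_card.1 (show 1 < C.card by omega)
  have b1 := hbad1 v₁ hv₁
  have b2 := hbad1 v₂ hv₂
  have n1 := hνy v₁ (hCm v₁ hv₁).1 (hCm v₁ hv₁).2
  have n2 := hνy v₂ (hCm v₂ hv₂).1 (hCm v₂ hv₂).2
  have hQ1 := tight_subsingleton hW hP hyP hx hU hs hν (hCm v₁ hv₁).2 n1 htr hQ hxQ hQt b1
  have hQr : r ∉ Q := by
    intro hrQ
    obtain ⟨q, rfl⟩ := card_eq_one.1 (show Q.card = 1 by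
      have := card_pos.2 ⟨r, hrQ⟩
      omega)
    obtain rfl := mem_singleton.1 hrQ
    rw [sum_singleton, singleton_biUnion] at hQt
    have e1 := hpair v₁ (hCm v₁ hv₁).1 (hCm v₁ hv₁).2
    have e2 : ((N r ∪ M v₁) \ insert v₁ U).card ≤ (N r \ U).card + (M v₁ \ U).card := by
      refine (card_le_card ?_).trans (card_union_le _ _)
      rw [← union_sdiff_distrib]
      exact sdiff_subset_sdiff le_rfl (subset_insert _ _)
    rw [RTree.demand_insert_of_ne hxr] at hrd
    omega
  have hlow : ν (t.par y) + 2 * νy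
      ≤ ((N (t.par y) ∪ M v₁ ∪ M v₂) \ U).card + P.card + 3 * c := by
    have := card_union_three U (hs.old_new _ hx v₁ (hCm v₁ hv₁).2)
      (hs.old_new _ hx v₂ (hCm v₂ hv₂).2) (hs.new_new v₁ v₂ hne)
    have := hν _ hx
    omega
  have hup : ((N (t.par y) ∪ M v₁ ∪ M v₂) \ U).card
      ≤ C.card + (Q.biUnion N \ U).card + (M v₁ \ U).card + (M v₂ \ U).card := by
    rw [union_sdiff_distrib, union_sdiff_distrib]
    have e1 := card_union_le (N (t.par y) \ U ∪ M v₁ \ U) (M v₂ \ U)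
    have e2 := card_union_le (N (t.par y) \ U) (M v₁ \ U)
    have e3 : (N (t.par y) \ U).card ≤ C.card + (Q.biUnion N \ U).card := by
      refine (card_le_card (fun q hq => ?_)).trans (card_union_le _ _)
      simp only [hC, mem_union, mem_sdiff] at hq ⊢
      tauto
    omega
  have hQd : ∃ q ∈ P, q ≠ r ∧ (Q.biUnion N \ U).card ≤ t.demand (insert y P) q := by
    rcases Nat.lt_or_ge 0 Q.card with hpos | h0
    · obtain ⟨q, rfl⟩ := card_eq_one.1 (show Q.card = 1 by omega)
      rw [sum_singleton] at hQt
      refine ⟨q, singleton_subset_iff.1 hQ, fun hh => hQr (mem_singleton.2 hh.symm), ?_⟩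
      rw [RTree.demand_insert_of_ne (fun hh => hxQ (mem_singleton.2 hh)), hQt]
    · have hQ0 : Q = ∅ := card_eq_zero.1 (by omega)
      exact ⟨_, hx, hxr, by rw [hQ0]; simp⟩
  obtain ⟨q, hq, hqr, hQd⟩ := hQd
  have e3 := h3 q hq hqr
  have hC2 : 2 * c + 1 ≤ C.card := by omega
  obtain ⟨m, hm⟩ := Nat.exists_eq_add_of_le h5
  have hmul : C.card * (m + 1) ≤ (U.erase p₀).card * c := by
    refine card_mul_le_card_mul (fun v p => p ∈ M v) (fun v hv => ?_) (fun p hp => ?_)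
    · have e1 := hbad1 v hv
      have e2 := hνy v (hCm v hv).1 (hCm v hv).2
      have e4 := card_sdiff_add_card_inter (M v) U
      have e5 := pred_card_le_card_erase (s := M v ∩ U) (a := p₀)
      rw [← inter_erase] at e5
      have e6 : (M v ∩ U.erase p₀).card
          ≤ (bipartiteAbove (fun v p => p ∈ M v) (U.erase p₀) v).card := by
        refine card_le_card (fun p hp => ?_)
        rw [mem_inter] at hp
        exact mem_filter.2 ⟨hp.2, hp.1⟩
      omega
    · refine (card_le_card (fun v hv => ?_)).trans (hdc p (mem_of_mem_erase hp) (ne_of_mem_erase hp))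
      obtain ⟨hv1, hv2⟩ := mem_filter.1 hv
      exact mem_filter.2 ⟨(hCm v hv1).1, hv2⟩
  rw [card_erase_of_mem hp₀] at hmul
  have e5 : (2 * c + 1) * (m + 1) ≤ C.card * (m + 1) := Nat.mul_le_mul_right _ hC2
  have e6 : (U.card - 1) * c ≤ (2 * (m + 1)) * c := Nat.mul_le_mul_right _ (by omega)
  nlinarith

end SpecialPlacement

section TwoCenters

variable {V W : Type*} [Fintype V] [DecidableEq V] [Fintype W] [DecidableEq W]
  {t : RTree W} {E : Finset (V × V)} {F : W → Finset (V × V)} {P : Finset W} {f : W → V}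
  {c k νy : ℕ}

/-- The sets from which the children of the placed vertices are chosen. -/
def pool (t : RTree W) (F : W → Finset (V × V)) (f : W → V) (z : W) : Finset V :=
  nb (F z) (t.side z) (f z)

lemma pool_update (y : W) (v : V) :
    pool t F (Function.update f y v)
      = Function.update (pool t F f) y (nb (F y) (t.side y) v) := by
  funext z
  by_cases h : z = y
  · subst h; simp [pool]
  · simp [pool, Function.update_of_ne h]

lemma PE.spread (h : PE t E P f) (hE : Host E c) (hF : ∀ z, F z ⊆ E) (y : W) :
    Spread (pool t F f) P (P.image f) (nb (F y) (t.side y)) c where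
  old_old z hz z' hz' hne := by
    refine (card_le_card (inter_subset_inter (nb_mono (hF z) _ _) (nb_mono (hF z') _ _))).trans
      (hE.codeg _ _ _ _ (fun hh => hne (h.inj hz hz' hh)))
  old_new z hz v hv := by
    refine (card_le_card (inter_subset_inter (nb_mono (hF z) _ _) (nb_mono (hF y) _ _))).trans
      (hE.codeg _ _ _ _ ?_)
    rintro rfl
    exact hv (mem_image_of_mem f hz)
  new_new v v' hne :=
    (card_le_card (inter_subset_inter (nb_mono (hF y) _ _) (nb_mono (hF y) _ _))).trans
      (hE.codeg _ _ _ _ hne)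
  irrefl v hv := hE.irrefl _ _ (nb_mono (hF y) _ _ hv)

lemma PE.extend_hall (h : PE t E P f) (hF : ∀ z, F z ⊆ E) {y : W} (hyP : y ∉ P)
    (hx : t.par y ∈ P) {v : V} (hv : v ∈ pool t F f (t.par y)) (hvU : v ∉ P.image f)
    (hall : Hall t (Function.update (pool t F f) y (nb (F y) (t.side y) v)) (insert y P)
      (insert v (P.image f))) :
    PE t E (insert y P) (Function.update f y v) ∧
      Hall t (pool t F (Function.update f y v)) (insert y P)
        ((insert y P).image (Function.update f y v)) := by
  refine ⟨h.extend hyP hx (nb_mono (hF _) _ _ hv) hvU, ?_⟩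
  rw [pool_update, image_update hyP]
  exact hall

/-- In a state without placed leaves, the demands of the placed vertices are controlled. -/
lemma RTree.demand_le_kids (x : W) : t.demand P x ≤ (t.kids x).card + t.extra P x := by
  unfold RTree.demand
  have : (t.pend P x).card ≤ (t.kids x).card := card_le_card sdiff_subset
  omega

lemma RTree.demand_root_le {y : W} (hy : y ∈ P) (hy0 : y ≠ t.root) :
    t.demand P (t.par y) + 1 ≤ (t.kids (t.par y)).card + t.extra P (t.par y) := by
  unfold RTree.demand
  have : (t.pend P (t.par y)).card < (t.kids (t.par y)).card := by
    refine card_lt_card ⟨sdiff_subset, fun hh => ?_⟩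
    exact (mem_sdiff.1 (hh (RTree.mem_kids.2 ⟨hy0, rfl⟩))).2 hy
  omega

end TwoCenters

section Hub

variable {V W : Type*} [Fintype V] [DecidableEq V] [Fintype W] [DecidableEq W]
  {t : RTree W} {E : Finset (V × V)} {F : W → Finset (V × V)} {P : Finset W} {f : W → V}
  {c k : ℕ} {v : W}

/-- `v` is a largest nonroot vertex, in number of children, and smaller than the root. -/
structure Second (t : RTree W) (v : W) : Prop where
  ne : v ≠ t.root
  pos : 1 ≤ (t.kids v).card
  lt : (t.kids v).card + 1 ≤ (t.kids t.root).card
  max : ∀ y, y ≠ t.root → (t.kids y).card ≤ (t.kids v).card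

lemma RTree.demand_cases (t : RTree W) (P : Finset W) (x : W) :
    (t.demand P x ≤ (t.kids x).card ∧ t.demand P x = (t.pend P x).card ∧ t.inner P x = 0) ∨
      (t.demand P x ≤ (t.kids x).card + 1 ∧ t.demand P x = t.inner P x + 1 ∧ 1 ≤ t.inner P x) := by
  have h := RTree.extra_inner (t := t) (P := P) x
  have h1 := RTree.demand_le_kids (t := t) (P := P) x
  have h2 : t.demand P x = (t.pend P x).card + t.extra P x := rfl
  omega

lemma Second.bound_set (hs : Second t v) (hW : Fintype.card W = k + 1)
    (hleaf : ∀ x ∈ P, (t.kids x).Nonempty) (Y Z : Finset W) (hY : ∀ y ∈ Y, (t.kids y).Nonempty)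
    (hYu : t.root ∉ Y) (hYv : v ∉ Y) :
    (t.kids t.root).card + (t.kids v).card + ∑ y ∈ Y, (t.kids y).card
      + ∑ z ∈ Z, t.inner P z + P.card ≤ k + 2 + Y.card := by
  have hk : ∀ x, 1 ≤ (t.kids x).card → (t.kids x).Nonempty := fun x h => card_pos.1 h
  have h1 : t.root ∉ insert v Y := by
    simp only [mem_insert, not_or]; exact ⟨hs.ne.symm, hYu⟩
  have h := RTree.sum_kids_add_inner_le (t := t) (P := P) hleaf (X := insert t.root (insert v Y))
    (Z := Z)
    (by
      intro x hx
      simp only [mem_insert] at hx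
      rcases hx with rfl | rfl | hx
      · exact hk _ (by have := hs.lt; omega)
      · exact hk _ hs.pos
      · exact hY x hx)
  rw [sum_insert h1, sum_insert hYv, card_insert_of_notMem h1, card_insert_of_notMem hYv,
    card_compl, hW] at h
  have := card_le_univ P
  omega

end Hub

section Bounds

variable {W : Type*} [Fintype W] [DecidableEq W] {t : RTree W} {P : Finset W}
  {c k b νv m : ℕ} {v : W}

/-- Lower bounds on the neighbourhood sizes used while a vertex that is not a leaf is placed. -/
structure Sizes (k c κ b νv m : ℕ) : Prop where
  c_pos : 1 ≤ c
  c_le : 12 * c + 1 ≤ k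
  m_le_b : m ≤ b
  m_le_v : m ≤ νv
  three : 3 * c + k + 2 ≤ 3 * m
  three' : κ ≤ 2 → 3 * c + k + 3 ≤ 3 * m
  two_v : 3 * c + k + 3 ≤ 2 * m + νv
  two_b : 3 * c + k + 3 ≤ 2 * m + b
  pair : 18 * c + 4 * k + 8 ≤ 6 * m + 3 * b + 3 * νv

/-- The size bounds that are sufficient for placing a vertex. -/
def size (t : RTree W) (v : W) (b νv m : ℕ) (z : W) : ℕ :=
  if z = t.root then b else if z = v then νv else m

lemma Sizes.place_bounds (hz : Sizes k c (t.kids t.root).card b νv m) (hs : Second t v)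
    (hW : Fintype.card W = k + 1) {y x : W}
    (hleaf : ∀ x ∈ insert y P, (t.kids x).Nonempty) (hyP : y ∉ P) (hyu : y ≠ t.root) (hyv : y ≠ v)
    (hx : x ∈ P) (hxu : x ≠ t.root) (hxp : t.par x = t.root) :
    (∀ z ∈ P, 2 * t.demand (insert y P) y + t.demand (insert y P) z + P.card + 3 * c
      < 2 * m + size t v b νv m z) ∧
    (∀ z ∈ P, ∀ z' ∈ P, z ≠ z' → 2 * t.demand (insert y P) y + t.demand (insert y P) z
      + t.demand (insert y P) z' + P.card + 6 * c < 2 * m + size t v b νv m z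
        + size t v b νv m z') ∧
    3 * t.demand (insert y P) y + P.card + 3 * c < 3 * m + 3 ∧
    (∀ z ∈ P, ∀ z' ∈ P, z ≠ z' → k + 1 + 3 * c ≤ size t v b νv m z + size t v b νv m z' + m) := by
  obtain ⟨z1, z2, z3, z4, z5, z6, z7, z8, z9⟩ := hz
  have s1 := hs.pos
  have s2 := hs.lt
  have s3 := hs.max y hyu
  have hroot := RTree.demand_root_le (P := insert y P) (mem_insert_of_mem hx) hxu
  rw [hxp] at hroot
  have hroot' := RTree.extra_inner (t := t) (P := insert y P) t.root
  have hne : ∀ z ∈ P, z ≠ y := by rintro z hz rfl; exact hyP hz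
  have hcard : (insert y P).card = P.card + 1 := card_insert_of_notMem hyP
  have hPy : ∀ z ∈ P, (t.kids z).Nonempty := fun z hz => hleaf z (mem_insert_of_mem hz)
  have hyk := hleaf y (mem_insert_self _ _)
  have hsv : size t v b νv m v = νv := by simp [size, hs.ne]
  have hsu : size t v b νv m t.root = b := by simp [size]
  have hsz : ∀ z, z ≠ t.root → z ≠ v → size t v b νv m z = m := by
    intro z h1 h2; simp [size, h1, h2]
  have hsize : ∀ z, m ≤ size t v b νv m z := by
    intro z; unfold size; split_ifs <;> omega
  have dy := RTree.demand_cases t (insert y P) y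
  have dz := RTree.demand_cases t (insert y P)
  have B := hs.bound_set hW hleaf
  have two : ∀ z ∈ P, ∀ z' ∈ P, z ≠ z' → z' ≠ t.root → (z = v ∨ z' ≠ v) →
      2 * t.demand (insert y P) y + t.demand (insert y P) z
      + t.demand (insert y P) z' + P.card + 6 * c < 2 * m + size t v b νv m z
        + size t v b νv m z' := by
    intro z hz z' hz' hzz hzu' hzv'
    have dz1 := dz z
    have dz2 := dz z'
    have n1 := hne z hz
    have n2 := hne z' hz'
    by_cases hzu : z = t.root
    · subst hzu
      have hzv' : z' ≠ v := hzv'.resolve_left (fun h => hs.ne h.symm)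
      have := B {y, z'} {y, t.root, z'} (by
        intro q hq
        simp only [mem_insert, mem_singleton] at hq
        rcases hq with rfl | rfl
        exacts [hyk, hPy _ hz']) (by simp [hyu.symm, hzz]) (by simp [hyv.symm, hzv'.symm])
      rw [sum_pair n2.symm, sum_insert (by simp [n1.symm, n2.symm]), sum_pair hzz,
        card_pair n2.symm] at this
      rw [hsu, hsz z' hzu' hzv']
      omega
    · by_cases hzv : z = v
      · subst hzv
        have := B {y, z'} {y, z, z'} (by
          intro q hq
          simp only [mem_insert, mem_singleton] at hq
          rcases hq with rfl | rfl
          exacts [hyk, hPy _ hz']) (by simp [hyu.symm, hzu'.symm]) (by simp [hyv.symm, hzz])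
        rw [sum_pair n2.symm, sum_insert (by simp [n1.symm, n2.symm]), sum_pair hzz,
          card_pair n2.symm] at this
        rw [hsv, hsz z' hzu' hzz.symm]
        omega
      · have hzv' : z' ≠ v := hzv'.resolve_left hzv
        have := B {y, z, z'} {y, z, z'} (by
          intro q hq
          simp only [mem_insert, mem_singleton] at hq
          rcases hq with rfl | rfl | rfl
          exacts [hyk, hPy _ hz, hPy _ hz']) (by simp [hyu.symm, Ne.symm hzu, hzu'.symm])
          (by simp [hyv.symm, Ne.symm hzv, hzv'.symm])
        have hn : y ∉ ({z, z'} : Finset W) := by simp [n1.symm, n2.symm]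
        rw [sum_insert hn, sum_pair hzz, sum_insert hn, sum_pair hzz, card_insert_of_notMem hn,
          card_pair hzz] at this
        rw [hsz z hzu hzv, hsz z' hzu' hzv']
        omega
  have uv : t.root ∈ P → v ∈ P → 2 * t.demand (insert y P) y + t.demand (insert y P) t.root
      + t.demand (insert y P) v + P.card + 6 * c < 2 * m + b + νv := by
    intro hu hv
    have n1 := hne _ hu
    have n2 := hne _ hv
    have dz1 := dz t.root
    have dz2 := dz v
    have := B {y} {y, t.root, v} (by
          intro q hq
          rw [mem_singleton.1 hq]; exact hyk) (by simp [hyu.symm]) (by simp [hyv.symm])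
    rw [sum_singleton, sum_insert (by simp [n1.symm, n2.symm]), sum_pair hs.ne.symm,
      card_singleton] at this
    have hP2 : 2 ≤ P.card := one_lt_card.2 ⟨_, hu, _, hv, hs.ne.symm⟩
    omega
  refine ⟨?_, ?_, ?_, ?_⟩
  · intro z hz
    have dz1 := dz z
    have n1 := hne z hz
    by_cases hzu : z = t.root
    · subst hzu
      have := B {y} {y, t.root} (by
          intro q hq
          rw [mem_singleton.1 hq]; exact hyk) (by simp [hyu.symm]) (by simp [hyv.symm])
      rw [sum_singleton, sum_pair n1.symm, card_singleton] at this
      rw [hsu]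
      omega
    · by_cases hzv : z = v
      · subst hzv
        have := B {y} {y, z} (by
          intro q hq
          rw [mem_singleton.1 hq]; exact hyk) (by simp [hyu.symm]) (by simp [hyv.symm])
        rw [sum_singleton, sum_pair n1.symm, card_singleton] at this
        rw [hsv]
        omega
      · have := B {y, z} {y, z} (by
          intro q hq
          simp only [mem_insert, mem_singleton] at hq
          rcases hq with rfl | rfl
          exacts [hyk, hPy _ hz]) (by simp [hyu.symm, Ne.symm hzu]) (by simp [hyv.symm, Ne.symm hzv])
        rw [sum_pair n1.symm, sum_pair n1.symm, card_pair n1.symm] at this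
        rw [hsz z hzu hzv]
        omega
  · intro z hz z' hz' hzz
    by_cases hzu' : z' = t.root
    · by_cases hzv : z = v
      · rw [hzu', hzv, hsu, hsv]
        have := uv (hzu' ▸ hz') (hzv ▸ hz)
        omega
      · have := two z' hz' z hz hzz.symm (fun h => hzz (h.trans hzu'.symm)) (Or.inr hzv)
        omega
    · by_cases hzv : z = v
      · exact two z hz z' hz' hzz hzu' (Or.inl hzv)
      · by_cases hzv' : z' = v
        · by_cases hzu : z = t.root
          · rw [hzu, hzv', hsu, hsv]
            have := uv (hzu ▸ hz) (hzv' ▸ hz')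
            omega
          · have := two z' hz' z hz hzz.symm hzu (Or.inl hzv')
            omega
        · exact two z hz z' hz' hzz hzu' (Or.inr hzv')
  · have := B {y} {y} (by
      intro q hq
      rw [mem_singleton.1 hq]; exact hyk) (by simp [hyu.symm]) (by simp [hyv.symm])
    rw [sum_singleton, sum_singleton, card_singleton] at this
    omega
  · intro z hz z' hz' _
    have := hsize z
    have := hsize z'
    omega

end Bounds

section HubPhase

variable {V W : Type*} [Fintype V] [DecidableEq V] [Fintype W] [DecidableEq W]
  {t : RTree W} {E : Finset (V × V)} {P : Finset W} {f : W → V} {c k b νv m : ℕ} {v : W}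

/-- Partial embeddings that contain the two largest vertices and can be completed. -/
structure HubState (t : RTree W) (E : Finset (V × V)) (v : W) (b νv : ℕ) (P : Finset W)
    (f : W → V) : Prop where
  pe : PE t E P f
  v_mem : v ∈ P
  kid_mem : ∃ x ∈ P, x ≠ t.root ∧ t.par x = t.root
  root_le : b ≤ (nb E true (f t.root)).card
  v_le : νv ≤ (nb E (t.side v) (f v)).card
  hall : Hall t (pool t (fun _ => E) f) P (P.image f)
  leaf : (∃ x ∈ P, t.kids x = ∅) → ∀ y, (t.kids y).Nonempty → y ∈ P

lemma HubState.place (h : HubState t E v b νv P f) {y : W} (hyP : y ∉ P)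
    (hx : t.par y ∈ P) {p : V} (hp : p ∈ pool t (fun _ => E) f (t.par y)) (hpU : p ∉ P.image f)
    (hall : Hall t (Function.update (pool t (fun _ => E) f) y (nb E (t.side y) p)) (insert y P)
      (insert p (P.image f)))
    (hleaf : (t.kids y).Nonempty ∨ ∀ z, (t.kids z).Nonempty → z ∈ P) :
    HubState t E v b νv (insert y P) (Function.update f y p) := by
  obtain ⟨h1, h2⟩ := h.pe.extend_hall (fun _ => Subset.rfl) hyP hx hp hpU hall
  have hne : ∀ z ∈ P, z ≠ y := by rintro z hz rfl; exact hyP hz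
  refine ⟨h1, mem_insert_of_mem h.v_mem, ?_, ?_, ?_, h2, ?_⟩
  · obtain ⟨x, hx, hh⟩ := h.kid_mem
    exact ⟨x, mem_insert_of_mem hx, hh⟩
  · rw [Function.update_of_ne (hne _ h.pe.closed.1)]
    exact h.root_le
  · rw [Function.update_of_ne (hne _ h.v_mem)]
    exact h.v_le
  · rintro ⟨x, hxP, hxk⟩ z hz
    rcases hleaf with hyk | hall
    · rcases mem_insert.1 hxP with rfl | hxP
      · rw [hxk] at hyk; exact absurd rfl hyk.ne_empty
      · exact mem_insert_of_mem (h.leaf ⟨x, hxP, hxk⟩ z hz)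
    · exact mem_insert_of_mem (hall z hz)

lemma HubState.exists_insert (h : HubState t E v b νv P f) (hE : Host E c)
    (hW : Fintype.card W = k + 1) (hs : Second t v)
    (hz : Sizes k c (t.kids t.root).card b νv m) (hm : ∀ s, MinDeg E s m) (hP : P ≠ univ) :
    ∃ P' f', P.card < P'.card ∧ HubState t E v b νv P' f' := by
  have hroot : ∀ y, y ∉ P → y ≠ t.root := by rintro y hy rfl; exact hy h.pe.closed.1
  have hnb : ∀ y ∈ P, y ≠ t.root → m ≤ (nb E (t.side y) (f y)).card := fun y hy hy0 =>
    hm _ _ ⟨_, h.pe.adj' hy hy0⟩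
  obtain ⟨x, hxP, hx0, hxr⟩ := h.kid_mem
  by_cases hall : ∀ z, (t.kids z).Nonempty → z ∈ P
  · obtain ⟨y, hy⟩ : ∃ y, y ∉ P := by
      by_contra! hc
      exact hP (eq_univ_of_forall hc)
    obtain ⟨y, hyP, hyx, -⟩ := h.pe.closed.exists_next hy
    have hk : ∀ z, z ∉ P → t.kids z = ∅ := fun z hz => by
      by_contra hc
      exact hz (hall z (nonempty_iff_ne_empty.2 hc))
    obtain ⟨Q, -, -, -, hcard, hold⟩ := h.hall.exists_tight (hroot y hyP) hyP hyx
      (Or.inr fun z hz => hk z (mem_sdiff.1 hz).2)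
    have hpos : 0 < t.demand P (t.par y) := by
      have : 0 < (t.pend P (t.par y)).card :=
        card_pos.2 ⟨y, RTree.mem_pend.2 ⟨⟨hroot y hyP, rfl⟩, hyP⟩⟩
      unfold RTree.demand
      omega
    obtain ⟨p, hp⟩ := card_pos.1 (hpos.trans_le hcard)
    have hp' := mem_sdiff.1 (mem_sdiff.1 hp).1
    refine ⟨insert y P, Function.update f y p, by rw [card_insert_of_notMem hyP]; omega,
      h.place hyP hyx hp'.1 hp'.2 (hall_insert_of_demand_eq_zero (hold p hp) ?_) (Or.inr hall)⟩
    simp [RTree.demand, RTree.extra, RTree.pend, hk y hyP]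
  · push Not at hall
    obtain ⟨z, hzk, hzP⟩ := hall
    obtain ⟨y, hyP, hyx, hyz⟩ := h.pe.closed.exists_next hzP
    have hyk : (t.kids y).Nonempty := by
      rcases hyz with rfl | ⟨z', hz', hz''⟩
      · exact hzk
      · exact ⟨z', RTree.mem_kids.2 ⟨hz', hz''⟩⟩
    have hleaf : ∀ q ∈ insert y P, (t.kids q).Nonempty := by
      intro q hq
      rcases mem_insert.1 hq with rfl | hq
      · exact hyk
      · by_contra hc
        exact hzP (h.leaf ⟨q, hq, not_nonempty_iff_eq_empty.1 hc⟩ z hzk)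
    have hyv : y ≠ v := by rintro rfl; exact hyP h.v_mem
    obtain ⟨h1, h2, h3, h4⟩ := hz.place_bounds hs hW hleaf hyP (hroot y hyP) hyv hxP hx0 hxr
    obtain ⟨p, hp, hpU, hh⟩ := h.hall.exists_place (M := nb E (t.side y)) (c := c) (νy := m)
      (ν := size t v b νv m) hW h.pe.closed (hroot y hyP) hyP hyx hyk h.pe.card_image
      (h.pe.spread hE (fun _ => Subset.rfl) y) (by
        intro q hq
        unfold size pool
        split_ifs with e1 e2
        · subst e1
          rw [t.side_root]
          exact h.root_le
        · subst e2
          exact h.v_le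
        · exact hnb q hq e1) (by
        intro p hp _
        refine hm _ _ ⟨f (t.par y), ?_⟩
        rw [t.side_par (hroot y hyP), ← mem_nb_not]
        exact hp) h1 h2 h3 h4
    exact ⟨insert y P, Function.update f y p, by rw [card_insert_of_notMem hyP]; omega,
      h.place hyP hyx hp hpU hh (Or.inl hyk)⟩

lemma HubState.embeds (h : HubState t E v b νv P f) (hE : Host E c)
    (hW : Fintype.card W = k + 1) (hs : Second t v)
    (hz : Sizes k c (t.kids t.root).card b νv m) (hm : ∀ s, MinDeg E s m) : EmbedsRT t E :=
  embeds_of_extend (HubState t E v b νv) (fun _ _ h => h.pe)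
    (fun _ _ h hP => h.exists_insert hE hW hs hz hm hP) h

end HubPhase

section Path

variable {V W : Type*} [Fintype V] [DecidableEq V] [Fintype W] [DecidableEq W]
  {t : RTree W} {E E' : Finset (V × V)} {P : Finset W} {f : W → V} {c k b νv m : ℕ} {v : W} {w : V}

/-- `z` is `v` or an ancestor of `v`. -/
def RTree.Anc (t : RTree W) (v z : W) : Prop := ∃ i, t.par^[i] v = z ∧ t.dep z + i = t.dep v

lemma RTree.Anc.eq_of_dep_eq {z z' : W} (h : t.Anc v z) (h' : t.Anc v z')
    (hd : t.dep z = t.dep z') : z = z' := by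
  obtain ⟨i, rfl, hi⟩ := h
  obtain ⟨j, rfl, hj⟩ := h'
  rw [show i = j by omega]

lemma RTree.Closed.exists_anc (hP : t.Closed P) (hv : v ∉ P) :
    ∃ z, z ∉ P ∧ t.par z ∈ P ∧ t.Anc v z ∧ (z = v ∨ (t.kids z).Nonempty) := by
  suffices H : ∀ n y, t.dep y = n → y ∉ P → t.Anc v y → (y = v ∨ (t.kids y).Nonempty) →
      ∃ z, z ∉ P ∧ t.par z ∈ P ∧ t.Anc v z ∧ (z = v ∨ (t.kids z).Nonempty) from
    H _ v rfl hv ⟨0, rfl, rfl⟩ (Or.inl rfl)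
  intro n
  induction n with
  | zero =>
    intro y hd hy _ _
    by_cases hy0 : y = t.root
    · exact absurd (hy0 ▸ hP.1) hy
    · have := t.dep_par y hy0
      omega
  | succ n ih =>
    intro y hd hy ha hk
    by_cases hyp : t.par y ∈ P
    · exact ⟨y, hy, hyp, ha, hk⟩
    · have hy0 : y ≠ t.root := by rintro rfl; exact hy hP.1
      have hdp := t.dep_par y hy0
      obtain ⟨i, hi, hd'⟩ := ha
      exact ih (t.par y) (by omega) hyp
        ⟨i + 1, by rw [Function.iterate_succ_apply', hi], by omega⟩
        (Or.inr ⟨y, RTree.mem_kids.2 ⟨hy0, rfl⟩⟩)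

/-- The pair sets used while the path from the root to `v` is placed. -/
def stage (t : RTree W) (v : W) (E E' : Finset (V × V)) (z : W) : Finset (V × V) :=
  if z = t.root ∨ z = v then E else E'

lemma stage_subset (hE' : E' ⊆ E) (z : W) : stage t v E E' z ⊆ E := by
  unfold stage
  split_ifs
  exacts [Subset.rfl, subset_trans hE' Subset.rfl]

/-- Partial embeddings of the path from the root to `v`. -/
structure PathState (t : RTree W) (E E' : Finset (V × V)) (v : W) (w : V) (P : Finset W)
    (f : W → V) : Prop where
  pe : PE t E P f
  notMem : v ∉ P
  kids : ∀ z ∈ P, (t.kids z).Nonempty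
  kid_mem : ∃ x ∈ P, x ≠ t.root ∧ t.par x = t.root ∧ t.Anc v x
  map_root : f t.root = w
  nonempty : ∀ z ∈ P, z ≠ t.root → (nb E' (t.side z) (f z)).Nonempty
  hall : Hall t (pool t (stage t v E E') f) P (P.image f)

/-- Lower bounds on the neighbourhood sizes used for the path from the root to `v`. -/
structure PathSizes (k c κu κv b νv m : ℕ) : Prop where
  c_pos : 1 ≤ c
  c_le : 12 * c + 1 ≤ k
  m_le_b : m ≤ b
  m_le_v : m ≤ νv
  three : 3 * c + k + 2 ≤ 3 * m
  two_b : 3 * c + k + 3 ≤ 2 * m + b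
  two_v : 5 * c + k + 2 ≤ m + 2 * νv ∨ 5 * c + 2 * k + 2 ≤ m + 2 * νv + 2 * κu
  half : k + κv ≤ 2 * νv + κu
  half' : k + 2 ≤ 2 * νv + κu
  v_lt : κv + 1 ≤ νv
  u_le : κu ≤ b
  u_lt : 2 * κu ≤ k → κu + 1 ≤ b

lemma PathState.exists_interior (h : PathState t E E' v w P f) (hE : Host E c) (hE' : E' ⊆ E)
    (hW : Fintype.card W = k + 1) (hs : Second t v)
    (hz : PathSizes k c (t.kids t.root).card (t.kids v).card b νv m)
    (hm : ∀ s, MinDeg E' s m) (hw : b ≤ (nb E true w).card) (hu : 3 ≤ (t.kids t.root).card)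
    {y : W} (hyP : y ∉ P) (hyx : t.par y ∈ P) (hya : t.Anc v y) (hyv : y ≠ v)
    (hyk : (t.kids y).Nonempty) :
    ∃ f', PathState t E E' v w (insert y P) f' := by
  have hy0 : y ≠ t.root := by rintro rfl; exact hyP h.pe.closed.1
  obtain ⟨x, hxP, hx0, hxr, hxa⟩ := h.kid_mem
  have hyr : t.par y ≠ t.root := by
    intro hc
    apply hyP
    rwa [hya.eq_of_dep_eq hxa (by rw [t.dep_par y hy0, t.dep_par x hx0, hc, hxr])]
  have hne : ∀ z ∈ P, z ≠ v := by rintro z hzP rfl; exact h.notMem hzP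
  have hleaf : ∀ q ∈ insert y P, (t.kids q).Nonempty := by
    intro q hq
    rcases mem_insert.1 hq with rfl | hq
    exacts [hyk, h.kids q hq]
  have hst : ∀ z, z ≠ t.root → z ≠ v → stage t v E E' z = E' := by
    intro z h1 h2
    simp [stage, h1, h2]
  have hsr : stage t v E E' t.root = E := by simp [stage]
  obtain ⟨z1, z2, z3, z4, z5, z6, z7, z8, z9, z10, z11, z12⟩ := hz
  have hsizes : Sizes k c (t.kids t.root).card b (18 * c + 4 * k + 8 + m) m := by
    constructor <;> omega
  obtain ⟨h1, h2, h3, h4⟩ := hsizes.place_bounds hs hW hleaf hyP hy0 hyv hxP hx0 hxr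
  have hnb : ∀ p ∈ pool t (stage t v E E') f (t.par y), (nb E' (t.side y) p).Nonempty := by
    intro p hp
    refine ⟨f (t.par y), ?_⟩
    rw [t.side_par hy0, ← mem_nb_not, ← hst _ hyr (hne _ hyx)]
    exact hp
  obtain ⟨p, hp, hpU, hh⟩ := h.hall.exists_place (M := nb (stage t v E E' y) (t.side y)) (c := c)
    (νy := m) (ν := size t v b (18 * c + 4 * k + 8 + m) m) hW h.pe.closed hy0 hyP hyx hyk
    h.pe.card_image (h.pe.spread hE (stage_subset hE') y) (by
      intro q hq
      unfold size pool
      rw [if_neg (hne q hq)]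
      split_ifs with e1
      · subst e1
        rw [t.side_root, h.map_root, hsr]
        exact hw
      · rw [hst q e1 (hne q hq)]
        exact hm _ _ (h.nonempty q hq e1)) (by
      intro p hp _
      rw [hst y hy0 hyv]
      exact hm _ _ (hnb p hp)) h1 h2 h3 h4
  obtain ⟨g1, g2⟩ := h.pe.extend_hall (stage_subset hE') hyP hyx hp hpU hh
  have hney : ∀ z ∈ P, z ≠ y := by rintro z hz rfl; exact hyP hz
  refine ⟨Function.update f y p, g1, ?_, hleaf, ⟨x, mem_insert_of_mem hxP, hx0, hxr, hxa⟩, ?_, ?_,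
    g2⟩
  · rw [mem_insert, not_or]
    exact ⟨hyv.symm, h.notMem⟩
  · rw [Function.update_of_ne (hney _ h.pe.closed.1)]
    exact h.map_root
  · intro z hz hz0
    rcases mem_insert.1 hz with rfl | hz
    · rw [Function.update_self]
      exact hnb p hp
    · rw [Function.update_of_ne (hney z hz)]
      exact h.nonempty z hz hz0

lemma hubState_of_path (hE' : E' ⊆ E) (g1 : PE t E (insert v P) f)
    (g2 : Hall t (pool t (stage t v E E') f) (insert v P) ((insert v P).image f))
    (hk : ∀ z ∈ insert v P, (t.kids z).Nonempty)
    (hkid : ∃ x ∈ insert v P, x ≠ t.root ∧ t.par x = t.root) (hw : b ≤ (nb E true (f t.root)).card)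
    (hv : νv ≤ (nb E (t.side v) (f v)).card) : HubState t E v b νv (insert v P) f where
  pe := g1
  v_mem := mem_insert_self _ _
  kid_mem := hkid
  root_le := hw
  v_le := hv
  hall := g2.congr (fun z _ => nb_mono (stage_subset hE' z) _ _)
  leaf := by
    rintro ⟨x, hx, hx0⟩
    exact absurd hx0 (hk x hx).ne_empty

lemma PathState.exists_last (h : PathState t E E' v w P f) (hE : Host E c) (hE' : E' ⊆ E)
    (hW : Fintype.card W = k + 1) (hs : Second t v)
    (hz : PathSizes k c (t.kids t.root).card (t.kids v).card b νv m)
    (hm : ∀ s, MinDeg E' s m) (hw : b ≤ (nb E true w).card)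
    (hpair : ∀ p, p ≠ w → (nb E' (t.side v) p).Nonempty →
      k ≤ ((nb E true w ∪ nb E (t.side v) p).erase w).card ∧ νv ≤ (nb E (t.side v) p).card)
    (hvx : t.par v ∈ P) :
    ∃ f', HubState t E v b νv (insert v P) f' := by
  obtain ⟨x, hxP, hx0, hxr, hxa⟩ := h.kid_mem
  have hv0 := hs.ne
  have hvP := h.notMem
  have hvr : t.par v ≠ t.root := by
    intro hc
    have ha : t.Anc v v := ⟨0, rfl, rfl⟩
    apply hvP
    rwa [ha.eq_of_dep_eq hxa (by rw [t.dep_par v hv0, t.dep_par x hx0, hc, hxr])]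
  have hne : ∀ z ∈ P, z ≠ v := by rintro z hzP rfl; exact hvP hzP
  have hvk : (t.kids v).Nonempty := card_pos.1 hs.pos
  have hleaf : ∀ q ∈ insert v P, (t.kids q).Nonempty := by
    intro q hq
    rcases mem_insert.1 hq with rfl | hq
    exacts [hvk, h.kids q hq]
  have hst : ∀ z, z ≠ t.root → z ≠ v → stage t v E E' z = E' := by
    intro z h1 h2
    simp [stage, h1, h2]
  have hsr : stage t v E E' t.root = E := by simp [stage]
  have hsv : stage t v E E' v = E := by simp [stage]
  obtain ⟨z1, z2, z3, z4, z5, z6, z7, z8, z9, z10, z11, z12⟩ := hz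
  have s1 := hs.pos
  have s2 := hs.lt
  have hcard : (insert v P).card = P.card + 1 := card_insert_of_notMem hvP
  have hwU : w ∈ P.image f := h.map_root ▸ mem_image_of_mem f h.pe.closed.1
  have hP2 : 2 ≤ P.card := one_lt_card.2 ⟨_, h.pe.closed.1, _, hxP, hx0.symm⟩
  have hnb : ∀ p ∈ pool t (stage t v E E') f (t.par v), (nb E' (t.side v) p).Nonempty := by
    intro p hp
    refine ⟨f (t.par v), ?_⟩
    rw [t.side_par hv0, ← mem_nb_not, ← hst _ hvr (hne _ hvx)]
    exact hp
  have hpr : ∀ p ∈ pool t (stage t v E E') f (t.par v), p ∉ P.image f →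
      k ≤ ((nb E true w ∪ nb E (t.side v) p).erase w).card ∧ νv ≤ (nb E (t.side v) p).card := by
    intro p hp hpU
    refine hpair p ?_ (hnb p hp)
    rintro rfl
    exact hpU hwU
  have dz := RTree.demand_cases t (insert v P)
  have B := hs.bound_set hW hleaf
  have B0 := B ∅ {v} (by simp) (by simp) (by simp)
  simp only [sum_empty, sum_singleton, card_empty] at B0
  have dv := dz v
  have hsz : ∀ z, z ≠ t.root → size t v b νv m z = if z = v then νv else m := by
    intro z hz
    simp [size, hz]
  have h1 : ∀ z ∈ P, z ≠ t.root → 2 * t.demand (insert v P) v + t.demand (insert v P) z + P.card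
      + 5 * c < m + 2 * νv + 2 := by
    intro z hz hz0
    have := B {z} {v, z} (by
      intro q hq
      rw [mem_singleton.1 hq]
      exact h.kids z hz) (by simp [hz0.symm]) (by simp [(hne z hz).symm])
    rw [sum_singleton, sum_pair (hne z hz).symm, card_singleton] at this
    have := dz z
    have e : 2 * t.demand (insert v P) v + t.demand (insert v P) z + P.card ≤ k + 2 ∧
        2 * t.demand (insert v P) v + t.demand (insert v P) z + P.card
          + 2 * (t.kids t.root).card ≤ 2 * k + 2 := by
      clear z3 z4 z5 z6 z7 z8 z9 z10 z11 z12
      omega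
    clear this dv B0
    omega
  clear z7
  obtain ⟨p, hp, hpU, hh⟩ := h.hall.exists_place_of_pair (M := nb (stage t v E E' v) (t.side v))
    (c := c) (νy := νv) (ν := fun z => if z = t.root then b else m) (r := t.root)
    (p₀ := f (t.par v)) hW h.pe.closed hv0 hvP hvx hvk h.pe.closed.1 hvr
    h.pe.card_image (h.pe.spread hE (stage_subset hE') v) (by
      intro q hq
      unfold pool
      split_ifs with e1
      · subst e1
        rw [t.side_root, h.map_root, hsr]
        exact hw
      · rw [hst q e1 (hne q hq)]
        exact hm _ _ (h.nonempty q hq e1)) (by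
      intro p hp hpU
      rw [hsv]
      exact (hpr p hp hpU).2) (by
      intro p hp hpU
      have e1 := (hpr p hp hpU).1
      have e2 : pool t (stage t v E E') f t.root = nb E true w := by
        unfold pool
        rw [hsr, t.side_root, h.map_root]
      rw [e2, hsv]
      set A := nb E true w ∪ nb E (t.side v) p
      have e3 : (A.erase w).card ≤ (A \ insert p (P.image f)).card
          + ((insert p (P.image f)).erase w).card := by
        refine (card_le_card (fun q hq => ?_)).trans (card_union_le _ _)
        simp only [mem_erase, mem_union, mem_sdiff] at hq ⊢
        tauto
      rw [card_erase_of_mem (mem_insert_of_mem hwU), card_insert_of_notMem hpU, h.pe.card_image]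
        at e3
      rw [card_compl, hcard]
      omega)
    (mem_image_of_mem f hvx) (by
      intro q hq hqne
      refine (card_le_card (fun p hp => ?_)).trans
        (hE.codeg (t.side (t.par v)) (t.side (t.par v)) (f (t.par v)) q hqne.symm)
      obtain ⟨hp1, hp2⟩ := mem_filter.1 hp
      refine mem_inter.2 ⟨nb_mono (stage_subset hE' _) _ _ hp1, ?_⟩
      rw [hsv, t.side_par hv0] at hp2
      exact mem_nb_not.2 hp2)
    (by
      intro z hz hz0
      have := h1 z hz hz0
      simp only [if_neg hz0]
      omega)
    (by
      intro z hz hz0 z' hz' hz0' hzz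
      simp only [if_neg hz0, if_neg hz0']
      have hn := (hne z hz).symm
      have hn' := (hne z' hz').symm
      have := B {z, z'} {v, z, z'} (by
        intro q hq
        simp only [mem_insert, mem_singleton] at hq
        rcases hq with rfl | rfl
        exacts [h.kids _ hz, h.kids _ hz']) (by simp [hz0.symm, hz0'.symm]) (by simp [hn, hn'])
      have hnn : v ∉ ({z, z'} : Finset W) := by simp [hn, hn']
      rw [sum_pair hzz, sum_insert hnn, sum_pair hzz, card_pair hzz] at this
      have := dz z
      have := dz z'
      omega)
    (by
      intro q hq hq0
      have := h1 q hq hq0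
      simp only [if_neg hvr]
      omega)
    (by omega) (by omega)
    (by
      intro z _ z' _ _
      split_ifs <;> omega)
  obtain ⟨g1, g2⟩ := h.pe.extend_hall (stage_subset hE') hvP hvx hp hpU hh
  refine ⟨Function.update f v p, hubState_of_path hE' g1 g2 hleaf
    ⟨x, mem_insert_of_mem hxP, hx0, hxr⟩ ?_ ?_⟩
  · rwa [Function.update_of_ne hv0.symm, h.map_root]
  · rw [Function.update_self]
    exact (hpr p hp hpU).2

end Path

section Start

variable {V W : Type*} [Fintype V] [DecidableEq V] [Fintype W] [DecidableEq W]
  {t : RTree W} {E E' : Finset (V × V)} {P : Finset W} {f : W → V} {c k b νv m : ℕ} {v : W} {w : V}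

lemma hall_root (hE : Host E c) (hW : Fintype.card W = k + 1) (hs : Second t v)
    (hub : (t.kids t.root).card ≤ b)
    (hub' : 2 * (t.kids t.root).card ≤ k → (t.kids t.root).card + 1 ≤ b)
    (hw : b ≤ (nb E true w).card) :
    Hall t (pool t (stage t v E E') (fun _ => w)) {t.root} {w} := by
  have hsr : stage t v E E' t.root = E := by simp [stage]
  have hrk : (t.kids t.root).Nonempty := card_pos.1 (by have := hs.lt; omega)
  intro S hS
  rcases subset_singleton_iff.1 hS with rfl | rfl
  · simp
  · rw [sum_singleton, singleton_biUnion]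
    unfold pool
    rw [hsr, t.side_root, sdiff_singleton_eq_erase, erase_eq_of_notMem (hE.irrefl _ _)]
    have h1 := RTree.sum_kids_add_inner_le (t := t) (P := {t.root}) (X := {t.root})
      (Z := {t.root}) (by simpa using hrk) (by simpa using hrk)
    rw [sum_singleton, sum_singleton, card_compl, hW, card_singleton] at h1
    have h2 := RTree.extra_inner (t := t) (P := {t.root}) t.root
    have h3 : t.pend {t.root} t.root = t.kids t.root := by
      unfold RTree.pend
      rw [sdiff_singleton_eq_erase, erase_eq_of_notMem (fun h => (RTree.mem_kids.1 h).1 rfl)]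
    unfold RTree.demand
    rw [h3] at h2 ⊢
    beta_reduce
    omega

set_option maxHeartbeats 2000000 in
lemma exists_start (hE : Host E c) (hE' : E' ⊆ E) (hW : Fintype.card W = k + 1) (hs : Second t v)
    (hz : PathSizes k c (t.kids t.root).card (t.kids v).card b νv m)
    (hm : ∀ s, MinDeg E' s m) (hw : b ≤ (nb E true w).card) (hwne : (nb E' true w).Nonempty)
    (hpair : ∀ p, p ≠ w → (nb E' (t.side v) p).Nonempty →
      k ≤ ((nb E true w ∪ nb E (t.side v) p).erase w).card ∧ νv ≤ (nb E (t.side v) p).card) :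
    (∃ P f, PathState t E E' v w P f) ∨ ∃ P f, HubState t E v b νv P f := by
  have hpe := PE.base t E w
  have hvP : v ∉ ({t.root} : Finset W) := by simpa using hs.ne
  obtain ⟨x, hxP, hxp, hxa, hxk⟩ := hpe.closed.exists_anc hvP
  have hx0 : x ≠ t.root := by simpa using hxP
  have hxr : t.par x = t.root := by simpa using hxp
  replace hxk : (t.kids x).Nonempty := by
    rcases hxk with rfl | h
    exacts [card_pos.1 hs.pos, h]
  have hrk : (t.kids t.root).Nonempty := card_pos.1 (by have := hs.lt; omega)
  have hall := hall_root (E' := E') hE hW hs hz.u_le hz.u_lt hw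
  obtain ⟨Q, hQ, hxQ, -, -, hold⟩ := hall.exists_tight hx0 hxP hxp (Or.inl hxk)
  have hQ0 : Q = ∅ := by
    rcases subset_singleton_iff.1 hQ with rfl | rfl
    · rfl
    · exact absurd hxp hxQ
  subst hQ0
  have hsr : stage t v E E' t.root = E := by simp [stage]
  obtain ⟨p, hp⟩ := hwne
  have hpw : p ≠ w := by
    rintro rfl
    exact hE.irrefl _ _ (nb_mono hE' _ _ hp)
  have hpool : pool t (stage t v E E') (fun _ => w) t.root = nb E true w := by
    unfold pool
    rw [hsr, t.side_root]
  have hp' : p ∈ pool t (stage t v E E') (fun _ => w) (t.par x) := by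
    rw [hxr, hpool]
    exact nb_mono hE' _ _ hp
  replace hold := hold p (by simp [hp', hpw])
  have hnbx : (nb E' (t.side x) p).Nonempty := by
    refine ⟨w, ?_⟩
    rw [t.side_par hx0, hxr, t.side_root, ← mem_nb_not]
    exact hp
  have hpS : p ∉ nb (stage t v E E' x) (t.side x) p := fun h =>
    hE.irrefl _ _ (nb_mono (stage_subset hE' x) _ _ h)
  have hleaf : ∀ q ∈ insert x ({t.root} : Finset W), (t.kids q).Nonempty := by
    intro q hq
    rcases mem_insert.1 hq with rfl | hq
    · exact hxk
    · rw [mem_singleton.1 hq]; exact hrk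
  have hcard : (insert x ({t.root} : Finset W)).card = 2 := by
    rw [card_insert_of_notMem hxP, card_singleton]
  have dz := RTree.demand_cases t (insert x {t.root})
  have hroot := RTree.demand_root_le (t := t) (P := insert x {t.root}) (mem_insert_self _ _) hx0
  rw [hxr] at hroot
  have hroot' := RTree.extra_inner (t := t) (P := insert x {t.root}) t.root
  have dx := dz x
  have du := dz t.root
  have B := hs.bound_set hW hleaf
  have hk := hs.lt
  have hkp := hs.pos
  have hkx := hs.max x hx0
  obtain ⟨z1, z2, z3, z4, z5, z6, z7, z8, z9, z10, z11, z12⟩ := hz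
  clear z7
  have hH : Hall t (Function.update (pool t (stage t v E E') (fun _ => w)) x
      (nb (stage t v E E' x) (t.side x) p)) (insert x {t.root}) (insert p {w}) := by
    have hsub : ∀ A : Finset V, A.card ≤ (A \ insert p {w}).card + 2 := by
      intro A
      have e1 := card_sdiff_add_card_inter A (insert p {w})
      have e2 : (A ∩ insert p {w}).card ≤ 2 := (card_le_card inter_subset_right).trans card_le_two
      omega
    have hsub' : (nb (stage t v E E' x) (t.side x) p).card
        ≤ (nb (stage t v E E' x) (t.side x) p \ insert p {w}).card + 1 := by
      rw [sdiff_insert, erase_eq_of_notMem (fun h => hpS (mem_sdiff.1 h).1),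
        sdiff_singleton_eq_erase]
      have := pred_card_le_card_erase (s := nb (stage t v E E' x) (t.side x) p) (a := w)
      omega
    by_cases hxv : x = v
    · subst hxv
      have hsx : stage t x E E' x = E := by simp [stage]
      rw [hsx] at hsub' ⊢
      obtain ⟨q1, q2⟩ := hpair p hpw hnbx
      have b1 := B ∅ {x} (by simp) (by simp) (by simp)
      simp only [sum_empty, sum_singleton, card_empty] at b1
      refine hall_insert hpe.closed hxp hold (by omega) ?_ ?_
      · intro z hz
        rw [mem_singleton.1 hz, hpool]
        have e1 := RTree.sum_demand_le (hpe.closed.insert hxp) (S := {t.root, x}) (by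
          intro q hq
          simp only [mem_insert, mem_singleton] at hq ⊢
          tauto)
        rw [sum_pair hx0.symm, card_compl, hcard, hW] at e1
        have e2 := pred_card_le_card_erase (s := (nb E true w ∪ nb E (t.side x) p).erase w) (a := p)
        rw [sdiff_insert, sdiff_singleton_eq_erase]
        omega
      · intro z hz z' hz' hne
        exact absurd ((mem_singleton.1 hz).trans (mem_singleton.1 hz').symm) hne
    · have hsx : stage t v E E' x = E' := by simp [stage, hx0, hxv]
      rw [hsx] at hsub' ⊢
      have q2 := hm _ _ hnbx
      have b1 := B {x} {x} (by simpa using hxk) (by simpa using hx0.symm)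
        (by simpa using Ne.symm hxv)
      have b2 := B {x} {x, t.root} (by simpa using hxk) (by simpa using hx0.symm)
        (by simpa using Ne.symm hxv)
      simp only [sum_singleton, card_singleton, sum_pair hx0] at b1 b2
      refine hall_insert hpe.closed hxp hold (by omega) ?_ ?_
      · intro z hz
        rw [mem_singleton.1 hz, hpool]
        have e1 := hsub (nb E true w ∪ nb E' (t.side x) p)
        have e2 := card_union_add_card_inter (nb E true w) (nb E' (t.side x) p)
        have e3 := (card_le_card (inter_subset_inter (Subset.refl (nb E true w))
          (nb_mono hE' (t.side x) p))).trans (hE.codeg true (t.side x) w p hpw.symm)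
        omega
      · intro z hz z' hz' hne
        exact absurd ((mem_singleton.1 hz).trans (mem_singleton.1 hz').symm) hne
  obtain ⟨g1, g2⟩ := hpe.extend_hall (F := stage t v E E') (stage_subset hE') hxP hxp hp'
    (by simpa using hpw) (by simpa using hH)
  have hfr : Function.update (fun _ => w) x p t.root = w := Function.update_of_ne hx0.symm _ _
  by_cases hxv : x = v
  · subst hxv
    refine Or.inr ⟨_, _, hubState_of_path hE' g1 g2 hleaf ⟨x, mem_insert_self _ _, hx0, hxr⟩ ?_ ?_⟩
    · rwa [hfr]
    · rw [Function.update_self]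
      exact (hpair p hpw hnbx).2
  · refine Or.inl ⟨_, _, g1, ?_, hleaf, ⟨x, mem_insert_self _ _, hx0, hxr, hxa⟩, hfr, ?_, g2⟩
    · simp only [mem_insert, mem_singleton, not_or]
      exact ⟨Ne.symm hxv, hs.ne⟩
    · intro z hz hz0
      rcases mem_insert.1 hz with rfl | hz
      · rw [Function.update_self]
        exact hnbx
      · exact absurd (mem_singleton.1 hz) hz0

lemma PathState.exists_hub (h : PathState t E E' v w P f) (hE : Host E c) (hE' : E' ⊆ E)
    (hW : Fintype.card W = k + 1) (hs : Second t v)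
    (hz : PathSizes k c (t.kids t.root).card (t.kids v).card b νv m)
    (hm : ∀ s, MinDeg E' s m) (hw : b ≤ (nb E true w).card)
    (hu : 3 ≤ (t.kids t.root).card ∨ t.par v = t.root)
    (hpair : ∀ p, p ≠ w → (nb E' (t.side v) p).Nonempty →
      k ≤ ((nb E true w ∪ nb E (t.side v) p).erase w).card ∧ νv ≤ (nb E (t.side v) p).card) :
    ∃ P f, HubState t E v b νv P f := by
  have hu' : 3 ≤ (t.kids t.root).card := by
    refine hu.resolve_right (fun hc => ?_)
    obtain ⟨x, hxP, hx0, hxr, hxa⟩ := h.kid_mem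
    have ha : t.Anc v v := ⟨0, rfl, rfl⟩
    apply h.notMem
    rwa [ha.eq_of_dep_eq hxa (by rw [t.dep_par v hs.ne, t.dep_par x hx0, hc, hxr])]
  induction' hn : Fintype.card W - P.card using Nat.strong_induction_on with n ih generalizing P f
  obtain ⟨y, hyP, hyx, hya, hyk⟩ := h.pe.closed.exists_anc h.notMem
  by_cases hyv : y = v
  · subst hyv
    obtain ⟨f', h'⟩ := h.exists_last hE hE' hW hs hz hm hw hpair hyx
    exact ⟨_, f', h'⟩
  · obtain ⟨f', h'⟩ := h.exists_interior hE hE' hW hs hz hm hw hu' hyP hyx hya hyv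
      (hyk.resolve_left hyv)
    have := card_insert_of_notMem hyP
    have := card_le_univ (insert y P)
    exact ih _ (by omega) h' rfl

/-- Embedding by placing first the path between the two largest vertices. -/
lemma embeds_of_two_centers {m' : ℕ} (hE : Host E c) (hE' : E' ⊆ E)
    (hW : Fintype.card W = k + 1) (hs : Second t v)
    (hu : 3 ≤ (t.kids t.root).card ∨ t.par v = t.root)
    (hz : Sizes k c (t.kids t.root).card b νv m) (hm : ∀ s, MinDeg E s m)
    (hz' : PathSizes k c (t.kids t.root).card (t.kids v).card b νv m')
    (hm' : ∀ s, MinDeg E' s m') (hw : b ≤ (nb E true w).card) (hwne : (nb E' true w).Nonempty)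
    (hpair : ∀ p, p ≠ w → (nb E' (t.side v) p).Nonempty →
      k ≤ ((nb E true w ∪ nb E (t.side v) p).erase w).card ∧ νv ≤ (nb E (t.side v) p).card) :
    EmbedsRT t E := by
  rcases exists_start hE hE' hW hs hz' hm' hw hwne hpair with ⟨P, f, h⟩ | ⟨P, f, h⟩
  · obtain ⟨P', f', h'⟩ := h.exists_hub hE hE' hW hs hz' hm' hw hu hpair
    exact h'.embeds hE hW hs hz hm
  · exact h.embeds hE hW hs hz hm

end Start

section Assembly

variable {V W : Type*} [Fintype V] [DecidableEq V] [Fintype W] [DecidableEq W]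
  {t : RTree W} {E E' E₀ : Finset (V × V)} {c k : ℕ} {v : W}

lemma EmbedsRT.mono (h : E' ⊆ E) (he : EmbedsRT t E') : EmbedsRT t E := by
  obtain ⟨f, hf, hadj⟩ := he
  exact ⟨f, hf, fun y hy => nb_mono h _ _ (hadj y hy)⟩

lemma exists_nb_nonempty {n : ℕ} (h : n < E.card) : ∃ w, (nb E true w).Nonempty := by
  obtain ⟨⟨p, q⟩, he⟩ := card_pos.1 (show 0 < E.card by omega)
  exact ⟨p, q, by simpa [nb] using he⟩

lemma weight_lt {α β : ℕ} (hαβ : β + α + 1 = k) (h : (k - 1) * Fintype.card V < E.card) :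
    β * (E.image Prod.fst).card + α * (E.image Prod.snd).card < E.card := by
  have h1 := Nat.mul_le_mul_left β (card_le_univ (E.image Prod.fst))
  have h2 := Nat.mul_le_mul_left α (card_le_univ (E.image Prod.snd))
  have h3 : (k - 1) * Fintype.card V = β * Fintype.card V + α * Fintype.card V := by
    rw [← Nat.add_mul]
    congr 1
    omega
  omega

lemma Second.add_le (hs : Second t v) (hW : Fintype.card W = k + 1) :
    (t.kids t.root).card + (t.kids v).card ≤ k := by
  have h1 := t.sum_kids_univ
  have h2 := sum_le_univ_sum_of_nonneg (f := fun x => (t.kids x).card) (s := {t.root, v})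
    (fun _ => Nat.zero_le _)
  rw [sum_pair hs.ne.symm] at h2
  omega

lemma exists_second (hW : Fintype.card W = k + 1) (h2 : 2 * (t.kids t.root).card ≤ k + 2 * c)
    (hk : 12 * c + 1 ≤ k)
    (hmax : ∀ y, y ≠ t.root → (t.kids y).card + 1 ≤ (t.kids t.root).card) :
    ∃ v, Second t v ∧ (3 ≤ (t.kids t.root).card ∨ t.par v = t.root) := by
  have hsum := t.sum_kids_univ
  rw [hW] at hsum
  have hkid : ∃ y, t.par y = t.root ∧ y ≠ t.root ∧ 1 ≤ (t.kids y).card := by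
    by_contra! hcon
    have hcl : t.Closed (insert t.root (t.kids t.root)) := by
      refine ⟨mem_insert_self _ _, fun y hy h0 => ?_⟩
      rw [(RTree.mem_kids.1 ((mem_insert.1 hy).resolve_left h0)).2]
      exact mem_insert_self _ _
    have huniv : insert t.root (t.kids t.root) = univ := by
      rw [eq_univ_iff_forall]
      intro y
      by_contra hy
      obtain ⟨z, hz, hzp, -⟩ := hcl.exists_next hy
      rw [mem_insert, not_or, RTree.mem_kids] at hz
      rcases mem_insert.1 hzp with hp | hp
      · exact hz.2 ⟨hz.1, hp⟩
      · obtain ⟨p1, p2⟩ := RTree.mem_kids.1 hp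
        have := hcon _ p2 p1
        have hz' : z ∈ t.kids (t.par z) := RTree.mem_kids.2 ⟨hz.1, rfl⟩
        have := card_pos.2 ⟨z, hz'⟩
        omega
    have := congrArg card huniv
    rw [card_univ, hW] at this
    have := card_insert_le t.root (t.kids t.root)
    omega
  obtain ⟨y, hyr, hy0, hyk⟩ := hkid
  by_cases h3 : 3 ≤ (t.kids t.root).card
  · obtain ⟨v, hv, hvm⟩ := exists_max_image (univ.erase t.root) (fun x => (t.kids x).card)
      ⟨y, by simpa using hy0⟩
    have hv0 : v ≠ t.root := by simpa using hv
    have hvm' : ∀ x, x ≠ t.root → (t.kids x).card ≤ (t.kids v).card :=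
      fun x hx => hvm x (by simpa using hx)
    exact ⟨v, ⟨hv0, hyk.trans (hvm' y hy0), hmax v hv0, hvm'⟩, Or.inl h3⟩
  · refine ⟨y, ⟨hy0, hyk, hmax y hy0, fun x hx => ?_⟩, Or.inr hyr⟩
    have := hmax x hx
    omega

lemma embeds_of_small_root_of_true (hE₀ : Host E₀ c) (hcard : (k - 1) * Fintype.card V < E₀.card)
    (hW : Fintype.card W = k + 1) (hc : 1 ≤ c) (hk : 12 * c + 1 ≤ k) (hk' : k ≤ 12 * c + 12)
    (h2 : 2 * (t.kids t.root).card ≤ k + 2 * c) (hs : Second t v) (hv : t.side v = true)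
    (hu : 3 ≤ (t.kids t.root).card ∨ t.par v = t.root) : EmbedsRT t E₀ := by
  have hu3 : 3 ≤ (t.kids t.root).card := hu.resolve_right fun h => by
    rw [t.side_par hs.ne, h, t.side_root] at hv
    simp at hv
  obtain ⟨a, ha⟩ : ∃ a, a = (k + 3 * c + 4) / 3 := ⟨_, rfl⟩
  obtain ⟨E, hEE, hlt, hb, ha'⟩ := prune (a - 1) (k - a) E₀ (weight_lt (by omega) hcard)
  have hE := hE₀.mono hEE
  obtain ⟨w, hw⟩ := exists_nb_nonempty hlt
  have hbound := hs.add_le hW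
  have hlt' := hs.lt
  have hpos := hs.pos
  have hm : ∀ s, MinDeg E s (min (k + 1 - a) a) := by
    rintro (_ | _) p hp
    · have := ha' p hp; omega
    · have := hb p hp; omega
  refine EmbedsRT.mono hEE (embeds_of_two_centers (b := k + 1 - a) (νv := k + 1 - a) hE Subset.rfl
    hW hs hu ?_ hm ?_ hm ?_ hw ?_)
  · constructor <;> omega
  · constructor <;> omega
  · have := hb w hw
    omega
  · intro p hp hpn
    rw [hv] at hpn ⊢
    have h1 := hb w hw
    have h3 := hb p hpn
    have h4 := card_union_add_card_inter (nb E true w) (nb E true p)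
    have h5 := hE.codeg true true w p hp.symm
    have h6 := pred_card_le_card_erase (s := nb E true w ∪ nb E true p) (a := w)
    constructor <;> omega

lemma embeds_of_small_root_of_false (hE₀ : Host E₀ c) (hcard : (k - 1) * Fintype.card V < E₀.card)
    (hW : Fintype.card W = k + 1) (hc : 1 ≤ c) (hk : 12 * c + 1 ≤ k) (hk' : k ≤ 12 * c + 12)
    (h2 : 2 * (t.kids t.root).card ≤ k + 2 * c) (hs : Second t v) (hv : t.side v = false)
    (hu : 3 ≤ (t.kids t.root).card ∨ t.par v = t.root) : EmbedsRT t E₀ := by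
  obtain ⟨b, hbdef⟩ : ∃ b, b = max (t.kids t.root).card ((k + 2) / 2) := ⟨_, rfl⟩
  obtain ⟨E, hEE, hlt, hb, ha⟩ := prune (k - b) (b - 1) E₀ (weight_lt (by omega) hcard)
  have hE := hE₀.mono hEE
  have hbound := hs.add_le hW
  have hlt' := hs.lt
  have hpos := hs.pos
  have hm : ∀ s, MinDeg E s (min b (k + 1 - b)) := by
    rintro (_ | _) p hp
    · have := ha p hp; omega
    · have := hb p hp; omega
  rcases le_total (E.image Prod.fst).card (E.image Prod.snd).card with hp | hp
  · obtain ⟨w, hw⟩ := exists_large_nb_of_le hp hlt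
    refine EmbedsRT.mono hEE (embeds_of_two_centers (b := b) (νv := k + 1 - b) hE Subset.rfl
      hW hs hu ?_ hm ?_ hm ?_
      (card_pos.1 (show 0 < (nb E true w).card by omega)) ?_)
    · constructor <;> omega
    · constructor <;> omega
    · omega
    · intro p hp hpn
      rw [hv] at hpn ⊢
      have h1 := ha p hpn
      have h3 : nb E true w ⊆ (nb E true w ∪ nb E false p).erase w := fun q hq =>
        mem_erase.2 ⟨fun h => hE.irrefl true w (h ▸ hq), mem_union_left _ hq⟩
      have h4 := card_le_card h3
      constructor <;> omega
  · obtain ⟨E', hE', hlt2, hb', ha''⟩ := prune _ _ E (prune_trade c (by omega) hp hlt)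
    obtain ⟨w, hw⟩ := exists_nb_nonempty hlt2
    have hm' : ∀ s, MinDeg E' s (min (b - c) (k + 1 - b + c)) := by
      rintro (_ | _) p hp
      · have := ha'' p hp; omega
      · have := hb' p hp; omega
    refine EmbedsRT.mono hEE (embeds_of_two_centers (b := b) (νv := k + 1 - b + c) hE hE'
      hW hs hu ?_ hm ?_ hm' ?_ hw ?_)
    · constructor <;> omega
    · constructor <;> omega
    · have := hb w (hw.mono (nb_mono hE' _ _))
      omega
    · intro p hp hpn
      rw [hv] at hpn ⊢
      have h1 := hb w (hw.mono (nb_mono hE' _ _))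
      have h3 := (ha'' p hpn).trans (card_le_card (nb_mono hE' _ _))
      have h4 := card_union_add_card_inter (nb E true w) (nb E false p)
      have h5 := hE.codeg true false w p hp.symm
      have h6 := pred_card_le_card_erase (s := nb E true w ∪ nb E false p) (a := w)
      constructor <;> omega

lemma embeds_of_large_root (hE₀ : Host E₀ c) (hcard : (k - 1) * Fintype.card V < E₀.card)
    (hW : Fintype.card W = k + 1) (hk : 12 * c + 1 ≤ k)
    (h2 : k + 2 * c + 1 ≤ 2 * (t.kids t.root).card) : EmbedsRT t E₀ := by
  have hsum := t.sum_kids_univ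
  rw [hW] at hsum
  have hle := single_le_sum (f := fun x => (t.kids x).card) (fun _ _ => Nat.zero_le _)
    (mem_univ t.root)
  obtain ⟨κ, hκ⟩ : ∃ κ, κ = (t.kids t.root).card := ⟨_, rfl⟩
  simp only [← hκ] at h2 hle
  obtain ⟨E, hEE, hlt, hb, ha⟩ := prune (k - κ) (κ - 1) E₀ (weight_lt (by omega) hcard)
  have hE := hE₀.mono hEE
  rw [show κ - 1 + 1 = κ by omega, hκ] at hb
  rw [show k - κ + 1 = k + 1 - κ by omega, hκ] at ha
  apply EmbedsRT.mono hEE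
  rcases le_total (E.image Prod.fst).card (E.image Prod.snd).card with hp | hp
  · obtain ⟨w, hw⟩ := exists_large_nb_of_le hp hlt
    exact embeds_of_large_root_of_matched hW hE hk (w := w) (by omega) hb ha (by omega)
  · obtain ⟨E', hE', hlt2, hb', ha'⟩ := prune _ _ E (prune_trade c (by omega) hp hlt)
    obtain ⟨w, hw⟩ := exists_nb_nonempty hlt2
    rw [show κ - 1 - c + 1 = κ - c by omega, hκ] at hb'
    rw [show k - κ + c + 1 = k + 1 - κ + c by omega, hκ] at ha'
    exact embeds_of_large_root_of_trade hW hE hE' (by omega) hb hb' ha' hw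

/-- A rooted tree with `k` edges, whose root has the largest degree, embeds in every loopless pair
set with more than `(k - 1) * card V` pairs and codegrees at most `(k - 1) / 12`. -/
theorem embedsRT (hE₀ : Host E₀ c) (hcard : (k - 1) * Fintype.card V < E₀.card)
    (hW : Fintype.card W = k + 1) (hk : 12 * c + 1 ≤ k) (hk' : k ≤ 12 * c + 12)
    (hmax : ∀ y, y ≠ t.root → (t.kids y).card + 1 ≤ (t.kids t.root).card) : EmbedsRT t E₀ := by
  have hsum := t.sum_kids_univ
  rw [hW] at hsum
  rcases Nat.eq_zero_or_pos c with rfl | hc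
  · have hr : 1 ≤ (t.kids t.root).card := by
      have : 1 < Fintype.card W := by omega
      obtain ⟨y, hy⟩ := Fintype.exists_ne_of_one_lt_card this t.root
      have := hmax y hy
      omega
    have hle := single_le_sum (f := fun x => (t.kids x).card) (fun _ _ => Nat.zero_le _)
      (mem_univ t.root)
    obtain ⟨E, hEE, hlt, hb, ha⟩ := prune (k - (t.kids t.root).card) ((t.kids t.root).card - 1) E₀
      (weight_lt (by omega) hcard)
    obtain ⟨w, hw⟩ := exists_nb_nonempty hlt
    refine EmbedsRT.mono hEE (embeds_of_codeg_zero (hE₀.mono hEE) hb ha hw (by omega) ?_)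
    intro y hy
    have h1 := hmax y hy
    have h2 := sum_le_univ_sum_of_nonneg (f := fun x => (t.kids x).card) (s := {t.root, y})
      (fun _ => Nat.zero_le _)
    rw [sum_pair hy.symm] at h2
    omega
  · rcases Nat.lt_or_ge (k + 2 * c) (2 * (t.kids t.root).card) with h2 | h2
    · exact embeds_of_large_root hE₀ hcard hW hk h2
    · obtain ⟨v, hs, hu⟩ := exists_second hW h2 hk hmax
      cases hv : t.side v
      · exact embeds_of_small_root_of_false hE₀ hcard hW hc hk hk' h2 hs hv hu
      · exact embeds_of_small_root_of_true hE₀ hcard hW hc hk hk' h2 hs hv hu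

end Assembly

section Tree

variable {W : Type*} [Fintype W] [DecidableEq W] {T : W → W → Bool}

lemma Antidirected.ne (hT : Antidirected T) {x y : W} (h : T x y) : x ≠ y := by
  rintro rfl
  exact hT x x x h h

lemma Antidirected.adj_iff (hT : Antidirected T) {x y : W} :
    (underG T).Adj x y ↔ T x y ∨ T y x := by
  simp only [underG, SimpleGraph.fromRel_adj, and_iff_right_iff_imp]
  rintro (h | h)
  exacts [hT.ne h, (hT.ne h).symm]

lemma Antidirected.card_eq (hT : Antidirected T) (htree : (underG T).IsTree) :
    Fintype.card W = arcCount T + 1 := by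
  classical
  rw [← htree.card_edgeFinset]
  congr 1
  symm
  refine card_bij (fun p _ => s(p.1, p.2)) ?_ ?_ ?_
  · intro p hp
    rw [SimpleGraph.mem_edgeFinset, SimpleGraph.mem_edgeSet, hT.adj_iff]
    exact Or.inl (mem_filter.1 hp).2
  · rintro ⟨a, b⟩ hp ⟨a', b'⟩ hp' h
    simp only [mem_filter, mem_univ, true_and] at hp hp'
    rcases Sym2.eq_iff.1 h with ⟨h1, h2⟩ | ⟨h1, h2⟩
    · simp only at h1 h2
      rw [h1, h2]
    · simp only at h1 h2
      subst h1 h2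
      exact (hT _ _ _ hp hp').elim
  · intro e
    induction e with | _ a b
    intro he
    rw [SimpleGraph.mem_edgeFinset, SimpleGraph.mem_edgeSet, hT.adj_iff] at he
    rcases he with he | he
    · exact ⟨(a, b), by simpa using he, rfl⟩
    · exact ⟨(b, a), by simpa using he, Sym2.eq_swap⟩

/-- A tree can be rooted at any vertex. -/
lemma SimpleGraph.IsTree.exists_rTree {G : SimpleGraph W} (hG : G.IsTree) (u : W) :
    ∃ t : RTree W, t.root = u ∧
      ∀ x y, G.Adj x y ↔ (x ≠ u ∧ t.par x = y) ∨ (y ≠ u ∧ t.par y = x) := by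
  classical
  have hex : ∀ y, ∃ z, y ≠ u → G.Adj y z ∧ G.dist u y = G.dist u z + 1 := by
    intro y
    by_cases hy : y = u
    · exact ⟨y, fun h => absurd hy h⟩
    obtain ⟨p, hp⟩ := hG.connected.exists_walk_length_eq_dist y u
    cases p with
    | nil => exact absurd rfl hy
    | @cons _ z _ h q =>
      refine ⟨z, fun _ => ⟨h, ?_⟩⟩
      rw [SimpleGraph.Walk.length_cons, SimpleGraph.dist_comm] at hp
      have h1 := SimpleGraph.dist_le q
      have h2 := hG.connected.dist_triangle (u := u) (v := z) (w := y)
      rw [SimpleGraph.dist_comm] at h1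
      rw [SimpleGraph.dist_eq_one_iff_adj.2 h.symm] at h2
      omega
  choose par hpar using hex
  let t : RTree W := ⟨u, par, G.dist u, SimpleGraph.dist_self, fun y hy => (hpar y hy).2⟩
  refine ⟨t, rfl, fun x y => ⟨fun h => ?_, ?_⟩⟩
  · have himg : (univ.erase u).image (fun z => s(z, par z)) = G.edgeFinset := by
      refine eq_of_subset_of_card_le ?_ ?_
      · intro e he
        obtain ⟨z, hz, rfl⟩ := mem_image.1 he
        rw [SimpleGraph.mem_edgeFinset]
        exact (hpar z (ne_of_mem_erase hz)).1
      · rw [card_image_of_injOn, card_erase_of_mem (mem_univ u), card_univ, ← hG.card_edgeFinset]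
        · simp
        · intro a ha b hb hab
          have ha' : a ≠ u := by simpa using ha
          have hb' : b ≠ u := by simpa using hb
          rcases Sym2.eq_iff.1 hab with ⟨h1, -⟩ | ⟨h1, h2⟩
          · exact h1
          · have e1 := (hpar a ha').2
            have e2 := (hpar b hb').2
            rw [h2] at e1
            rw [← h1] at e2
            omega
    have he : s(x, y) ∈ (univ.erase u).image (fun z => s(z, par z)) := by
      rw [himg, SimpleGraph.mem_edgeFinset]
      exact h
    obtain ⟨z, hz, hzz⟩ := mem_image.1 he
    have hz' := ne_of_mem_erase hz
    rcases Sym2.eq_iff.1 hzz with ⟨rfl, h2⟩ | ⟨rfl, h2⟩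
    exacts [Or.inl ⟨hz', h2⟩, Or.inr ⟨hz', h2⟩]
  · rintro (⟨hx, rfl⟩ | ⟨hy, rfl⟩)
    exacts [(hpar x hx).1, (hpar y hy).1.symm]

end Tree

section Digraph

variable {V W : Type*} [Fintype V] [DecidableEq V] [Fintype W] [DecidableEq W]
  {D : V → V → Bool} {T : W → W → Bool}

/-- The arcs of a digraph, as a pair set. -/
def arcs (D : V → V → Bool) : Finset (V × V) := univ.filter (fun p => D p.1 p.2)

lemma nb_arcs (D : V → V → Bool) (s : Bool) (p : V) : nb (arcs D) s p = nbr D s p := by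
  cases s <;> ext q <;> simp [nb, nbr, arcs, outNbr, inNbr]

lemma host_arcs {c : ℕ} (hloop : Loopless D) (hfree : K2sFree D (c + 1)) : Host (arcs D) c := by
  have hirr : ∀ s p, p ∉ nb (arcs D) s p := by
    rintro (_ | _) p <;> simp [nb, arcs, hloop p]
  refine ⟨hirr, fun s s' p p' hp => ?_⟩
  by_contra! hc
  obtain ⟨S, hS, hcard⟩ := exists_subset_card_eq (Nat.succ_le_of_lt hc)
  refine hfree ⟨p, p', s, s', S, hp, hcard, fun h => ?_, fun h => ?_, ?_⟩
  · exact hirr s p (mem_inter.1 (hS h)).1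
  · exact hirr s' p' (mem_inter.1 (hS h)).2
  · rwa [nb_arcs, nb_arcs] at hS

lemma embeds_of_source {k : ℕ} (hk : 0 < k) (hloop : Loopless D)
    (hfree : K2sFree D ((k + 11) / 12)) (harcs : (k - 1) * Fintype.card V < arcCount D)
    (hT : Antidirected T) (htree : (underG T).IsTree) (hkT : arcCount T = k) {u : W}
    (hmax : ∀ y, (outNbr T y ∪ inNbr T y).card ≤ (outNbr T u ∪ inNbr T u).card)
    (hu : ∀ z, ¬ T z u) : Embeds T D := by
  obtain ⟨t, rfl, ht⟩ := htree.exists_rTree u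
  have hadj : ∀ x y, y ∈ outNbr T x ∪ inNbr T x ↔
      (x ≠ t.root ∧ t.par x = y) ∨ (y ≠ t.root ∧ t.par y = x) := by
    intro x y
    rw [← ht, hT.adj_iff]
    simp [outNbr, inNbr]
  have hW := hT.card_eq htree
  rw [hkT] at hW
  have hnr : outNbr T t.root ∪ inNbr T t.root = t.kids t.root := by
    ext y
    rw [hadj, RTree.mem_kids]
    simp
  have hny : ∀ y, y ≠ t.root → outNbr T y ∪ inNbr T y = insert (t.par y) (t.kids y) := by
    intro y hy
    ext z
    rw [hadj, mem_insert, RTree.mem_kids]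
    simp [hy, eq_comm]
  have hkids : ∀ y, y ≠ t.root → (t.kids y).card + 1 ≤ (t.kids t.root).card := by
    intro y hy
    have := hmax y
    rw [hnr, hny y hy, card_insert_of_notMem] at this
    · exact this
    · intro h
      obtain ⟨h1, h2⟩ := RTree.mem_kids.1 h
      have e1 := t.dep_par y hy
      have e2 := t.dep_par _ h1
      rw [h2] at e2
      omega
  have hside : ∀ n x, t.dep x = n → (t.side x = true → ∀ z, ¬ T z x) ∧
      (t.side x = false → ∀ z, ¬ T x z) := by
    intro n
    induction n with
    | zero =>
      intro x hx
      have : x = t.root := by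
        by_contra h
        have := t.dep_par x h
        omega
      subst this
      rw [t.side_root]
      exact ⟨fun _ => hu, by simp⟩
    | succ n ih =>
      intro x hx
      have hx0 : x ≠ t.root := by
        rintro rfl
        rw [t.dep_root] at hx
        omega
      obtain ⟨i1, i2⟩ := ih (t.par x) (by have := t.dep_par x hx0; omega)
      have ha := hT.adj_iff.1 ((ht x (t.par x)).2 (Or.inl ⟨hx0, rfl⟩))
      rw [t.side_par hx0]
      constructor
      · intro h z hz
        exact hT _ _ _ hz (ha.resolve_right (i2 (by simpa using h) x))
      · intro h z hz
        exact hT _ _ _ (ha.resolve_left (i1 (by simpa using h) x)) hz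
  have hE : Host (arcs D) ((k - 1) / 12) := by
    apply host_arcs hloop
    rwa [show (k - 1) / 12 + 1 = (k + 11) / 12 by omega]
  obtain ⟨f, hf, hfadj⟩ := embedsRT hE harcs hW (by omega) (by omega) hkids
  refine ⟨f, hf, fun x y hxy => ?_⟩
  rcases (ht x y).1 (hT.adj_iff.2 (Or.inl hxy)) with ⟨h0, rfl⟩ | ⟨h0, rfl⟩
  · have h := hfadj x h0
    cases hs : t.side (t.par x)
    · rw [hs] at h
      simpa [nb, arcs] using h
    · exact absurd hxy ((hside _ _ rfl).1 hs x)
  · have h := hfadj y h0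
    cases hs : t.side (t.par y)
    · exact absurd hxy ((hside _ _ rfl).2 hs y)
    · rw [hs] at h
      simpa [nb, arcs] using h

lemma nbr_flip (D : V → V → Bool) (s : Bool) (p : V) : nbr (flip D) s p = nbr D (!s) p := by
  cases s
  · show inNbr (flip D) p = outNbr D p
    ext q
    rw [inNbr, outNbr, mem_filter, mem_filter]
    rfl
  · show outNbr (flip D) p = inNbr D p
    ext q
    rw [inNbr, outNbr, mem_filter, mem_filter]
    rfl

lemma K2sFree.flip {s : ℕ} (h : K2sFree D s) : K2sFree (flip D) s := by
  rintro ⟨a, b, sa, sb, S, h1, h2, h3, h4, h5⟩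
  rw [nbr_flip, nbr_flip] at h5
  exact h ⟨a, b, !sa, !sb, S, h1, h2, h3, h4, h5⟩

lemma arcCount_flip (D : V → V → Bool) : arcCount (flip D) = arcCount D := by
  refine card_bij (fun p _ => p.swap) ?_ ?_ ?_
  · exact fun p hp => mem_filter.2 ⟨mem_univ _, (mem_filter.1 hp).2⟩
  · simp
  · exact fun p hp => ⟨p.swap, mem_filter.2 ⟨mem_univ _, (mem_filter.1 hp).2⟩, p.swap_swap⟩

lemma underG_flip (T : W → W → Bool) : underG (flip T) = underG T := by
  ext x y
  simp [underG, flip, or_comm]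

end Digraph

/-- Every `𝒦_{2,s}`-free digraph (s = ⌈k/12⌉) with `n` vertices and more than
`(k−1)·n` arcs contains every antidirected tree with `k` arcs. -/
theorem stmt_0 (k : ℕ) (hk : 0 < k)
    {V : Type*} [Fintype V] [DecidableEq V]
    (D : V → V → Bool) (hloop : Loopless D)
    (hfree : K2sFree D ((k + 11) / 12))
    (harcs : (k - 1) * Fintype.card V < arcCount D)
    {W : Type*} [Fintype W] [DecidableEq W]
    (T : W → W → Bool) (hT : Antidirected T)
    (htree : (underG T).IsTree) (hkT : arcCount T = k) :
    Embeds T D := by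
  obtain ⟨w⟩ : Nonempty W := htree.connected.nonempty
  obtain ⟨u, -, hu⟩ := exists_max_image univ (fun y => (outNbr T y ∪ inNbr T y).card)
    ⟨w, mem_univ w⟩
  by_cases hs : ∃ z, T z u
  · obtain ⟨z, hz⟩ := hs
    have hT' : Antidirected (flip T) := fun x y z h1 h2 => hT z y x h2 h1
    have hu' : ∀ y, (outNbr (flip T) y ∪ inNbr (flip T) y).card
        ≤ (outNbr (flip T) u ∪ inNbr (flip T) u).card := by
      intro y
      have := hu y (mem_univ y)
      rwa [union_comm, union_comm (outNbr T u)] at this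
    obtain ⟨f, hf, hadj⟩ := embeds_of_source (D := flip D) (T := flip T) (u := u) hk
      (fun v => hloop v) hfree.flip (by rwa [arcCount_flip]) hT' (by rwa [underG_flip])
      (by rwa [arcCount_flip]) hu' (fun x hx => hT _ _ _ hz hx)
    exact ⟨f, hf, fun x y h => hadj y x h⟩
  · push Not at hs
    exact embeds_of_source hk hloop hfree harcs hT htree hkT (fun y => hu y (mem_univ y))
      (fun z => by simpa using hs z)
end

section
/- Let k be a positive integer. Every digraph D on n vertices with more than (k−1)·n arcs contains every antidirected caterpillar with k arcs, i.e., for every antidirected caterpillar T with exactly k arcs there is an embedding of T in D. -/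
open Finset

section Zigzag

variable {V W : Type*}

/-- A strict cyclic order: `C a b c` says that `b` lies strictly between `a` and `c`
in clockwise order. -/
structure IsStrictCyclicOrder (C : V → V → V → Prop) : Prop where
  rotate : ∀ {a b c}, C a b c → C b c a
  asymm : ∀ {a b c}, C a b c → ¬ C c b a
  trans : ∀ {a b c d}, C a b c → C a c d → C a b d
  total : ∀ {a b c}, a ≠ b → b ≠ c → a ≠ c → C a b c ∨ C a c b

namespace IsStrictCyclicOrder

variable {C : V → V → V → Prop}

theorem not_self_left (hC : IsStrictCyclicOrder C) (a b : V) : ¬ C a a b := fun h =>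
  hC.asymm (hC.rotate h) (hC.rotate h)

theorem not_self_right (hC : IsStrictCyclicOrder C) (a b : V) : ¬ C a b b := fun h =>
  hC.not_self_left b a (hC.rotate h)

theorem trans_right (hC : IsStrictCyclicOrder C) {a b c d : V} (h : C a b d)
    (h' : C b c d) : C a c d :=
  hC.rotate (hC.trans (hC.rotate (hC.rotate h)) (hC.rotate (hC.rotate h')))

theorem reverse (hC : IsStrictCyclicOrder C) : IsStrictCyclicOrder (fun a b c => C c b a) where
  rotate h := hC.rotate (hC.rotate h)
  asymm h := hC.asymm h
  trans h h' := hC.trans_right h' h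
  total h₁ h₂ h₃ := by
    rcases hC.total h₁ h₂ h₃ with h | h
    · exact Or.inr (hC.rotate h)
    · exact Or.inl (hC.rotate h)

end IsStrictCyclicOrder

theorem exists_isStrictCyclicOrder (V : Type*) [Fintype V] :
    ∃ C : V → V → V → Prop, IsStrictCyclicOrder C := by
  let e := Fintype.equivFin V
  refine ⟨fun a b c => (e a < e b ∧ e b < e c) ∨ (e b < e c ∧ e c < e a) ∨
    (e c < e a ∧ e a < e b), ?_, ?_, ?_, ?_⟩
  · intros; omega
  · intros; omega
  · intros; omega
  · intro a b c h₁ h₂ h₃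
    have h₁' := e.injective.ne h₁
    have h₂' := e.injective.ne h₂
    have h₃' := e.injective.ne h₃
    omega

/-- The arc relation of `D`, read forwards (`true`) or backwards (`false`). -/
def SignedArc (D : V → V → Bool) (s : Bool) (a b : V) : Prop :=
  if s then D a b else D b a

theorem signedArc_not {D : V → V → Bool} {s : Bool} {a b : V} :
    SignedArc D (!s) a b ↔ SignedArc D s b a := by
  cases s <;> simp [SignedArc]

theorem SignedArc.ne {D : V → V → Bool} (hD : Loopless D) {s : Bool} {a b : V}
    (h : SignedArc D s a b) : a ≠ b := by
  rintro rfl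
  cases s <;> exact hD a h

theorem card_signedArc [Fintype V] (D : V → V → Bool) (s : Bool) [DecidablePred
    fun p : V × V => SignedArc D s p.1 p.2] :
    (univ.filter fun p : V × V => SignedArc D s p.1 p.2).card = arcCount D := by
  cases s
  · refine Finset.card_bij (fun p _ => p.swap) ?_ ?_ ?_
    · simp [SignedArc]
    · intro p _ q _ h
      exact Prod.swap_injective h
    · rintro ⟨a, b⟩ h
      exact ⟨(b, a), by simpa [SignedArc] using h, rfl⟩
  · simp [SignedArc, arcCount]

/-- `ZigzagBuilt G S F v u`: the subgraph of `G` with vertex set `S` and edge set `F` arises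
from one edge by successively attaching a new vertex to the vertex that received the previous
new vertex, or to that previous new vertex itself. The last edge attached is `vu`, with `u`
the newest vertex. -/
inductive ZigzagBuilt [DecidableEq W] (G : SimpleGraph W) :
    Finset W → Finset (Sym2 W) → W → W → Prop
  | base {v u : W} (h : G.Adj v u) : ZigzagBuilt G {v, u} {s(v, u)} v u
  | leaf {S F} {v u w : W} (hB : ZigzagBuilt G S F v u) (h : G.Adj v w) (hw : w ∉ S) :
      ZigzagBuilt G (insert w S) (insert s(v, w) F) v w
  | spine {S F} {v u w : W} (hB : ZigzagBuilt G S F v u) (h : G.Adj u w) (hw : w ∉ S) :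
      ZigzagBuilt G (insert w S) (insert s(u, w) F) u w

namespace ZigzagBuilt

variable [DecidableEq W] {G : SimpleGraph W} {S : Finset W} {F : Finset (Sym2 W)} {v u : W}

theorem adj (hB : ZigzagBuilt G S F v u) : G.Adj v u := by
  cases hB <;> assumption

theorem mem_edges (hB : ZigzagBuilt G S F v u) : s(v, u) ∈ F := by
  cases hB <;> simp

theorem mem_of_edge (hB : ZigzagBuilt G S F v u) :
    ∀ {x y : W}, s(x, y) ∈ F → x ∈ S ∧ y ∈ S := by
  induction hB with
  | base h => simp; grind
  | leaf hB h hw ih => have := ih hB.mem_edges; simp; grind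
  | spine hB h hw ih => have := ih hB.mem_edges; simp; grind

theorem left_mem (hB : ZigzagBuilt G S F v u) : v ∈ S := (hB.mem_of_edge hB.mem_edges).1

theorem right_mem (hB : ZigzagBuilt G S F v u) : u ∈ S := (hB.mem_of_edge hB.mem_edges).2

theorem adj_of_edge (hB : ZigzagBuilt G S F v u) : ∀ e ∈ F, e ∈ G.edgeSet := by
  induction hB with
  | base h => simpa
  | leaf hB h hw ih => simpa using ⟨h, ih⟩
  | spine hB h hw ih => simpa using ⟨h, ih⟩

theorem card_edges (hB : ZigzagBuilt G S F v u) : F.card + 1 = S.card := by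
  induction hB with
  | base h => simp [h.ne]
  | leaf hB h hw ih =>
    rw [card_insert_of_notMem hw, card_insert_of_notMem (fun h' => hw (hB.mem_of_edge h').2), ih]
  | spine hB h hw ih =>
    rw [card_insert_of_notMem hw, card_insert_of_notMem (fun h' => hw (hB.mem_of_edge h').2), ih]

end ZigzagBuilt

/-- A colouring of the vertices of `G` that is proper. -/
def ProperBool (G : SimpleGraph W) (col : W → Bool) : Prop :=
  ∀ x y, G.Adj x y → col y = !col x

/-- `f` sends the edges of `F` to arcs of `D`, oriented from colour `true` to colour `false`. -/
def MapsEdges (D : V → V → Bool) (col : W → Bool) (F : Finset (Sym2 W)) (f : W → V) : Prop :=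
  ∀ x y, s(x, y) ∈ F → SignedArc D (col x) (f x) (f y)

/-- The pair `(a, b)` is the image of `(v, u)` under an embedding of the graph `(S, F)` in `D`
that avoids the open clockwise interval from `b` to `a`. -/
def IsGoodPair (D : V → V → Bool) (col : W → Bool) (C : V → V → V → Prop)
    (S : Finset W) (F : Finset (Sym2 W)) (v u : W) (a b : V) : Prop :=
  ∃ f : W → V, Set.InjOn f S ∧ MapsEdges D col F f ∧ f v = a ∧ f u = b ∧
    ∀ z ∈ S, ¬ C b (f z) a

section Extend

variable [DecidableEq W] {G : SimpleGraph W} {S : Finset W} {F : Finset (Sym2 W)}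
  {D : V → V → Bool} {col : W → Bool} {C : V → V → V → Prop}

theorem injOn_update {f : W → V} (hf : Set.InjOn f S) {w : W} (hw : w ∉ S) {c : V}
    (hc : ∀ z ∈ S, f z ≠ c) : Set.InjOn (Function.update f w c) (insert w S : Finset W) := by
  intro x hx y hy hxy
  simp only [coe_insert, Set.mem_insert_iff, mem_coe] at hx hy
  by_cases hxw : x = w <;> by_cases hyw : y = w
  · rw [hxw, hyw]
  · subst hxw
    simp only [Function.update_self, Function.update_of_ne hyw] at hxy
    exact absurd hxy.symm (hc y (hy.resolve_left hyw))
  · subst hyw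
    simp only [Function.update_self, Function.update_of_ne hxw] at hxy
    exact absurd hxy (hc x (hx.resolve_left hxw))
  · simp only [Function.update_of_ne hxw, Function.update_of_ne hyw] at hxy
    exact hf (hx.resolve_left hxw) (hy.resolve_left hyw) hxy

theorem mapsEdges_update {f : W → V} (hcol : ProperBool G col) (hf : MapsEdges D col F f)
    (hF : ∀ {x y : W}, s(x, y) ∈ F → x ∈ S ∧ y ∈ S) {p w : W} (hpw : G.Adj p w) (hw : w ∉ S)
    {c : V} (hc : SignedArc D (col p) (f p) c) :
    MapsEdges D col (insert s(p, w) F) (Function.update f w c) := by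
  intro x y hxy
  rw [mem_insert, Sym2.eq_iff] at hxy
  rcases hxy with (⟨rfl, rfl⟩ | ⟨rfl, rfl⟩) | hxy
  · rwa [Function.update_self, Function.update_of_ne hpw.ne]
  · rw [Function.update_self, Function.update_of_ne hpw.ne, hcol _ _ hpw, signedArc_not]
    exact hc
  · have hx : x ≠ w := fun h => hw (h ▸ (hF hxy).1)
    have hy : y ≠ w := fun h => hw (h ▸ (hF hxy).2)
    rw [Function.update_of_ne hx, Function.update_of_ne hy]
    exact hf x y hxy

variable {v u w : W} {a b c : V}

theorem IsGoodPair.signedArc (hB : ZigzagBuilt G S F v u)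
    (h : IsGoodPair D col C S F v u a b) : SignedArc D (col v) a b := by
  obtain ⟨f, -, hf, rfl, rfl, -⟩ := h
  exact hf _ _ hB.mem_edges

theorem IsGoodPair.leaf (hC : IsStrictCyclicOrder C) (hcol : ProperBool G col)
    (hB : ZigzagBuilt G S F v u) (hvw : G.Adj v w) (hw : w ∉ S)
    (h : IsGoodPair D col C S F v u a b) (hac : SignedArc D (col v) a c) (hbc : C b c a) :
    IsGoodPair D col C (insert w S) (insert s(v, w) F) v w a c := by
  obtain ⟨f, hinj, hf, rfl, rfl, hfree⟩ := h
  refine ⟨Function.update f w c, injOn_update hinj hw fun z hz hzc => hfree z hz (hzc ▸ hbc),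
    mapsEdges_update hcol hf hB.mem_of_edge hvw hw hac, Function.update_of_ne hvw.ne _ _,
    Function.update_self _ _ _, fun z hz => ?_⟩
  by_cases hzw : z = w
  · subst hzw
    rw [Function.update_self]
    exact hC.not_self_left _ _
  · rw [Function.update_of_ne hzw]
    exact fun h => hfree z ((mem_insert.1 hz).resolve_left hzw) (hC.trans_right hbc h)

theorem IsGoodPair.spine (hC : IsStrictCyclicOrder C) (hcol : ProperBool G col)
    (hB : ZigzagBuilt G S F v u) (huw : G.Adj u w) (hw : w ∉ S)
    (h : IsGoodPair D col (fun x y z => C z y x) S F v u a b)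
    (hbc : SignedArc D (col u) b c) (hcb : C a c b) :
    IsGoodPair D col C (insert w S) (insert s(u, w) F) u w b c := by
  obtain ⟨f, hinj, hf, rfl, rfl, hfree⟩ := h
  refine ⟨Function.update f w c, injOn_update hinj hw fun z hz hzc => hfree z hz (hzc ▸ hcb),
    mapsEdges_update hcol hf hB.mem_of_edge huw hw hbc, Function.update_of_ne huw.ne _ _,
    Function.update_self _ _ _, fun z hz => ?_⟩
  by_cases hzw : z = w
  · subst hzw
    rw [Function.update_self]
    exact hC.not_self_left _ _
  · rw [Function.update_of_ne hzw]
    exact fun h => hfree z ((mem_insert.1 hz).resolve_left hzw) (hC.trans_right hcb h)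

end Extend

open Classical in
theorem card_filter_le_add_of_fiber_subsingleton [Fintype V] {P Q : V × V → Prop}
    (g : V × V → V) (h : ∀ p q, P p → ¬ Q p → P q → ¬ Q q → g p = g q → p = q) :
    (univ.filter P).card ≤ (univ.filter Q).card + Fintype.card V := by
  have h₁ : (univ.filter fun p => P p ∧ ¬ Q p).card ≤ Fintype.card V := by
    refine card_le_card_of_injOn g (fun _ _ => mem_univ _) ?_
    intro p hp q hq hpq
    simp only [coe_filter, mem_univ, true_and, Set.mem_ofPred_eq] at hp hq
    exact h p q hp.1 hp.2 hq.1 hq.2 hpq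
  have h₂ : univ.filter P ⊆ univ.filter Q ∪ univ.filter fun p => P p ∧ ¬ Q p := by
    intro p
    simp only [mem_filter, mem_univ, true_and, mem_union]
    tauto
  have h₃ := (card_le_card h₂).trans (card_union_le _ _)
  omega

open Classical in
theorem ZigzagBuilt.arcCount_le [Fintype V] [DecidableEq W] {G : SimpleGraph W}
    {S : Finset W} {F : Finset (Sym2 W)} {v u : W} {D : V → V → Bool} {col : W → Bool}
    (hD : Loopless D) (hcol : ProperBool G col) (hB : ZigzagBuilt G S F v u) :
    ∀ {C : V → V → V → Prop}, IsStrictCyclicOrder C →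
      arcCount D + Fintype.card V ≤
        (univ.filter fun p : V × V => IsGoodPair D col C S F v u p.1 p.2).card +
          F.card * Fintype.card V := by
  induction hB with
  | @base v u h =>
    intro C hC
    rw [← card_signedArc D (col v), card_singleton, one_mul]
    refine Nat.add_le_add_right (card_le_card fun p => ?_) _
    simp only [mem_filter, mem_univ, true_and]
    intro hp
    have hne := hp.ne hD
    have hu : Function.update (fun _ => p.1) u p.2 u = p.2 := Function.update_self _ _ _
    have hv : Function.update (fun _ => p.1) u p.2 v = p.1 := Function.update_of_ne h.ne _ _
    refine ⟨Function.update (fun _ => p.1) u p.2, ?_, ?_, hv, hu, ?_⟩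
    · intro x hx y hy
      simp only [coe_insert, coe_singleton, Set.mem_insert_iff, Set.mem_singleton_iff] at hx hy
      rcases hx with rfl | rfl <;> rcases hy with rfl | rfl <;> simp [hv, hne, hne.symm]
    · intro x y hxy
      rw [mem_singleton, Sym2.eq_iff] at hxy
      rcases hxy with ⟨rfl, rfl⟩ | ⟨rfl, rfl⟩
      · rwa [hu, hv]
      · rw [hu, hv, hcol _ _ h, signedArc_not]
        exact hp
    · intro z hz
      rw [mem_insert, mem_singleton] at hz
      rcases hz with rfl | rfl
      · rw [hv]
        exact hC.not_self_right _ _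
      · rw [hu]
        exact hC.not_self_left _ _
  | @leaf S F v u w hB h hw ih =>
    intro C hC
    have key := card_filter_le_add_of_fiber_subsingleton
      (P := fun p : V × V => IsGoodPair D col C S F v u p.1 p.2)
      (Q := fun p : V × V => IsGoodPair D col C (insert w S) (insert s(v, w) F) v w p.1 p.2)
      Prod.fst (by
        rintro ⟨a, b⟩ ⟨a', c⟩ hp hp' hq hq' (rfl : a = a')
        by_contra hne
        have hbc : b ≠ c := fun hbc => hne (by rw [hbc])
        have hb := hp.signedArc hB
        have hc := hq.signedArc hB
        rcases hC.total (hb.ne hD) hbc (hc.ne hD) with h' | h'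
        · exact hq' (hp.leaf hC hcol hB h hw hc (hC.rotate h'))
        · exact hp' (hq.leaf hC hcol hB h hw hb (hC.rotate h')))
    have := ih hC
    rw [card_insert_of_notMem (fun h' => hw (hB.mem_of_edge h').2), add_mul]
    omega
  | @spine S F v u w hB h hw ih =>
    intro C hC
    have key := card_filter_le_add_of_fiber_subsingleton
      (P := fun p : V × V => IsGoodPair D col (fun x y z => C z y x) S F v u p.1 p.2)
      (Q := fun p : V × V =>
        IsGoodPair D col C (insert w S) (insert s(u, w) F) u w p.2 p.1)
      Prod.snd (by
        rintro ⟨a, b⟩ ⟨c, b'⟩ hp hp' hq hq' (rfl : b = b')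
        by_contra hne
        have hac : a ≠ c := fun hac => hne (by rw [hac])
        have ha := hp.signedArc hB
        have hc := hq.signedArc hB
        have hflip : ∀ {x : V}, SignedArc D (col v) x b → SignedArc D (col u) b x := by
          intro x hx
          rwa [hcol _ _ hB.adj, signedArc_not]
        rcases hC.total (ha.ne hD).symm hac (hc.ne hD).symm with h' | h'
        · exact hq' (hp.spine hC hcol hB h hw (hflip hc) (hC.rotate h'))
        · exact hp' (hq.spine hC hcol hB h hw (hflip ha) (hC.rotate h')))
    have hswap : (univ.filter fun p : V × V =>
        IsGoodPair D col C (insert w S) (insert s(u, w) F) u w p.2 p.1).card =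
        (univ.filter fun p : V × V =>
        IsGoodPair D col C (insert w S) (insert s(u, w) F) u w p.1 p.2).card := by
      refine Finset.card_bij (fun p _ => p.swap) (by simp) (fun p _ q _ h => Prod.swap_injective h)
        ?_
      rintro ⟨a, b⟩ h
      exact ⟨(b, a), by simpa using h, rfl⟩
    have := ih hC.reverse
    rw [card_insert_of_notMem (fun h' => hw (hB.mem_of_edge h').2), add_mul]
    omega

/-- The subgraph `(S, F)` is a single vertex `c`, or is built edge by edge with last edge
containing `c`, so that a new vertex may next be attached to `c`. -/
def Attachable [DecidableEq W] (G : SimpleGraph W) (S : Finset W) (F : Finset (Sym2 W))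
    (c : W) : Prop :=
  (S = {c} ∧ F = ∅) ∨ ∃ v u, ZigzagBuilt G S F v u ∧ (c = v ∨ c = u)

section Caterpillar

variable [DecidableEq W] {G : SimpleGraph W}

theorem Attachable.mem {S : Finset W} {F : Finset (Sym2 W)} {c : W}
    (hA : Attachable G S F c) : c ∈ S := by
  rcases hA with ⟨rfl, -⟩ | ⟨v, u, hB, rfl | rfl⟩
  · exact mem_singleton_self c
  · exact hB.left_mem
  · exact hB.right_mem

theorem Attachable.attach {S : Finset W} {F : Finset (Sym2 W)} {c w : W}
    (hA : Attachable G S F c) (h : G.Adj c w) (hw : w ∉ S) :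
    ∃ F', ZigzagBuilt G (insert w S) F' c w := by
  rcases hA with ⟨rfl, rfl⟩ | ⟨v, u, hB, rfl | rfl⟩
  · exact ⟨_, Finset.pair_comm c w ▸ ZigzagBuilt.base h⟩
  · exact ⟨_, hB.leaf h hw⟩
  · exact ⟨_, hB.spine h hw⟩

theorem Attachable.attach_leaves {S : Finset W} {F : Finset (Sym2 W)} {c : W}
    (hA : Attachable G S F c) (L : Finset W) :
    (∀ w ∈ L, G.Adj c w ∧ w ∉ S) → ∃ F', Attachable G (L ∪ S) F' c := by
  induction L using Finset.induction_on with
  | empty => exact fun _ => ⟨F, by simpa using hA⟩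
  | insert w L hwL ih =>
    intro hL
    obtain ⟨F', hA'⟩ := ih fun x hx => hL x (mem_insert_of_mem hx)
    have hw := hL w (mem_insert_self _ _)
    obtain ⟨F'', hB⟩ := hA'.attach hw.1 (by simp [hwL, hw.2])
    exact ⟨F'', by rw [insert_union]; exact Or.inr ⟨_, _, hB, Or.inl rfl⟩⟩

open Classical in
theorem Attachable.exists_along_path [Fintype W] {x y : W} (P : G.Walk x y) :
    ∀ {S : Finset W} {F : Finset (Sym2 W)}, P.IsPath → Attachable G S F x →
      (∀ z ∈ P.support, z ∈ S → z = x) →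
      ∃ S' F' c, Attachable G S' F' c ∧ S ⊆ S' ∧
        ∀ w ∈ P.support, w ∈ S' ∧ ∀ z, G.Adj w z → z ∈ S' := by
  induction P with
  | @nil x =>
    intro S F _ hA _
    obtain ⟨F', hA'⟩ := hA.attach_leaves (univ.filter fun w => G.Adj x w ∧ w ∉ S) (by simp)
    refine ⟨_, F', x, hA', subset_union_right, ?_⟩
    intro w hw
    obtain rfl : w = x := by simpa using hw
    refine ⟨hA'.mem, fun z hz => ?_⟩
    by_cases hzS : z ∈ S <;> simp [hz, hzS]
  | @cons x x' y h P ih =>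
    intro S F hP hA hS
    rw [SimpleGraph.Walk.cons_isPath_iff] at hP
    have hPS : ∀ z ∈ P.support, z ∉ S := by
      intro z hz hzS
      have hzx := hS z (by simp [hz]) hzS
      exact hP.2 (hzx ▸ hz)
    obtain ⟨F₁, hA₁⟩ := hA.attach_leaves
      (univ.filter fun w => G.Adj x w ∧ w ∉ S ∧ w ∉ P.support) (by simp; tauto)
    obtain ⟨F₂, hB⟩ := hA₁.attach h (by
      simp only [mem_union, mem_filter, not_or]
      exact ⟨fun h' => h'.2.2.2 P.start_mem_support, hPS _ P.start_mem_support⟩)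
    obtain ⟨S', F', c, hA', hSS', hcov⟩ := ih hP.1 (Or.inr ⟨_, _, hB, Or.inr rfl⟩) (by
      intro z hz hzS
      simp only [mem_insert, mem_union, mem_filter, mem_univ, true_and] at hzS
      rcases hzS with h' | h' | h'
      · exact h'
      · exact absurd hz h'.2.2
      · exact absurd h' (hPS z hz))
    have hsub : S ⊆ S' := fun z hz => hSS' (by simp [hz])
    refine ⟨S', F', c, hA', hsub, ?_⟩
    intro w hw
    rw [SimpleGraph.Walk.support_cons, List.mem_cons] at hw
    rcases hw with rfl | hw
    · refine ⟨hsub hA.mem, fun z hz => ?_⟩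
      by_cases hzS : z ∈ S
      · exact hsub hzS
      by_cases hzP : z ∈ P.support
      · exact (hcov z hzP).1
      · exact hSS' (by simp [hz, hzS, hzP])
    · exact hcov w hw

theorem IsCaterpillarG.exists_attachable [Fintype W] (hG : IsCaterpillarG G) :
    ∃ F c, Attachable G univ F c := by
  obtain ⟨-, x, y, P, hP, hcov⟩ := hG
  obtain ⟨S, F, c, hA, -, hS⟩ := Attachable.exists_along_path P (S := {x}) (F := ∅) hP
    (Or.inl ⟨rfl, rfl⟩) (by simp)
  have hS' : S = univ := by
    ext v
    simp only [mem_univ, iff_true]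
    rcases hcov v with hv | ⟨w, hw, hvw⟩
    · exact (hS v hv).1
    · exact (hS w hw).2 v hvw.symm
  exact ⟨F, c, hS' ▸ hA⟩

open Classical in
theorem ZigzagBuilt.edges_eq_of_isTree [Fintype W] (hG : G.IsTree) {F : Finset (Sym2 W)}
    {v u : W} (hB : ZigzagBuilt G univ F v u) : F = G.edgeFinset := by
  refine eq_of_subset_of_card_le (fun e he => ?_) ?_
  · rw [SimpleGraph.mem_edgeFinset]
    exact hB.adj_of_edge e he
  · have h₁ := hB.card_edges
    have h₂ := hG.card_edgeFinset
    rw [card_univ] at h₁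
    omega

end Caterpillar

theorem underG_adj_of_arc {T : W → W → Bool} (hT : Antidirected T) {x y : W} (h : T x y) :
    (underG T).Adj x y := by
  rw [underG, SimpleGraph.fromRel_adj]
  exact ⟨fun hxy => hT x x x (by subst hxy; exact h) (by subst hxy; exact h), Or.inl h⟩

open Classical in
theorem card_edgeFinset_underG_le [Fintype W] (T : W → W → Bool) :
    (underG T).edgeFinset.card ≤ arcCount T := by
  refine (card_le_card fun e => ?_).trans (card_image_le (f := fun p : W × W => s(p.1, p.2)))
  induction e with
  | _ x y =>
  rw [SimpleGraph.mem_edgeFinset, SimpleGraph.mem_edgeSet, underG, SimpleGraph.fromRel_adj]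
  rintro ⟨-, h | h⟩
  · exact mem_image.2 ⟨(x, y), by simpa using h, rfl⟩
  · exact mem_image.2 ⟨(y, x), by simpa using h, Sym2.eq_swap⟩

theorem exists_properBool_underG {T : W → W → Bool} (hT : Antidirected T) :
    ∃ col, ProperBool (underG T) col ∧ ∀ x y, T x y → col x = true := by
  classical
  refine ⟨fun x => decide (∃ y, T x y), ?_, fun x y h => decide_eq_true ⟨y, h⟩⟩
  intro x y h
  rw [underG, SimpleGraph.fromRel_adj] at h
  rcases h with ⟨-, h | h⟩
  · have hx : ∃ z, T x z := ⟨y, h⟩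
    have hy : ¬ ∃ z, T y z := fun ⟨z, hz⟩ => hT x y z h hz
    simp only [hx, hy, decide_true, decide_false, Bool.not_true]
  · have hy : ∃ z, T y z := ⟨x, h⟩
    have hx : ¬ ∃ z, T x z := fun ⟨z, hz⟩ => hT y x z h hz
    simp only [hx, hy, decide_true, decide_false, Bool.not_false]

end Zigzag

/-- Every digraph on `n` vertices with more than `(k−1)·n` arcs contains
every antidirected caterpillar with `k` arcs. -/
theorem stmt_1 (k : ℕ) (hk : 0 < k)
    {V : Type*} [Fintype V] [DecidableEq V]
    (D : V → V → Bool) (hloop : Loopless D)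
    (harcs : (k - 1) * Fintype.card V < arcCount D)
    {W : Type*} [Fintype W] [DecidableEq W]
    (T : W → W → Bool) (hT : Antidirected T)
    (hcat : IsCaterpillarG (underG T)) (hkT : arcCount T = k) :
    Embeds T D := by
  classical
  obtain ⟨F, c, hA⟩ := hcat.exists_attachable
  obtain ⟨⟨x, y⟩, hxy⟩ := card_pos.1 (show 0 < arcCount T by omega)
  have hadj : (underG T).Adj x y := underG_adj_of_arc hT (by simpa using hxy)
  rcases hA with ⟨hc, -⟩ | ⟨v, u, hB, -⟩
  · have hx : x ∈ ({c} : Finset W) := hc ▸ mem_univ x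
    have hy : y ∈ ({c} : Finset W) := hc ▸ mem_univ y
    exact absurd ((mem_singleton.1 hx).trans (mem_singleton.1 hy).symm) hadj.ne
  obtain ⟨C, hC⟩ := exists_isStrictCyclicOrder V
  have hF := hB.edges_eq_of_isTree hcat.1
  have hFk : F.card ≤ k := by
    rw [hF, ← hkT]
    exact card_edgeFinset_underG_le T
  obtain ⟨col, hcol, hcolT⟩ := exists_properBool_underG hT
  have hle := hB.arcCount_le hloop hcol hC
  have hmul : F.card * Fintype.card V ≤ (k - 1) * Fintype.card V + Fintype.card V := by
    rw [← Nat.succ_mul]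
    exact Nat.mul_le_mul_right _ (by omega)
  obtain ⟨p, hp⟩ := card_pos.1 (show 0 < (univ.filter fun p : V × V =>
    IsGoodPair D col C univ F v u p.1 p.2).card by omega)
  obtain ⟨f, hinj, hf, -⟩ := (mem_filter.1 hp).2
  refine ⟨f, fun a b hab => hinj (mem_coe.2 (mem_univ a)) (mem_coe.2 (mem_univ b)) hab,
    fun a b hab => ?_⟩
  have h := hf a b (by
    rw [hF, SimpleGraph.mem_edgeFinset]
    exact underG_adj_of_arc hT hab)
  simpa [SignedArc, hcolT a b hab] using h
end
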